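/- arXiv:1007.2080 — 2 statements merged into one kernel-verified Lean document; each statement's English description precedes it below -/
import Mathlib

section
/- Let G = A ∗ B be the free product of two residually finite groups A and B. Let u₁, …, uₙ be elements of G such that no uᵢ lies in any conjugate of A or of B, and such that for all i ≠ j the elements uᵢ and uⱼ do not lie in conjugate cyclic subgroups (i.e., there exist no g, c ∈ G and integers k, l with uᵢ = c^k and g·uⱼ·g⁻¹ = c^l). Then there exists a positive integer K such that for every sequence of positive integers l₁, …, lₙ there exists a finite group H and a surjective group homomorphism φ : G → H such that the order of φ(uᵢ) equals K·lᵢ for every i. -/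
open scoped Monoid.Coprod

namespace FreeProductOmnipotence

section IntProd

variable {G : Type*} [Group G]

/-- The ordered product `s (n - 1) * ⋯ * s 1 * s 0`. -/
def natProd (s : ℕ → G) : ℕ → G
  | 0 => 1
  | n + 1 => s n * natProd s n

/-- The two-sided ordered product of a sequence: `intProd s 0 = 1` and
`intProd s (t + 1) = s t * intProd s t`. -/
def intProd (s : ℤ → G) : ℤ → G
  | .ofNat n => natProd (fun m => s m) n
  | .negSucc n => natProd (fun m => (s (Int.negSucc m))⁻¹) (n + 1)

@[simp] lemma intProd_zero (s : ℤ → G) : intProd s 0 = 1 := rfl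

lemma intProd_natCast (s : ℤ → G) (n : ℕ) : intProd s n = natProd (fun m => s m) n := rfl

lemma intProd_add_one (s : ℤ → G) (t : ℤ) : intProd s (t + 1) = s t * intProd s t := by
  rcases t with n | n
  · rfl
  · cases n with
    | zero => simp [intProd, natProd, Int.negSucc_eq]
    | succ n =>
      have : Int.negSucc (n + 1) + 1 = Int.negSucc n := by simp [Int.negSucc_eq]
      rw [this]
      simp [intProd, natProd]

lemma intProd_add_period {s : ℤ → G} {d : ℤ} (h : Function.Periodic s d) (t : ℤ) :
    intProd s (t + d) = intProd s t * intProd s d := by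
  induction t using Int.induction_on with
  | zero => simp
  | succ n ih => rw [add_right_comm, intProd_add_one, intProd_add_one, h, ih, mul_assoc]
  | pred n ih =>
    have h1 := intProd_add_one s (-n - 1 + d)
    have h2 := intProd_add_one s (-n - 1)
    rw [show (-n - 1 + d + 1 : ℤ) = -n + d by ring, ih, h] at h1
    rw [show (-n - 1 + 1 : ℤ) = -n by ring] at h2
    rw [h2, mul_assoc] at h1
    exact (mul_left_cancel (h1.trans (by rfl))).symm.trans rfl

lemma intProd_zsmul_period {s : ℤ → G} {d : ℤ} (h : Function.Periodic s d) (t m : ℤ) :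
    intProd s (t + m * d) = intProd s t * intProd s d ^ m := by
  induction m using Int.induction_on with
  | zero => simp
  | succ n ih =>
    rw [show t + (n + 1 : ℤ) * d = t + n * d + d by ring, intProd_add_period h, ih, zpow_add_one,
      mul_assoc]
  | pred n ih =>
    have h1 := intProd_add_period h (t + (-n - 1) * d)
    rw [show t + (-n - 1 : ℤ) * d + d = t + -n * d by ring, ih] at h1
    rw [zpow_sub_one, ← mul_assoc, h1, mul_inv_cancel_right]

end IntProd

/-- An alternating word `a (k - 1) b (k - 1) ⋯ a 0 b 0` with `k > 0` and nontrivial letters,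
regarded as a cyclic word. -/
structure AltWord (A B : Type*) [Group A] [Group B] where
  /-- The number of syllable pairs. -/
  len : ℕ
  len_pos : 0 < len
  /-- The letters from `A`. -/
  a : ZMod len → A
  /-- The letters from `B`. -/
  b : ZMod len → B
  a_ne : ∀ t, a t ≠ 1
  b_ne : ∀ t, b t ≠ 1

namespace AltWord

variable {A B : Type*} [Group A] [Group B] (W : AltWord A B)

instance : NeZero W.len := ⟨W.len_pos.ne'⟩

/-- The pair of consecutive letters read at time `t`. -/
def step (t : ℤ) : A ∗ B := .inl (W.a t) * .inr (W.b t)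

lemma step_periodic : Function.Periodic W.step W.len := fun t => by simp [step]

/-- The partial product of a word at time `t`. -/
def part (t : ℤ) : A ∗ B := intProd W.step t

/-- The element represented by a word. -/
def elem : A ∗ B := W.part W.len

@[simp] lemma part_zero : W.part 0 = 1 := rfl

lemma part_add_one (t : ℤ) :
    W.part (t + 1) = .inl (W.a t) * (.inr (W.b t) * W.part t) := by
  rw [part, intProd_add_one, step, mul_assoc]; rfl

lemma part_add_mul_len (t m : ℤ) : W.part (t + m * W.len) = W.part t * W.elem ^ m :=
  intProd_zsmul_period W.step_periodic t m

end AltWord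

section Existence

variable {A B : Type*} [Group A] [Group B]

/-- The element of `A ∗ B` represented by a list of syllable pairs. -/
def listElem (l : List (A × B)) : A ∗ B :=
  (l.map fun p => (.inl p.1 * .inr p.2 : A ∗ B)).prod

@[simp] lemma listElem_nil : listElem ([] : List (A × B)) = 1 := rfl

@[simp] lemma listElem_cons (p : A × B) (l) :
    listElem (p :: l) = .inl p.1 * .inr p.2 * listElem l := by simp [listElem]

@[simp] lemma listElem_append (l l' : List (A × B)) :
    listElem (l ++ l') = listElem l * listElem l' := by simp [listElem]

lemma exists_listElem (g : A ∗ B) : ∃ l : List (A × B), listElem l = g := by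
  induction g using Monoid.Coprod.induction_on with
  | inl a => exact ⟨[(a, 1)], by simp⟩
  | inr b => exact ⟨[(1, b)], by simp⟩
  | mul x y hx hy =>
    obtain ⟨l, rfl⟩ := hx
    obtain ⟨l', rfl⟩ := hy
    exact ⟨l ++ l', by simp⟩

lemma natProd_eq_prod_reverse (f : ℕ → A ∗ B) (n : ℕ) :
    natProd f n = ((List.range n).map f).reverse.prod := by
  induction n with
  | zero => rfl
  | succ n ih => simp [natProd, ih, List.range_succ]

/-- The alternating word attached to a nonempty list of pairs of nontrivial letters. -/
lemma exists_altWord_of_list (l : List (A × B)) (hl : l ≠ []) (h : ∀ p ∈ l, p.1 ≠ 1 ∧ p.2 ≠ 1) :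
    ∃ W : AltWord A B, W.elem = listElem l := by
  have hpos : 0 < l.reverse.length := by simpa using List.length_pos_of_ne_nil hl
  have : NeZero l.reverse.length := ⟨hpos.ne'⟩
  have hm : ∀ t : ZMod l.reverse.length, l.reverse[t.val]'(ZMod.val_lt t) ∈ l := fun t =>
    List.mem_reverse.1 (List.getElem_mem _)
  refine ⟨⟨l.reverse.length, hpos, fun t => (l.reverse[t.val]'(ZMod.val_lt t)).1,
    fun t => (l.reverse[t.val]'(ZMod.val_lt t)).2, fun t => (h _ (hm t)).1,
    fun t => (h _ (hm t)).2⟩, ?_⟩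
  rw [AltWord.elem, AltWord.part, intProd_natCast, natProd_eq_prod_reverse, listElem]
  have key : ∀ f : ℕ → A ∗ B, (∀ m (hm : m < l.reverse.length),
      f m = .inl (l.reverse[m]).1 * .inr (l.reverse[m]).2) →
      ((List.range l.reverse.length).map f).reverse =
        l.map fun p => (.inl p.1 * .inr p.2 : A ∗ B) := fun f hf => by
    rw [List.reverse_eq_iff, ← List.map_reverse]
    refine List.ext_getElem (by simp) fun m h1 h2 => ?_
    rw [List.getElem_map, List.getElem_map, List.getElem_range, hf]
  rw [key]
  intro m hm
  simp only [AltWord.step, Int.cast_natCast, ZMod.val_natCast_of_lt hm]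

/-- Every element of `A ∗ B` that is not conjugate into a factor is conjugate to an alternating
word. -/
lemma exists_altWord (u : A ∗ B)
    (hu : ¬ ∃ g : A ∗ B, g * u * g⁻¹ ∈ (Monoid.Coprod.inl : A →* A ∗ B).range ∨
        g * u * g⁻¹ ∈ (Monoid.Coprod.inr : B →* A ∗ B).range) :
    ∃ (W : AltWord A B) (h : A ∗ B), h * u * h⁻¹ = W.elem := by
  classical
  have hex : ∃ n : ℕ, ∃ l : List (A × B), l.length = n ∧ ∃ h, h * u * h⁻¹ = listElem l := by
    obtain ⟨l, hl⟩ := exists_listElem u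
    exact ⟨_, l, rfl, 1, by simp [hl]⟩
  obtain ⟨l, hlen, h, hl⟩ := Nat.find_spec hex
  have hmin : ∀ l' : List (A × B), l'.length < l.length → ∀ h, h * u * h⁻¹ ≠ listElem l' :=
    fun l' hl' h hh => Nat.find_min hex (hlen ▸ hl') ⟨l', rfl, h, hh⟩
  have hne : l ≠ [] := by
    rintro rfl
    exact hu ⟨h, .inl ⟨1, by simp [hl]⟩⟩
  have rot : ∀ (l₁ l₂ : List (A × B)) (k : A ∗ B), k * u * k⁻¹ = listElem (l₁ ++ l₂) →
      ∃ k' : A ∗ B, k' * u * k'⁻¹ = listElem (l₂ ++ l₁) := fun l₁ l₂ k hk =>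
    ⟨(listElem l₁)⁻¹ * k, by
      rw [mul_inv_rev, inv_inv, ← mul_assoc, mul_assoc _ k u, mul_assoc _ (k * u), hk]
      simp⟩
  obtain ⟨W, hW⟩ := exists_altWord_of_list l hne fun p hp => by
    obtain ⟨l₁, l₂, rfl⟩ := List.append_of_mem hp
    constructor
    · intro hp1
      obtain ⟨k, hk⟩ := rot (l₁ ++ [p]) l₂ h (by simpa using hl)
      rw [← List.append_assoc] at hk
      rcases List.eq_nil_or_concat (l₂ ++ l₁) with h0 | ⟨l', q, h0⟩
      · rw [h0] at hk
        exact hu ⟨k, .inr ⟨p.2, by simp [hk, hp1]⟩⟩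
      · rw [h0] at hk
        refine hmin (l' ++ [(q.1, q.2 * p.2)]) ?_ k (by simp [hk, hp1, mul_assoc])
        have := congrArg List.length h0
        simp at this ⊢
        lia
    · intro hp2
      obtain ⟨k, hk⟩ := rot l₁ (p :: l₂) h hl
      rw [List.cons_append] at hk
      rcases h0 : l₂ ++ l₁ with _ | ⟨q, l'⟩
      · rw [h0] at hk
        exact hu ⟨k, .inl ⟨p.1, by simp [hk, hp2]⟩⟩
      · rw [h0] at hk
        refine hmin ((p.1 * q.1, q.2) :: l') ?_ k (by simp [hk, hp2, mul_assoc])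
        have := congrArg List.length h0
        simp at this ⊢
        lia
  exact ⟨W, h, hl.trans hW.symm⟩

end Existence

section Separation

variable {A : Type*} [Group A]

lemma exists_finite_quotient_separating
    (hA : ∀ a : A, a ≠ 1 → ∃ (F : Type) (_ : Group F) (_ : Finite F) (ψ : A →* F), ψ a ≠ 1)
    (T : Set A) (hT : T.Finite) :
    ∃ (F : Type) (_ : Group F) (_ : Finite F) (ψ : A →* F), ∀ a ∈ T, a ≠ 1 → ψ a ≠ 1 := by
  induction T, hT using Set.Finite.induction_on with
  | empty => exact ⟨Unit, inferInstance, inferInstance, 1, by simp⟩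
  | @insert a T _ _ ih =>
    obtain ⟨F, _, _, ψ, hψ⟩ := ih
    by_cases ha : a = 1
    · exact ⟨F, _, ‹_›, ψ, by rintro b (rfl | hb) h; exacts [(h ha).elim, hψ b hb h]⟩
    · obtain ⟨F', _, _, ψ', hψ'⟩ := hA a ha
      refine ⟨F × F', inferInstance, inferInstance, ψ.prod ψ', ?_⟩
      rintro b (rfl | hb) h h1
      · exact hψ' (Prod.ext_iff.1 h1).2
      · exact hψ b hb h (Prod.ext_iff.1 h1).1

end Separation

namespace AltWord

variable {A B : Type*} [Group A] [Group B] (W : AltWord A B) {X : Type*}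
  (ρ : A ∗ B →* Equiv.Perm X)

/-- The position at time `t` of the walk from `x` that reads the cyclic word `W`. -/
def ept (x : X) (t : ℤ) : X := ρ (W.part t) x

/-- The position between times `t` and `t + 1`, after reading the letter of `B`. -/
def opt (x : X) (t : ℤ) : X := ρ (.inr (W.b t)) (W.ept ρ x t)

@[simp] lemma ept_zero (x : X) : W.ept ρ x 0 = x := by simp [ept]

lemma ept_add_one (x : X) (t : ℤ) : W.ept ρ x (t + 1) = ρ (.inl (W.a t)) (W.opt ρ x t) := by
  simp [ept, opt, part_add_one]

lemma ept_add_mul_len (x : X) (t m : ℤ) :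
    W.ept ρ x (t + m * W.len) = W.ept ρ (ρ (W.elem ^ m) x) t := by
  simp [ept, part_add_mul_len]

lemma opt_add_mul_len (x : X) (t m : ℤ) :
    W.opt ρ x (t + m * W.len) = W.opt ρ (ρ (W.elem ^ m) x) t := by
  simp [opt, ept_add_mul_len]

lemma ept_mul_len (x : X) (m : ℤ) : W.ept ρ x (m * W.len) = ρ (W.elem ^ m) x := by
  simpa using W.ept_add_mul_len ρ x 0 m

end AltWord

/-- A finite action of `A ∗ B`, free on each factor modulo the kernels of `ψA` and `ψB`, in which
the cyclic word `W` labels an embedded cycle meeting each orbit of a factor in at most one edge. -/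
structure CycleAction {A B : Type*} [Group A] [Group B] (W : AltWord A B) {F₁ F₂ : Type}
    [Group F₁] [Group F₂] (ψA : A →* F₁) (ψB : B →* F₂) where
  /-- The underlying finite set. -/
  X : Type
  finite : Finite X
  /-- The action. -/
  ρ : A ∗ B →* Equiv.Perm X
  /-- The vertices of the cycle from which a letter of `B` is read. -/
  e : ZMod W.len → X
  /-- The vertices of the cycle from which a letter of `A` is read. -/
  o : ZMod W.len → X
  inr_e : ∀ t, ρ (.inr (W.b t)) (e t) = o t
  inl_o : ∀ t, ρ (.inl (W.a t)) (o t) = e (t + 1)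
  free_inl : ∀ a x, ρ (.inl a) x = x → ψA a = 1
  free_inr : ∀ b x, ρ (.inr b) x = x → ψB b = 1
  orbit_o : ∀ a s t, ρ (.inl a) (o s) = o t → s = t
  orbit_e : ∀ b s t, ρ (.inr b) (e s) = e t → s = t

/-- The action of a group on `I × F` through left multiplication by a hom to `F`. -/
def mulLeftAct {A F : Type*} [Group A] [Group F] (ψ : A →* F) (I : Type*) :
    A →* Equiv.Perm (I × F) where
  toFun a := (Equiv.refl I).prodCongr (Equiv.mulLeft (ψ a))
  map_one' := by ext x <;> simp
  map_mul' a b := by ext x <;> simp [mul_assoc]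

@[simp] lemma mulLeftAct_apply {A F : Type*} [Group A] [Group F] (ψ : A →* F) (I : Type*) (a : A)
    (x : I × F) : mulLeftAct ψ I a x = (x.1, ψ a * x.2) := rfl

lemma exists_equiv_comp_eq {ι X Y : Type*} [Finite X] (e₀ : X ≃ Y) {f : ι → X} {g : ι → Y}
    (hf : f.Injective) (hg : g.Injective) : ∃ e : X ≃ Y, ∀ i, e (f i) = g i := by
  classical
  have := Fintype.ofFinite X
  let g' : ι → X := e₀.symm ∘ g
  have hg' : g'.Injective := e₀.symm.injective.comp hg
  let σ : {x // x ∈ Set.range f} ≃ {x // x ∈ Set.range g'} :=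
    (Equiv.ofInjective f hf).symm.trans (Equiv.ofInjective g' hg')
  refine ⟨σ.extendSubtype.trans e₀, fun i => ?_⟩
  have h := σ.extendSubtype_apply_of_mem (f i) ⟨i, rfl⟩
  have h2 : (Equiv.ofInjective f hf).symm ⟨f i, i, rfl⟩ = i := by
    rw [Equiv.symm_apply_eq]; rfl
  have h3 : (σ ⟨f i, i, rfl⟩ : X) = g' i := by
    simp only [σ, Equiv.trans_apply, h2]; rfl
  simp [h, h3, g']

lemma exists_cycleAction {A B : Type*} [Group A] [Group B] (W : AltWord A B) {F₁ F₂ : Type}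
    [Group F₁] [Group F₂] [Finite F₁] [Finite F₂] (ψA : A →* F₁) (ψB : B →* F₂)
    (ha : ∀ t, ψA (W.a t) ≠ 1) (hb : ∀ t, ψB (W.b t) ≠ 1) : Nonempty (CycleAction W ψA ψB) := by
  have : Finite (ZMod W.len) := inferInstance
  let e₀ : (ZMod W.len × F₂) × F₁ ≃ (ZMod W.len × F₁) × F₂ :=
    { toFun := fun x => ((x.1.1, x.2), x.1.2)
      invFun := fun x => ((x.1.1, x.2), x.1.2)
      left_inv := fun _ => rfl
      right_inv := fun _ => rfl }
  let e : ZMod W.len → (ZMod W.len × F₂) × F₁ := fun t => ((t - 1, 1), ψA (W.a (t - 1)))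
  let o : ZMod W.len → (ZMod W.len × F₂) × F₁ := fun t => ((t, 1), 1)
  let e' : ZMod W.len → (ZMod W.len × F₁) × F₂ := fun t => ((t, 1), 1)
  let o' : ZMod W.len → (ZMod W.len × F₁) × F₂ := fun t => ((t, 1), ψB (W.b t))
  obtain ⟨Θ, hΘ⟩ := exists_equiv_comp_eq (f := Sum.elim e o) (g := Sum.elim e' o') e₀
    (by
      refine Function.Injective.sumElim (fun s t h => ?_) (fun s t h => ?_) (fun s t h => ha (s - 1) ?_)
      · simpa [e] using (Prod.ext_iff.1 (Prod.ext_iff.1 h).1).1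
      · exact (Prod.ext_iff.1 (Prod.ext_iff.1 h).1).1
      · exact (Prod.ext_iff.1 h).2)
    (by
      refine Function.Injective.sumElim (fun s t h => ?_) (fun s t h => ?_) (fun s t h => hb t ?_)
      · exact (Prod.ext_iff.1 (Prod.ext_iff.1 h).1).1
      · exact (Prod.ext_iff.1 (Prod.ext_iff.1 h).1).1
      · exact (Prod.ext_iff.1 h).2.symm)
  have he : ∀ t, Θ (e t) = e' t := fun t => hΘ (.inl t)
  have ho : ∀ t, Θ (o t) = o' t := fun t => hΘ (.inr t)
  refine ⟨⟨(ZMod W.len × F₂) × F₁, inferInstance,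
    Monoid.Coprod.lift (mulLeftAct ψA _)
      ((Θ.symm.permCongrHom.toMonoidHom).comp (mulLeftAct ψB _)), e, o, ?_, ?_, ?_, ?_, ?_, ?_⟩⟩
  · intro t
    simp only [Monoid.Coprod.lift_apply_inr, MonoidHom.comp_apply]
    change Θ.symm (mulLeftAct ψB _ (W.b t) (Θ (e t))) = o t
    rw [Equiv.symm_apply_eq, he, ho]
    simp [e', o']
  · intro t
    simp [e, o]
  · intro a x h
    simpa using (Prod.ext_iff.1 h).2
  · intro b x h
    simp only [Monoid.Coprod.lift_apply_inr, MonoidHom.comp_apply] at h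
    change Θ.symm (mulLeftAct ψB _ b (Θ x)) = x at h
    rw [Equiv.symm_apply_eq] at h
    simpa using (Prod.ext_iff.1 h).2
  · intro a s t h
    simpa [o] using (Prod.ext_iff.1 (Prod.ext_iff.1 h).1).1
  · intro b s t h
    simp only [Monoid.Coprod.lift_apply_inr, MonoidHom.comp_apply] at h
    change Θ.symm (mulLeftAct ψB _ b (Θ (e s))) = e t at h
    rw [Equiv.symm_apply_eq, he, he] at h
    simpa [e'] using (Prod.ext_iff.1 (Prod.ext_iff.1 h).1).1

section Commensurable

variable {G : Type*} [Group G]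

lemma eq_intProd_mul {s f : ℤ → G} (h : ∀ n, f (n + 1) = s n * f n) (n : ℤ) :
    f n = intProd s n * f 0 := by
  induction n using Int.induction_on with
  | zero => simp
  | succ n ih => rw [h, intProd_add_one, ih, mul_assoc]
  | pred n ih =>
    have h1 := h (-n - 1)
    have h2 := intProd_add_one s (-n - 1)
    rw [sub_add_cancel] at h1 h2
    rw [ih, h2, mul_assoc] at h1
    exact (mul_left_cancel h1).symm

lemma commensurable_of_periodic {s s' : ℤ → G} {k k' t : ℤ} (hs : Function.Periodic s k)
    (hs' : Function.Periodic s' k') (h : ∀ n, s' n = s (t + n)) :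
    ∃ (g c : G) (i j : ℤ), intProd s k = c ^ i ∧ g * intProd s' k' * g⁻¹ = c ^ j := by
  have hs2 : Function.Periodic s k' := fun n => by
    have h1 := h (n - t + k')
    rw [hs', h] at h1
    rw [show n = t + (n - t) by ring, h1]
    ring_nf
  have hd : Function.Periodic s (Int.gcd k k' : ℤ) := by
    rw [Int.gcd_eq_gcd_ab, mul_comm, mul_comm k']
    simpa using (hs.int_mul (k.gcdA k')).add_period (hs2.int_mul (k.gcdB k'))
  obtain ⟨i, hi⟩ := Int.gcd_dvd_left (a := k) (b := k')
  obtain ⟨j, hj⟩ := Int.gcd_dvd_right (a := k) (b := k')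
  refine ⟨(intProd s t)⁻¹, intProd s (Int.gcd k k' : ℤ), i, j, ?_, ?_⟩
  · conv_lhs => rw [hi]
    simpa [mul_comm] using intProd_zsmul_period hd 0 i
  · have h1 : intProd s (t + k') = intProd s' k' * intProd s t := by
      simpa using eq_intProd_mul (s := s') (f := fun n => intProd s (t + n))
        (fun n => by rw [← add_assoc, intProd_add_one, h]) k'
    have h2 : intProd s (t + k') = intProd s t * intProd s (Int.gcd k k' : ℤ) ^ j := by
      conv_lhs => rw [hj]
      rw [mul_comm]
      exact intProd_zsmul_period hd t j
    rw [eq_mul_inv_of_mul_eq (h1.symm.trans h2)]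
    group

end Commensurable

namespace AltWord

variable {A B : Type*} [Group A] [Group B]

lemma eq_of_forall_natCast_eq {G : Type*} {f g : ℤ → G} {k k' : ℕ} (hk : 0 < k) (hk' : 0 < k')
    (hf : Function.Periodic f k) (hg : Function.Periodic g k') (h : ∀ n : ℕ, f n = g n) (n : ℤ) :
    f n = g n := by
  have hf' := (hf.int_mul (n.natAbs * k')) n
  have hg' := (hg.int_mul (n.natAbs * k)) n
  obtain ⟨m, hm⟩ := Int.eq_ofNat_of_zero_le (a := n + n.natAbs * k' * k) (by
    have h1 : (1 : ℤ) ≤ k' * k := by exact_mod_cast Nat.mul_pos hk' hk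
    have h2 : -(n.natAbs : ℤ) ≤ n := by omega
    nlinarith [Int.natCast_nonneg n.natAbs])
  simp only [Int.cast_mul, Int.cast_natCast] at hf' hg'
  rw [← hf', ← hg', show (n.natAbs : ℤ) * k * k' = n.natAbs * k' * k by ring, hm, h]

lemma commensurable_of_shift (W W' : AltWord A B) (t : ℤ)
    (ha : ∀ n : ℕ, W'.a n = W.a (t + n)) (hb : ∀ n : ℕ, W'.b n = W.b (t + n)) :
    ∃ (g c : A ∗ B) (i j : ℤ), W.elem = c ^ i ∧ g * W'.elem * g⁻¹ = c ^ j := by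
  refine commensurable_of_periodic (t := t) W.step_periodic W'.step_periodic
    (eq_of_forall_natCast_eq W'.len_pos W.len_pos W'.step_periodic ?_ fun n => ?_)
  · intro n
    beta_reduce
    rw [← add_assoc]
    exact W.step_periodic _
  · simp [step, ha, hb]

lemma commensurable_of_reverse (W W' : AltWord A B) (t : ℤ)
    (ha : ∀ n : ℕ, W'.a n = (W.a (t - n - 1))⁻¹) (hb : ∀ n : ℕ, W'.b n = (W.b (t - n))⁻¹) :
    ∃ (g c : A ∗ B) (i j : ℤ), W.elem = c ^ i ∧ g * W'.elem * g⁻¹ = c ^ j := by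
  let s : ℤ → A ∗ B := fun n =>
    (.inr (W.b ((-n : ℤ) : ZMod W.len)) * .inl (W.a ((-n - 1 : ℤ) : ZMod W.len)))⁻¹
  have hs : Function.Periodic s W.len := fun n => by
    have h1 : ((-(n + W.len) : ℤ) : ZMod W.len) = (-n : ℤ) := by push_cast; simp
    have h2 : ((-(n + W.len) - 1 : ℤ) : ZMod W.len) = (-n - 1 : ℤ) := by push_cast; simp
    simp only [s, h1, h2]
  obtain ⟨g, c, i, j, hi, hj⟩ := commensurable_of_periodic (t := -t) hs W'.step_periodic
    (eq_of_forall_natCast_eq W'.len_pos W.len_pos W'.step_periodic (fun n => by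
      rw [← add_assoc]
      exact hs _) fun n => by
        have h1 : ((-(-t + n) : ℤ) : ZMod W.len) = t - n := by push_cast; ring
        have h2 : ((-(-t + n) - 1 : ℤ) : ZMod W.len) = t - n - 1 := by push_cast; ring
        simp only [s, h1, h2, step, Int.cast_natCast, ha, hb, map_inv, mul_inv_rev])
  have hV := eq_intProd_mul (s := s) (f := fun n => .inr (W.b ((-n : ℤ) : ZMod W.len)) * W.part (-n))
    (fun n => by
      have h1 := W.part_add_one (-n - 1)
      rw [sub_add_cancel] at h1
      have h2 : -(n + 1) = -n - 1 := by ring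
      simp only [s, h1, h2]
      group) W.len
  have h3 : W.part (-W.len) = W.elem⁻¹ := by simpa using W.part_add_mul_len 0 (-1)
  simp only [neg_zero, part_zero, mul_one, h3, hi] at hV
  have h4 : ((-(W.len : ℤ) : ℤ) : ZMod W.len) = ((0 : ℤ) : ZMod W.len) := by simp
  rw [h4] at hV
  set b : A ∗ B := .inr (W.b ((0 : ℤ) : ZMod W.len))
  refine ⟨b⁻¹ * g, b⁻¹ * c * b⁻¹⁻¹, -i, j, ?_, ?_⟩
  · rw [conj_zpow, zpow_neg, eq_comm, ← inv_inj]
    rw [← eq_inv_mul_iff_mul_eq] at hV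
    rw [hV]
    group
  · rw [conj_zpow, ← hj, elem, part]
    group

end AltWord

namespace CycleAction

variable {A B : Type*} [Group A] [Group B] {W : AltWord A B} {F₁ F₂ : Type}
    [Group F₁] [Group F₂] {ψA : A →* F₁} {ψB : B →* F₂} (𝒞 : CycleAction W ψA ψB)

/-- The vertices of the distinguished cycle. -/
def cycle : Set 𝒞.X := Set.range 𝒞.e ∪ Set.range 𝒞.o

lemma inr_of_mem_e {b : B} (hb : ψB b ≠ 1) {t : ZMod W.len}
    (h : 𝒞.ρ (.inr b) (𝒞.e t) ∈ 𝒞.cycle) :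
    𝒞.ρ (.inr b) (𝒞.e t) = 𝒞.o t ∧ ψB b = ψB (W.b t) := by
  rcases h with ⟨s, hs⟩ | ⟨s, hs⟩
  · obtain rfl := 𝒞.orbit_e _ _ _ hs.symm
    exact (hb (𝒞.free_inr _ _ hs.symm)).elim
  · have h1 : 𝒞.ρ (.inr ((W.b s)⁻¹ * b)) (𝒞.e t) = 𝒞.e s := by
      rw [map_mul, map_mul, Equiv.Perm.mul_apply, ← hs, ← 𝒞.inr_e]
      simp
    obtain rfl := 𝒞.orbit_e _ _ _ h1
    have := 𝒞.free_inr _ _ h1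
    rw [map_mul, map_inv, inv_mul_eq_one] at this
    exact ⟨hs.symm, this.symm⟩

lemma inl_of_mem_o {a : A} (ha : ψA a ≠ 1) {t : ZMod W.len}
    (h : 𝒞.ρ (.inl a) (𝒞.o t) ∈ 𝒞.cycle) :
    𝒞.ρ (.inl a) (𝒞.o t) = 𝒞.e (t + 1) ∧ ψA a = ψA (W.a t) := by
  rcases h with ⟨s, hs⟩ | ⟨s, hs⟩
  · obtain ⟨s, rfl⟩ : ∃ r, s = r + 1 := ⟨s - 1, by simp⟩
    have h1 : 𝒞.ρ (.inl ((W.a s)⁻¹ * a)) (𝒞.o t) = 𝒞.o s := by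
      rw [map_mul, map_mul, Equiv.Perm.mul_apply, ← hs, ← 𝒞.inl_o]
      simp
    obtain rfl := 𝒞.orbit_o _ _ _ h1
    have := 𝒞.free_inl _ _ h1
    rw [map_mul, map_inv, inv_mul_eq_one] at this
    exact ⟨hs.symm, this.symm⟩
  · obtain rfl := 𝒞.orbit_o _ _ _ hs.symm
    exact (ha (𝒞.free_inl _ _ hs.symm)).elim

lemma inr_of_mem_o {b : B} (hb : ψB b ≠ 1) {t : ZMod W.len}
    (h : 𝒞.ρ (.inr b) (𝒞.o t) ∈ 𝒞.cycle) :
    𝒞.ρ (.inr b) (𝒞.o t) = 𝒞.e t ∧ ψB b = (ψB (W.b t))⁻¹ := by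
  have h0 : 𝒞.ρ (.inr (b * W.b t)) (𝒞.e t) = 𝒞.ρ (.inr b) (𝒞.o t) := by
    rw [map_mul, map_mul, Equiv.Perm.mul_apply, 𝒞.inr_e]
  rcases h with ⟨s, hs⟩ | ⟨s, hs⟩
  · obtain rfl := 𝒞.orbit_e _ _ _ (h0.trans hs.symm)
    have := 𝒞.free_inr _ _ (h0.trans hs.symm)
    rw [map_mul] at this
    exact ⟨hs.symm, eq_inv_of_mul_eq_one_left this⟩
  · have h1 : 𝒞.ρ (.inr ((W.b s)⁻¹ * (b * W.b t))) (𝒞.e t) = 𝒞.e s := by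
      rw [map_mul, map_mul, Equiv.Perm.mul_apply, h0, ← hs, ← 𝒞.inr_e]
      simp
    obtain rfl := 𝒞.orbit_e _ _ _ h1
    exact (hb (𝒞.free_inr _ _ hs.symm)).elim

lemma inl_of_mem_e {a : A} (ha : ψA a ≠ 1) {t : ZMod W.len}
    (h : 𝒞.ρ (.inl a) (𝒞.e (t + 1)) ∈ 𝒞.cycle) :
    𝒞.ρ (.inl a) (𝒞.e (t + 1)) = 𝒞.o t ∧ ψA a = (ψA (W.a t))⁻¹ := by
  have h0 : 𝒞.ρ (.inl (a * W.a t)) (𝒞.o t) = 𝒞.ρ (.inl a) (𝒞.e (t + 1)) := by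
    rw [map_mul, map_mul, Equiv.Perm.mul_apply, 𝒞.inl_o]
  rcases h with ⟨s, hs⟩ | ⟨s, hs⟩
  · obtain ⟨s, rfl⟩ : ∃ r, s = r + 1 := ⟨s - 1, by simp⟩
    have h1 : 𝒞.ρ (.inl ((W.a s)⁻¹ * (a * W.a t))) (𝒞.o t) = 𝒞.o s := by
      rw [map_mul, map_mul, Equiv.Perm.mul_apply, h0, ← hs, ← 𝒞.inl_o]
      simp
    obtain rfl := 𝒞.orbit_o _ _ _ h1
    exact (ha (𝒞.free_inl _ _ hs.symm)).elim
  · obtain rfl := 𝒞.orbit_o _ _ _ (h0.trans hs.symm)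
    have := 𝒞.free_inl _ _ (h0.trans hs.symm)
    rw [map_mul] at this
    exact ⟨hs.symm, eq_inv_of_mul_eq_one_left this⟩

/-- A word whose walk from some vertex stays on the distinguished cycle is commensurable
with the word of the cycle. -/
lemma commensurable_of_forall_mem (W' : AltWord A B)
    (ha : ∀ s, ψA (W'.a s) ≠ 1) (hb : ∀ s, ψB (W'.b s) ≠ 1)
    (ha' : ∀ s t, ψA (W'.a s) = ψA (W.a t) → W'.a s = W.a t)
    (hb' : ∀ s t, ψB (W'.b s) = ψB (W.b t) → W'.b s = W.b t)
    (ha'' : ∀ s t, ψA (W'.a s) = (ψA (W.a t))⁻¹ → W'.a s = (W.a t)⁻¹)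
    (hb'' : ∀ s t, ψB (W'.b s) = (ψB (W.b t))⁻¹ → W'.b s = (W.b t)⁻¹) (x : 𝒞.X)
    (he : ∀ n : ℕ, W'.ept 𝒞.ρ x n ∈ 𝒞.cycle) (ho : ∀ n : ℕ, W'.opt 𝒞.ρ x n ∈ 𝒞.cycle) :
    ∃ (g c : A ∗ B) (i j : ℤ), W.elem = c ^ i ∧ g * W'.elem * g⁻¹ = c ^ j := by
  have he0 := he 0
  rw [Nat.cast_zero, AltWord.ept_zero] at he0
  rcases he0 with ⟨t, rfl⟩ | ⟨t, rfl⟩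
  · have key : ∀ n : ℕ, W'.ept 𝒞.ρ (𝒞.e t) n = 𝒞.e (t + n) →
        (W'.ept 𝒞.ρ (𝒞.e t) (n + 1 : ℕ) = 𝒞.e (t + (n + 1 : ℕ)) ∧
        W'.a n = W.a (t + n) ∧ W'.b n = W.b (t + n)) := fun n hn => by
      have h1 := ho n
      rw [AltWord.opt, hn] at h1
      obtain ⟨h2, h3⟩ := 𝒞.inr_of_mem_e (hb _) h1
      have h4 := he (n + 1)
      push_cast at h4 ⊢
      rw [AltWord.ept_add_one, AltWord.opt, hn, h2] at h4 ⊢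
      obtain ⟨h5, h6⟩ := 𝒞.inl_of_mem_o (ha _) h4
      rw [Int.cast_natCast] at h3 h6
      rw [h5, add_assoc]
      simpa using ⟨ha' _ _ h6, hb' _ _ h3⟩
    have key' : ∀ n : ℕ, W'.ept 𝒞.ρ (𝒞.e t) n = 𝒞.e (t + n) := fun n => by
      induction n with
      | zero => simp
      | succ n ih => exact (key n ih).1
    obtain ⟨t, rfl⟩ := ZMod.intCast_surjective t
    exact W.commensurable_of_shift W' t (fun n => (key n (key' n)).2.1)
      fun n => (key n (key' n)).2.2
  · have key : ∀ n : ℕ, W'.ept 𝒞.ρ (𝒞.o t) n = 𝒞.o (t - n) →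
        (W'.ept 𝒞.ρ (𝒞.o t) (n + 1 : ℕ) = 𝒞.o (t - (n + 1 : ℕ)) ∧
        W'.a n = (W.a (t - n - 1))⁻¹ ∧ W'.b n = (W.b (t - n))⁻¹) := fun n hn => by
      have h1 := ho n
      rw [AltWord.opt, hn] at h1
      obtain ⟨h2, h3⟩ := 𝒞.inr_of_mem_o (hb _) h1
      have h4 := he (n + 1)
      push_cast at h4 ⊢
      rw [AltWord.ept_add_one, AltWord.opt, hn, h2, ← sub_add_cancel (t - (n : ZMod W.len)) 1]
        at h4
      rw [AltWord.ept_add_one, AltWord.opt, hn, h2, ← sub_add_cancel (t - (n : ZMod W.len)) 1]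
      obtain ⟨h5, h6⟩ := 𝒞.inl_of_mem_e (ha _) h4
      rw [Int.cast_natCast] at h3 h6
      rw [h5, ← sub_sub]
      simpa using ⟨ha'' _ _ h6, hb'' _ _ h3⟩
    have key' : ∀ n : ℕ, W'.ept 𝒞.ρ (𝒞.o t) n = 𝒞.o (t - n) := fun n => by
      induction n with
      | zero => simp
      | succ n ih => exact (key n ih).1
    obtain ⟨t, rfl⟩ := ZMod.intCast_surjective t
    exact W.commensurable_of_reverse W' t (fun n => (key n (key' n)).2.1)
      fun n => (key n (key' n)).2.2

end CycleAction

section FiniteGeneration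

open Matrix

/-- Finitely many invertible matrices over an algebraic extension of a finite field lie in a
finite subgroup. -/
lemma exists_finite_subgroup (k : Type) {K : Type} [Field k] [Finite k] [Field K] [Algebra k K]
    [Algebra.IsAlgebraic k K] {X : Type*} [Finite X] (γ : X → (Matrix (Fin 2) (Fin 2) K)ˣ) :
    ∃ R : Subgroup (Matrix (Fin 2) (Fin 2) K)ˣ, Finite R ∧ ∀ x, γ x ∈ R := by
  let E : Set K := Set.range (fun p : X × Fin 2 × Fin 2 => (γ p.1).1 p.2.1 p.2.2) ∪
    Set.range (fun p : X × Fin 2 × Fin 2 => (γ p.1)⁻¹.1 p.2.1 p.2.2)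
  have hE : E.Finite := (Set.finite_range _).union (Set.finite_range _)
  let k₀ := Algebra.adjoin k E
  have : Module.Finite k k₀ := Algebra.finite_adjoin_of_finite_of_isIntegral hE
    fun x _ => Algebra.IsIntegral.isIntegral x
  have : Finite k₀ := Module.finite_of_finite k
  let f : (Matrix (Fin 2) (Fin 2) k₀)ˣ →* (Matrix (Fin 2) (Fin 2) K)ˣ :=
    Units.map (k₀.val.toRingHom.mapMatrix (m := Fin 2)).toMonoidHom
  have : Finite (Matrix (Fin 2) (Fin 2) k₀) := inferInstanceAs (Finite (Fin 2 → Fin 2 → k₀))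
  have : Finite (Matrix (Fin 2) (Fin 2) k₀)ˣ := Finite.of_injective _ Units.val_injective
  refine ⟨f.range, Set.finite_range f, fun x => ?_⟩
  have h1 : ∀ a b, (γ x).1 a b ∈ k₀ := fun a b =>
    Algebra.subset_adjoin (.inl ⟨(x, a, b), rfl⟩)
  have h2 : ∀ a b, (γ x)⁻¹.1 a b ∈ k₀ := fun a b =>
    Algebra.subset_adjoin (.inr ⟨(x, a, b), rfl⟩)
  have inj : Function.Injective
      (k₀.val.toRingHom.mapMatrix : Matrix (Fin 2) (Fin 2) k₀ → Matrix (Fin 2) (Fin 2) K) :=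
    Matrix.map_injective Subtype.val_injective
  refine ⟨⟨Matrix.of fun a b => ⟨_, h1 a b⟩, Matrix.of fun a b => ⟨_, h2 a b⟩, inj ?_, inj ?_⟩, ?_⟩
  · rw [map_mul, map_one]
    exact (γ x).mul_inv
  · rw [map_mul, map_one]
    exact (γ x).inv_mul
  · ext a b
    rfl

end FiniteGeneration

section Nilpotent

open Matrix

variable {K : Type*} [Field K]

/-- The rank one nilpotent matrix with kernel spanned by `(c, 1)`. -/
def nilMat (c : K) : Matrix (Fin 2) (Fin 2) K := vecMulVec ![c, 1] ![1, -c]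

lemma nilMat_mul_self (c : K) : nilMat c * nilMat c = 0 := by
  rw [nilMat, vecMulVec_mul_vecMulVec]
  simp [dotProduct]

lemma nilMat_list_prod {X : Type*} {c : X → K} (hc : c.Injective) (x : X) (l : List X)
    (h : (x :: l).IsChain (· ≠ ·)) :
    ∃ κ : K, κ ≠ 0 ∧ ((x :: l).map fun x => nilMat (c x)).prod =
      κ • vecMulVec ![c x, 1] ![1, -c ((x :: l).getLast (by simp))] := by
  induction l generalizing x with
  | nil => exact ⟨1, one_ne_zero, by simp [nilMat]⟩
  | cons y l ih =>
    rw [List.isChain_cons_cons] at h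
    obtain ⟨κ, hκ, h2⟩ := ih y h.2
    refine ⟨κ * (c y - c x), mul_ne_zero hκ (sub_ne_zero.2 (hc.ne h.1.symm)), ?_⟩
    rw [List.map_cons, List.prod_cons, h2, nilMat, mul_smul_comm, vecMulVec_mul_vecMulVec,
      List.getLast_cons_cons, mul_smul]
    congr 1
    ext i j
    simp only [vecMulVec_apply, Matrix.smul_apply, Pi.smul_apply, smul_eq_mul, dotProduct,
      Fin.sum_univ_two, Matrix.cons_val_zero, Matrix.cons_val_one]
    ring

lemma trace_nilMat_list_prod_ne_zero {X : Type*} {c : X → K} (hc : c.Injective) (l : List X)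
    (hl : l ≠ []) (h : l.IsChain (· ≠ ·)) (h' : l.getLast hl ≠ l.head hl) :
    (l.map fun x => nilMat (c x)).prod.trace ≠ 0 := by
  obtain ⟨x, l, rfl⟩ := List.exists_cons_of_ne_nil hl
  obtain ⟨κ, hκ, h2⟩ := nilMat_list_prod hc x l h
  rw [h2, trace_smul, trace_vecMulVec]
  simp only [smul_eq_mul, ne_eq, mul_eq_zero, hκ, false_or]
  have := sub_ne_zero.2 (hc.ne h'.symm)
  simpa [dotProduct, Fin.sum_univ_two, ← sub_eq_add_neg] using this

/-- The product along `l` of the matrices `nilMat (c x)` perturbed by scalar matrices. -/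
def perturbedProd {X : Type*} (c ε : X → K) (l : List X) : Matrix (Fin 2) (Fin 2) K :=
  (l.map fun x => nilMat (c x) + ε x • (1 : Matrix (Fin 2) (Fin 2) K)).prod

open Polynomial in
lemma exists_polynomial_trace {X : Type*} (c : X → K) (E : X → K[X]) (l : List X) :
    ∃ P : K[X], ∀ r, P.eval r = (perturbedProd c (fun x => (E x).eval r) l).trace := by
  refine ⟨(l.map fun x => (nilMat (c x)).map C +
    E x • (1 : Matrix (Fin 2) (Fin 2) K[X])).prod.trace, fun r => ?_⟩
  rw [← coe_evalRingHom, AddMonoidHom.map_trace, ← RingHom.mapMatrix_apply, map_list_prod,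
    perturbedProd, List.map_map]
  congr 3
  ext x i j
  by_cases h : i = j <;> simp [h]

open Polynomial in
lemma exists_forall_eval_ne_zero [Infinite K] {ι : Type*} [Finite ι] (P : ι → K[X])
    (hP : ∀ i, P i ≠ 0) : ∃ r : K, r ≠ 0 ∧ ∀ i, (P i).eval r ≠ 0 := by
  have := Fintype.ofFinite ι
  by_contra! h
  have h1 : X * ∏ i, P i = 0 := Polynomial.funext fun r => by
    by_cases hr : r = 0
    · simp [hr]
    · obtain ⟨i, hi⟩ := h r hr
      rw [eval_mul, eval_prod, Finset.prod_eq_zero (Finset.mem_univ i) hi]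
      simp
  exact mul_ne_zero X_ne_zero (Finset.prod_ne_zero_iff.2 fun i _ => hP i) h1

variable [CharP K 2]

lemma transvection_aux (c ε : K) :
    (1 + ε⁻¹ • nilMat c) * (1 + ε⁻¹ • nilMat c) = (1 : Matrix (Fin 2) (Fin 2) K) := by
  rw [add_mul, one_mul, mul_add, mul_one, smul_mul_smul_comm, nilMat_mul_self, smul_zero, add_zero,
    add_assoc, ← add_smul, CharTwo.add_self_eq_zero, zero_smul, add_zero]

/-- The transvection `1 + ε⁻¹ N` for `N = nilMat c` in characteristic two. -/
def transvectionUnit (c ε : K) : (Matrix (Fin 2) (Fin 2) K)ˣ where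
  val := 1 + ε⁻¹ • nilMat c
  inv := 1 + ε⁻¹ • nilMat c
  val_inv := transvection_aux c ε
  inv_val := transvection_aux c ε

lemma transvectionUnit_mul_self (c ε : K) : transvectionUnit c ε * transvectionUnit c ε = 1 :=
  Units.ext (transvection_aux c ε)

lemma perturbedProd_eq {X : Type*} (c ε : X → K) (l : List X) (hε : ∀ x, ε x ≠ 0) :
    perturbedProd c ε l = (l.map ε).prod •
      ((l.map fun x => transvectionUnit (c x) (ε x)).prod : Matrix (Fin 2) (Fin 2) K) := by
  induction l with
  | nil => simp [perturbedProd]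
  | cons x l ih =>
    have h : nilMat (c x) + ε x • (1 : Matrix (Fin 2) (Fin 2) K) =
        ε x • (transvectionUnit (c x) (ε x)).1 := by
      rw [transvectionUnit, smul_add, smul_smul, mul_inv_cancel₀ (hε x), one_smul, add_comm]
    rw [perturbedProd, List.map_cons, List.prod_cons, ← perturbedProd, ih, List.map_cons,
      List.map_cons, List.prod_cons, List.prod_cons, Units.val_mul, h, smul_mul_smul_comm]

end Nilpotent

lemma exists_involutions_of_field (K : Type) [Field K] [CharP K 2] [Infinite K] [Algebra (ZMod 2) K]
    [Algebra.IsAlgebraic (ZMod 2) K] {X : Type*} [Finite X] (C : Set X) (l₀ : List X) (h₀ : ∀ x ∈ l₀, x ∈ C)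
    {J : Type*} [Finite J] (l : J → List X) (hne : ∀ j, l j ≠ [])
    (hchain : ∀ j, (l j).IsChain (· ≠ ·)) (hclosed : ∀ j, (l j).getLast (hne j) ≠ (l j).head (hne j))
    (hC : ∀ j, ∃ x ∈ l j, x ∉ C) :
    ∃ (S : Type) (_ : Group S) (_ : Finite S) (γ : X → S), (∀ x, γ x * γ x = 1) ∧
      ∀ j (g : S) (m : ℤ), g * ((l j).map γ).prod * g⁻¹ ≠ (l₀.map γ).prod ^ m := by
  classical
  obtain ⟨c, hc⟩ : ∃ c : X → K, c.Injective :=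
    ⟨fun x => Infinite.natEmbedding K (Finite.equivFin X x), (Infinite.natEmbedding K).injective.comp
      (Fin.val_injective.comp (Finite.equivFin X).injective)⟩
  have hzero : ∀ j, (perturbedProd c 0 (l j)).trace ≠ 0 := fun j => by
    simpa [perturbedProd] using
      trace_nilMat_list_prod_ne_zero hc (l j) (hne j) (hchain j) (hclosed j)
  obtain ⟨σ, hσ, hσ'⟩ : ∃ σ : K, σ ≠ 0 ∧
      ∀ j, (perturbedProd c (fun x => if x ∈ C then σ else 0) (l j)).trace ≠ 0 := by
    choose P hP using fun j =>
      exists_polynomial_trace c (fun x => if x ∈ C then Polynomial.X else 0) (l j)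
    obtain ⟨σ, hσ, h⟩ := exists_forall_eval_ne_zero P fun j hj => hzero j <| by
      simpa [hj, apply_ite, Pi.zero_def] using (hP j 0).symm
    refine ⟨σ, hσ, fun j => ?_⟩
    have := h j
    rw [hP] at this
    simpa [apply_ite] using this
  let w : (Matrix (Fin 2) (Fin 2) K)ˣ := (l₀.map fun x => transvectionUnit (c x) σ).prod
  have hw : IsOfFinOrder w := by
    obtain ⟨R, hR, hγ⟩ := exists_finite_subgroup (ZMod 2) fun x => transvectionUnit (c x) σ
    have hwR : w ∈ R := R.list_prod_mem fun g hg => by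
      obtain ⟨x, -, rfl⟩ := List.mem_map.1 hg
      exact hγ x
    exact R.subtype.isOfFinOrder (isOfFinOrder_of_finite (⟨w, hwR⟩ : R))
  have hΘ : (Set.range fun m : ℤ => ((w ^ m : (Matrix (Fin 2) (Fin 2) K)ˣ).1.trace)).Finite := by
    refine ((finite_zpowers.2 hw).image fun g => g.1.trace).subset ?_
    rintro _ ⟨m, rfl⟩
    exact ⟨w ^ m, ⟨m, rfl⟩, rfl⟩
  have := hΘ.to_subtype
  obtain ⟨τ, hτ, hτ'⟩ : ∃ τ : K, τ ≠ 0 ∧ ∀ j (m : ℤ),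
      (perturbedProd c (fun x => if x ∈ C then σ else τ) (l j)).trace ≠
        ((w ^ m : (Matrix (Fin 2) (Fin 2) K)ˣ).1.trace) *
          ((l j).map fun x => if x ∈ C then σ else τ).prod := by
    let E : X → Polynomial K := fun x => if x ∈ C then Polynomial.C σ else Polynomial.X
    have hE : ∀ r, (fun x => (E x).eval r) = fun x => if x ∈ C then σ else r := fun r => by
      ext x
      by_cases hx : x ∈ C <;> simp [E, hx]
    choose P hP using fun j => exists_polynomial_trace c E (l j)
    have hprod : ∀ j r, ((l j).map E).prod.eval r =
        ((l j).map fun x => if x ∈ C then σ else r).prod := fun j r => by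
      rw [← hE, ← Polynomial.coe_evalRingHom, map_list_prod, List.map_map]
      rfl
    obtain ⟨τ, hτ, h⟩ := exists_forall_eval_ne_zero
      (fun q : J × Set.range fun m : ℤ => ((w ^ m : (Matrix (Fin 2) (Fin 2) K)ˣ).1.trace) =>
        P q.1 - Polynomial.C q.2.1 * ((l q.1).map E).prod) fun ⟨j, θ⟩ hj => hσ' j <| by
      have h0 := congrArg (Polynomial.eval 0) hj
      obtain ⟨x, hx, hxC⟩ := hC j
      rw [Polynomial.eval_sub, Polynomial.eval_mul, hprod, hP, hE,
        List.prod_eq_zero (List.mem_map.2 ⟨x, hx, if_neg hxC⟩)] at h0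
      simpa using h0
    refine ⟨τ, hτ, fun j m hjm => h (j, ⟨_, m, rfl⟩) ?_⟩
    rw [Polynomial.eval_sub, Polynomial.eval_mul, hprod, hP, hE, hjm, Polynomial.eval_C, sub_self]
  let ε : X → K := fun x => if x ∈ C then σ else τ
  have hε : ∀ x, ε x ≠ 0 := fun x => by
    by_cases hx : x ∈ C <;> simp [ε, hx, hσ, hτ]
  let γ : X → (Matrix (Fin 2) (Fin 2) K)ˣ := fun x => transvectionUnit (c x) (ε x)
  have hw' : (l₀.map γ).prod = w := by
    refine congrArg List.prod (List.map_congr_left fun x hx => ?_)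
    simp [γ, ε, h₀ x hx]
  obtain ⟨R, hR, hγ⟩ := exists_finite_subgroup (ZMod 2) γ
  refine ⟨R, inferInstance, hR, fun x => ⟨γ x, hγ x⟩,
    fun x => Subtype.ext (transvectionUnit_mul_self _ _), fun j g m h => hτ' j m ?_⟩
  have h1 := congrArg (R.subtype) h
  simp only [map_mul, map_inv, map_zpow, map_list_prod, List.map_map] at h1
  change g.1 * ((l j).map γ).prod * (g.1)⁻¹ = (l₀.map γ).prod ^ m at h1
  rw [hw'] at h1
  rw [perturbedProd_eq c _ _ hε, ← h1, Matrix.trace_smul, Units.val_mul, Units.val_mul,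
    Matrix.trace_units_conj, smul_eq_mul, mul_comm]

/-- Given a list of points in `C` and finitely many closed walks leaving `C`, there are involutions
in a finite group, labelled by points, such that no product along one of the walks is conjugate to
a power of the product along the given list. -/
lemma exists_involutions {X : Type*} [Finite X] (C : Set X) (l₀ : List X) (h₀ : ∀ x ∈ l₀, x ∈ C)
    {J : Type*} [Finite J] (l : J → List X) (hne : ∀ j, l j ≠ [])
    (hchain : ∀ j, (l j).IsChain (· ≠ ·)) (hclosed : ∀ j, (l j).getLast (hne j) ≠ (l j).head (hne j))
    (hC : ∀ j, ∃ x ∈ l j, x ∉ C) :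
    ∃ (S : Type) (_ : Group S) (_ : Finite S) (γ : X → S), (∀ x, γ x * γ x = 1) ∧
      ∀ j (g : S) (m : ℤ), g * ((l j).map γ).prod * g⁻¹ ≠ (l₀.map γ).prod ^ m := by
  have : CharP (AlgebraicClosure (ZMod 2)) 2 :=
    charP_of_injective_algebraMap (algebraMap (ZMod 2) (AlgebraicClosure (ZMod 2))).injective 2
  have : Infinite (AlgebraicClosure (ZMod 2)) := IsAlgClosed.instInfinite
  exact exists_involutions_of_field (AlgebraicClosure (ZMod 2)) C l₀ h₀ l hne hchain hclosed hC

section Voltage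

variable {A B : Type*} [Group A] [Group B] {X Γ Y : Type*} [Group Γ] [MulAction Γ Y]
  (ρ : A ∗ B →* Equiv.Perm X) (γ : X → Γ)

/-- Permutations of `X` acting on the first factor of `X × Y`. -/
def permFst (X Y : Type*) : Equiv.Perm X →* Equiv.Perm (X × Y) where
  toFun σ := σ.prodCongr (Equiv.refl Y)
  map_one' := rfl
  map_mul' _ _ := rfl

@[simp] lemma permFst_apply (σ : Equiv.Perm X) (z : X × Y) : permFst X Y σ z = (σ z.1, z.2) := rfl

/-- The action on `X × Y` obtained by twisting the action of `A` by the voltages `γ`. -/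
def volt (Y : Type*) [MulAction Γ Y] : A ∗ B →* Equiv.Perm (X × Y) :=
  Monoid.Coprod.lift
    ((MulAut.conj (Equiv.prodShear (Equiv.refl X) fun x => MulAction.toPerm (γ x)) :
      Equiv.Perm (X × Y) ≃* Equiv.Perm (X × Y)).toMonoidHom.comp
        ((permFst X Y).comp (ρ.comp Monoid.Coprod.inl)))
    ((permFst X Y).comp (ρ.comp Monoid.Coprod.inr))

lemma volt_inl (a : A) (x : X) (y : Y) : volt ρ γ Y (.inl a) (x, y) =
    (ρ (.inl a) x, (γ (ρ (.inl a) x) * (γ x)⁻¹) • y) := by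
  rw [volt, Monoid.Coprod.lift_apply_inl, mul_smul]
  rfl

lemma volt_inr (b : B) (x : X) (y : Y) : volt ρ γ Y (.inr b) (x, y) = (ρ (.inr b) x, y) := by
  rw [volt, Monoid.Coprod.lift_apply_inr]
  rfl

/-- Equivariance of a map between two actions of `A ∗ B` can be checked on the factors. -/
lemma equivariant_of_factors {X' : Type*} {ρ : A ∗ B →* Equiv.Perm X} {ρ' : A ∗ B →* Equiv.Perm X'}
    (f : X → X') (hA : ∀ a x, f (ρ (.inl a) x) = ρ' (.inl a) (f x))
    (hB : ∀ b x, f (ρ (.inr b) x) = ρ' (.inr b) (f x)) (g : A ∗ B) (x : X) :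
    f (ρ g x) = ρ' g (f x) := by
  induction g using Monoid.Coprod.induction_on generalizing x with
  | inl a => exact hA a x
  | inr b => exact hB b x
  | mul g h hg hh => rw [map_mul, map_mul, Equiv.Perm.mul_apply, Equiv.Perm.mul_apply, hg, hh]

lemma volt_fst (g : A ∗ B) (z : X × Y) : (volt ρ γ Y g z).1 = ρ g z.1 :=
  equivariant_of_factors (ρ := volt ρ γ Y) Prod.fst (fun a z => by rw [volt_inl])
    (fun b z => by rw [volt_inr]) g z

variable (W : AltWord A B)

/-- The voltage accumulated in the first `n` steps of the walk from `x`. -/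
def hol (x : X) (n : ℕ) : Γ :=
  natProd (fun t : ℕ => γ (W.ept ρ x (t + 1)) * (γ (W.opt ρ x t))⁻¹) n

@[simp] lemma hol_zero (x : X) : hol ρ γ W x 0 = 1 := rfl

lemma hol_succ (x : X) (n : ℕ) : hol ρ γ W x (n + 1) =
    γ (W.ept ρ x (n + 1)) * (γ (W.opt ρ x n))⁻¹ * hol ρ γ W x n := rfl

lemma ept_volt (x : X) (y : Y) (n : ℕ) :
    W.ept (volt ρ γ Y) (x, y) n = (W.ept ρ x n, hol ρ γ W x n • y) := by
  induction n with
  | zero => simp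
  | succ n ih =>
    rw [Nat.cast_succ, AltWord.ept_add_one, AltWord.opt, ih, volt_inr, volt_inl, hol_succ,
      AltWord.ept_add_one, AltWord.opt, mul_smul _ (hol ρ γ W x n)]

lemma opt_volt (x : X) (y : Y) (n : ℕ) :
    W.opt (volt ρ γ Y) (x, y) n = (W.opt ρ x n, hol ρ γ W x n • y) := by
  rw [AltWord.opt, ept_volt, volt_inr]
  rfl

lemma volt_elem_pow (x : X) (y : Y) (n : ℕ) : volt ρ γ Y (W.elem ^ n) (x, y) =
    (ρ (W.elem ^ n) x, hol ρ γ W x (n * W.len) • y) := by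
  have h1 := W.ept_mul_len (volt ρ γ Y) (x, y) n
  have h2 := W.ept_mul_len ρ x n
  rw [zpow_natCast] at h1 h2
  rw [← h1, ← h2]
  exact_mod_cast ept_volt ρ γ W x y (n * W.len)

end Voltage

section Walks

variable {A B : Type*} [Group A] [Group B] {X Γ Y : Type*} [Group Γ] [MulAction Γ Y]
  (ρ : A ∗ B →* Equiv.Perm X) (γ : X → Γ) (W : AltWord A B)

/-- The list of positions at which voltages are read in the first `n` steps of the walk from `x`,
in reverse order. -/
def walkList (x : X) : ℕ → List X
  | 0 => []
  | n + 1 => W.ept ρ x (n + 1) :: W.opt ρ x n :: walkList x n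

lemma prod_map_walkList (hγ : ∀ x, γ x * γ x = 1) (x : X) (n : ℕ) :
    ((walkList ρ W x n).map γ).prod = hol ρ γ W x n := by
  induction n with
  | zero => rfl
  | succ n ih =>
    rw [walkList, List.map_cons, List.map_cons, List.prod_cons, List.prod_cons, ih, hol_succ,
      ← mul_assoc, inv_eq_of_mul_eq_one_left (hγ (W.opt ρ x n))]

variable {W}

lemma isChain_cons_walkList (h₁ : ∀ x t, ρ (.inr (W.b t)) x ≠ x)
    (h₂ : ∀ x t, ρ (.inl (W.a t)) x ≠ x) (x : X) (n : ℕ) :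
    (W.opt ρ x n :: walkList ρ W x n).IsChain (· ≠ ·) := by
  induction n with
  | zero => exact List.isChain_singleton _
  | succ n ih =>
    rw [walkList, List.isChain_cons_cons, List.isChain_cons_cons]
    refine ⟨?_, ?_, ih⟩
    · rw [AltWord.opt, Nat.cast_succ]
      exact h₁ _ _
    · rw [AltWord.ept_add_one]
      exact h₂ _ _

lemma getLast_walkList (x : X) (n : ℕ) (h : walkList ρ W x (n + 1) ≠ []) :
    (walkList ρ W x (n + 1)).getLast h = W.opt ρ x 0 := by
  induction n with
  | zero => simp [walkList]
  | succ n ih =>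
    have := ih (by simp [walkList])
    rw [← this]
    simp only [walkList, List.getLast_cons_cons]

lemma opt_mem_walkList (x : X) {t n : ℕ} (h : t < n) : W.opt ρ x t ∈ walkList ρ W x n := by
  induction n with
  | zero => lia
  | succ n ih =>
    rcases Nat.lt_succ_iff_lt_or_eq.1 h with h | rfl
    · simp [walkList, ih h]
    · simp [walkList]

lemma ept_mem_walkList (x : X) {t n : ℕ} (h : t < n) :
    W.ept ρ x (t + 1) ∈ walkList ρ W x n := by
  induction n with
  | zero => lia
  | succ n ih =>
    rcases Nat.lt_succ_iff_lt_or_eq.1 h with h | rfl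
    · simp [walkList, ih h]
    · simp [walkList]

end Walks

section Sums

variable {A B : Type*} [Group A] [Group B] {X : Type*} (ρ : A ∗ B →* Equiv.Perm X)
  (W : AltWord A B) {M : Type*} [AddCommGroup M]

/-- The sum of the increments of `θ` along the `A`-edges of the first `n` steps of the walk
from `x`. -/
def psum (x : X) (θ : X → M) (n : ℕ) : M :=
  ∑ t ∈ Finset.range n, (θ (W.ept ρ x (t + 1)) - θ (W.opt ρ x t))

lemma psum_mul_len_add (x : X) (θ : X → M) (s n : ℕ) :
    psum ρ W x θ (s * W.len + n) =
      psum ρ W x θ (s * W.len) + psum ρ W (ρ (W.elem ^ s) x) θ n := by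
  rw [psum, Finset.sum_range_add]
  congr 1
  refine Finset.sum_congr rfl fun t _ => ?_
  have h1 := W.ept_add_mul_len ρ x (t + 1) s
  have h2 := W.opt_add_mul_len ρ x t s
  rw [zpow_natCast] at h1 h2
  rw [← h1, ← h2]
  congr 3 <;> push_cast <;> ring

lemma psum_cycle_shift (x : X) (θ : X → M) (s N : ℕ) (h : ρ (W.elem ^ N) x = x) :
    psum ρ W (ρ (W.elem ^ s) x) θ (N * W.len) = psum ρ W x θ (N * W.len) := by
  have h1 := psum_mul_len_add ρ W x θ s (N * W.len)
  rw [add_comm (s * _), psum_mul_len_add, h, add_comm] at h1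
  exact (add_left_cancel h1).symm

lemma psum_mul_cycle (x : X) (θ : X → M) (m N : ℕ) (h : ρ (W.elem ^ N) x = x) :
    psum ρ W x θ (m * N * W.len) = m • psum ρ W x θ (N * W.len) := by
  induction m with
  | zero => simp [psum]
  | succ m ih =>
    have h1 : ρ (W.elem ^ (m * N)) x = x := by
      rw [mul_comm, pow_mul, map_pow]
      exact Equiv.Perm.pow_apply_eq_self_of_apply_eq_self h m
    rw [add_mul, add_mul, one_mul, psum_mul_len_add, h1, ih, succ_nsmul]

variable {ρ} in
lemma psum_comp {X' : Type*} {ρ' : A ∗ B →* Equiv.Perm X'} (f : X → X')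
    (hf : ∀ g x, f (ρ g x) = ρ' g (f x)) (x : X) (θ : X' → M) (n : ℕ) :
    psum ρ W x (fun x => θ (f x)) n = psum ρ' W (f x) θ n := by
  simp only [psum, AltWord.opt, AltWord.ept, hf]

end Sums

namespace CycleAction

variable {A B : Type*} [Group A] [Group B] {W : AltWord A B} {F₁ F₂ : Type}
    [Group F₁] [Group F₂] {ψA : A →* F₁} {ψB : B →* F₂} (𝒞 : CycleAction W ψA ψB)

lemma ept_e (n : ℕ) : W.ept 𝒞.ρ (𝒞.e 0) n = 𝒞.e n := by
  induction n with
  | zero => simp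
  | succ n ih =>
    rw [Nat.cast_succ, AltWord.ept_add_one, AltWord.opt, ih, Int.cast_natCast, 𝒞.inr_e, 𝒞.inl_o,
      Nat.cast_succ]

lemma opt_e (n : ℕ) : W.opt 𝒞.ρ (𝒞.e 0) n = 𝒞.o n := by
  rw [AltWord.opt, ept_e, Int.cast_natCast, 𝒞.inr_e]

lemma e_injective : Function.Injective 𝒞.e := fun s t h => 𝒞.orbit_e 1 s t (by simpa using h)

lemma o_ne_e (hb : ∀ t, ψB (W.b t) ≠ 1) (s t : ZMod W.len) : 𝒞.o s ≠ 𝒞.e t := fun h => by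
  rw [← 𝒞.inr_e] at h
  obtain rfl := 𝒞.orbit_e _ _ _ h
  exact hb _ (𝒞.free_inr _ _ h)

lemma elem_e : 𝒞.ρ W.elem (𝒞.e 0) = 𝒞.e 0 := by
  simpa [AltWord.ept, AltWord.elem] using 𝒞.ept_e W.len

end CycleAction

section Covers

variable {A B : Type*} [Group A] [Group B] {ι : Type*} [Finite ι] {W : ι → AltWord A B}

lemma finite_letters {G : Type*} {len : ι → ℕ} [∀ i, NeZero (len i)] (f : ∀ i, ZMod (len i) → G) :
    {g | ∃ i s, g = f i s}.Finite := by
  refine (Set.finite_range fun p : Σ i, ZMod (len i) => f p.1 p.2).subset ?_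
  rintro _ ⟨i, s, rfl⟩
  exact ⟨⟨i, s⟩, rfl⟩

lemma exists_quotient_separating_letters {G : Type*} [Group G] {len : ι → ℕ}
    [∀ i, NeZero (len i)] (f : ∀ i, ZMod (len i) → G)
    (hG : ∀ a : G, a ≠ 1 → ∃ (F : Type) (_ : Group F) (_ : Finite F) (ψ : G →* F), ψ a ≠ 1)
    (hf : ∀ i s, f i s ≠ 1) :
    ∃ (F : Type) (_ : Group F) (_ : Finite F) (ψ : G →* F), (∀ i s, ψ (f i s) ≠ 1) ∧
      (∀ i s j t, ψ (f i s) = ψ (f j t) → f i s = f j t) ∧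
      ∀ i s j t, ψ (f i s) = (ψ (f j t))⁻¹ → f i s = (f j t)⁻¹ := by
  have hfin := finite_letters f
  obtain ⟨F, _, hF, ψ, hψ⟩ := exists_finite_quotient_separating hG _
    (hfin.union ((hfin.image2 (fun a b => a * b⁻¹) hfin).union (hfin.image2 (· * ·) hfin)))
  refine ⟨F, _, hF, ψ, fun i s => hψ _ (.inl ⟨i, s, rfl⟩) (hf i s), fun i s j t h => ?_,
    fun i s j t h => ?_⟩ <;> by_contra hne
  · refine hψ _ (.inr (.inl ⟨_, ⟨i, s, rfl⟩, _, ⟨j, t, rfl⟩, rfl⟩)) ?_ ?_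
    · rwa [Ne, mul_inv_eq_one]
    · rw [map_mul, map_inv, h, mul_inv_cancel]
  · refine hψ _ (.inr (.inr ⟨_, ⟨i, s, rfl⟩, _, ⟨j, t, rfl⟩, rfl⟩)) ?_ ?_
    · rwa [Ne, mul_eq_one_iff_eq_inv]
    · rw [map_mul, h, inv_mul_cancel]

/-- There are finite quotients of the factors in which every cycle action of one of the words is
left by every walk reading another of the words. -/
lemma exists_quotients
    (hA : ∀ a : A, a ≠ 1 → ∃ (F : Type) (_ : Group F) (_ : Finite F) (ψ : A →* F), ψ a ≠ 1)
    (hB : ∀ b : B, b ≠ 1 → ∃ (F : Type) (_ : Group F) (_ : Finite F) (ψ : B →* F), ψ b ≠ 1)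
    (hcyc : ∀ i j, i ≠ j → ¬ ∃ (g c : A ∗ B) (k l : ℤ),
      (W i).elem = c ^ k ∧ g * (W j).elem * g⁻¹ = c ^ l) :
    ∃ (F₁ F₂ : Type) (_ : Group F₁) (_ : Group F₂) (_ : Finite F₁) (_ : Finite F₂)
      (ψA : A →* F₁) (ψB : B →* F₂), (∀ i s, ψA ((W i).a s) ≠ 1) ∧ (∀ i s, ψB ((W i).b s) ≠ 1) ∧
      ∀ i j, i ≠ j → ∀ (𝒞 : CycleAction (W i) ψA ψB) x, ∃ n : ℕ,
        (W j).ept 𝒞.ρ x n ∉ 𝒞.cycle ∨ (W j).opt 𝒞.ρ x n ∉ 𝒞.cycle := by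
  obtain ⟨F₁, _, _, ψA, h1, h2, h3⟩ := exists_quotient_separating_letters (fun i => (W i).a) hA
    fun i => (W i).a_ne
  obtain ⟨F₂, _, _, ψB, h4, h5, h6⟩ := exists_quotient_separating_letters (fun i => (W i).b) hB
    fun i => (W i).b_ne
  refine ⟨F₁, F₂, _, _, ‹_›, ‹_›, ψA, ψB, h1, h4, fun i j hij 𝒞 x => ?_⟩
  by_contra! h
  exact hcyc i j hij (𝒞.commensurable_of_forall_mem (W j) (h1 j) (h4 j) (fun s t => h2 j s i t)
    (fun s t => h5 j s i t) (fun s t => h3 j s i t) (fun s t => h6 j s i t) x (fun n => (h n).1)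
    fun n => (h n).2)

attribute [instance] CycleAction.finite

lemma ept_add_period {X : Type*} (ρ : A ∗ B →* Equiv.Perm X) (W : AltWord A B) {x : X} {N : ℕ}
    (h : ρ (W.elem ^ N) x = x) (q r : ℕ) :
    W.ept ρ x (r + q * (N * W.len) : ℕ) = W.ept ρ x r ∧
      W.opt ρ x (r + q * (N * W.len) : ℕ) = W.opt ρ x r := by
  have h1 : ρ (W.elem ^ ((q * N : ℕ) : ℤ)) x = x := by
    rw [zpow_natCast, mul_comm, pow_mul, map_pow]
    exact Equiv.Perm.pow_apply_eq_self_of_apply_eq_self h q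
  have h2 := W.ept_add_mul_len ρ x r (q * N : ℕ)
  have h3 := W.opt_add_mul_len ρ x r (q * N : ℕ)
  rw [h1] at h2 h3
  rw [← h2, ← h3]
  constructor <;> congr 1 <;> push_cast <;> ring

lemma CycleAction.mem_cycle_of_mem_walkList {W : AltWord A B} {F₁ F₂ : Type} [Group F₁] [Group F₂]
    {ψA : A →* F₁} {ψB : B →* F₂} (𝒞 : CycleAction W ψA ψB) (n : ℕ) {x : 𝒞.X}
    (hx : x ∈ walkList 𝒞.ρ W (𝒞.e 0) n) : x ∈ 𝒞.cycle := by
  induction n with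
  | zero => simp [walkList] at hx
  | succ n ih =>
    rw [walkList, ← Nat.cast_succ, 𝒞.ept_e, 𝒞.opt_e, List.mem_cons, List.mem_cons] at hx
    rcases hx with rfl | rfl | hx
    exacts [.inl ⟨_, rfl⟩, .inr ⟨_, rfl⟩, ih hx]

/-- A cycle action carries voltages in a finite group separating the holonomy of its cycle from
the holonomies of the other words. -/
lemma exists_voltage {F₁ F₂ : Type} [Group F₁] [Group F₂] {ψA : A →* F₁} {ψB : B →* F₂}
    (ha : ∀ i s, ψA ((W i).a s) ≠ 1) (hb : ∀ i s, ψB ((W i).b s) ≠ 1) {i : ι}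
    (𝒞 : CycleAction (W i) ψA ψB)
    (hleave : ∀ j, i ≠ j → ∀ x, ∃ n : ℕ,
      (W j).ept 𝒞.ρ x n ∉ 𝒞.cycle ∨ (W j).opt 𝒞.ρ x n ∉ 𝒞.cycle)
    {N : ℕ} (hN : 0 < N) (h : ∀ j, 𝒞.ρ ((W j).elem ^ N) = 1) :
    ∃ (S : Type) (_ : Group S) (_ : Finite S) (γ : 𝒞.X → S), ∀ j, i ≠ j → ∀ x (g : S) (m : ℤ),
      g * hol 𝒞.ρ γ (W j) x (N * (W j).len) * g⁻¹ ≠ hol 𝒞.ρ γ (W i) (𝒞.e 0) (W i).len ^ m := by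
  have hfb : ∀ j (x : 𝒞.X) (t : ZMod (W j).len), 𝒞.ρ (.inr ((W j).b t)) x ≠ x :=
    fun j x t h => hb j t (𝒞.free_inr _ _ h)
  have hfa : ∀ j (x : 𝒞.X) (t : ZMod (W j).len), 𝒞.ρ (.inl ((W j).a t)) x ≠ x :=
    fun j x t h => ha j t (𝒞.free_inl _ _ h)
  have hsucc : ∀ j, ∃ k, N * (W j).len = k + 1 := fun j =>
    Nat.exists_eq_add_one.2 (Nat.mul_pos hN (W j).len_pos)
  have hend : ∀ j x, (W j).ept 𝒞.ρ x (N * (W j).len : ℕ) = x := fun j x => by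
    simpa [h] using (ept_add_period 𝒞.ρ (W j) (x := x) (N := N) (by simp [h]) 1 0).1
  let l : {j // i ≠ j} × 𝒞.X → List 𝒞.X := fun q =>
    walkList 𝒞.ρ (W q.1) q.2 (N * (W q.1).len)
  have hl : ∀ q, l q ≠ [] := fun q => by
    obtain ⟨k, hk⟩ := hsucc q.1
    simp [l, hk, walkList]
  obtain ⟨S, instS, hS, γ, hγ, hγ'⟩ := exists_involutions 𝒞.cycle
    (walkList 𝒞.ρ (W i) (𝒞.e 0) (W i).len) (fun x hx => 𝒞.mem_cycle_of_mem_walkList _ hx)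
    l hl
    (fun q => (isChain_cons_walkList 𝒞.ρ (hfb q.1) (hfa q.1) _ _).tail)
    (fun ⟨j, x⟩ => by
      obtain ⟨k, hk⟩ := hsucc j
      have h1 := hl (j, x)
      have h2 := hend j x
      simp only [l, hk] at h1 h2 ⊢
      rw [getLast_walkList]
      simp only [walkList, List.head_cons, ← Nat.cast_succ]
      rw [h2]
      simpa [AltWord.opt] using hfb j x 0)
    (fun ⟨j, x⟩ => by
      by_contra! hall
      obtain ⟨n, hn⟩ := hleave j j.2 x
      have hpos := Nat.mul_pos hN (W j).len_pos
      obtain ⟨h1, h2⟩ := ept_add_period 𝒞.ρ (W j) (x := x) (N := N) (by simp [h])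
        (n / (N * (W j).len)) (n % (N * (W j).len))
      rw [mul_comm (n / _), Nat.mod_add_div] at h1 h2
      have hlt := Nat.mod_lt n hpos
      rw [h1, h2] at hn
      refine hn.elim (fun hn => hn ?_) fun hn => hn (hall _ (opt_mem_walkList _ _ hlt))
      rcases Nat.eq_zero_or_eq_succ_pred (n % (N * (W j).len)) with h0 | h0
      · rw [h0, Nat.cast_zero, AltWord.ept_zero, ← hend j x]
        obtain ⟨k, hk⟩ := hsucc j
        have := ept_mem_walkList 𝒞.ρ (W := W j) x (t := k) (n := N * (W j).len) (by lia)
        rw [hk, Nat.cast_succ]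
        exact hall _ this
      · rw [h0, Nat.cast_succ]
        exact hall _ (ept_mem_walkList _ _ (by lia)))
  refine ⟨S, instS, hS, γ, fun j hj x g m => ?_⟩
  have := hγ' (⟨j, hj⟩, x) g m
  rwa [prod_map_walkList 𝒞.ρ γ _ hγ, prod_map_walkList 𝒞.ρ γ _ hγ] at this

end Covers

section Cocycle

variable {A B : Type*} [Group A] [Group B] {X Γ : Type*} [Group Γ] (ρ : A ∗ B →* Equiv.Perm X)
  (γ : X → Γ) (W : AltWord A B)

lemma hol_mul_len {x : X} (h : ρ W.elem x = x) (m : ℕ) :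
    hol ρ γ W x (m * W.len) = hol ρ γ W x W.len ^ m := by
  have key : ∀ g : Γ, volt ρ γ Γ W.elem (x, g) = (x, hol ρ γ W x W.len * g) := fun g => by
    have := volt_elem_pow ρ γ W x g 1
    rwa [pow_one, h, one_mul, smul_eq_mul] at this
  have key' : volt ρ γ Γ (W.elem ^ m) (x, 1) = (x, hol ρ γ W x W.len ^ m) := by
    induction m with
    | zero => simp
    | succ m ih => rw [pow_succ', map_mul, Equiv.Perm.mul_apply, ih, key, pow_succ']
  rw [volt_elem_pow, smul_eq_mul, mul_one] at key'
  exact (Prod.ext_iff.1 key').2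

variable {ρ} in
lemma map_ept {X' : Type*} {ρ' : A ∗ B →* Equiv.Perm X'} (f : X → X')
    (hf : ∀ g x, f (ρ g x) = ρ' g (f x)) (x : X) (t : ℤ) :
    f (W.ept ρ x t) = W.ept ρ' (f x) t := hf _ _

variable {ρ} in
lemma map_opt {X' : Type*} {ρ' : A ∗ B →* Equiv.Perm X'} (f : X → X')
    (hf : ∀ g x, f (ρ g x) = ρ' g (f x)) (x : X) (t : ℤ) :
    f (W.opt ρ x t) = W.opt ρ' (f x) t := by
  rw [AltWord.opt, hf, map_ept W f hf]
  rfl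

variable {W} in
lemma psum_indicator {x y : X} (hy : ∀ t : ℕ, W.opt ρ x t ≠ y) (n : ℕ) :
    psum ρ W x (Set.indicator {y} (1 : X → ℚ)) n =
      ∑ t ∈ Finset.range n, Set.indicator {y} (1 : X → ℚ) (W.ept ρ x (t + 1)) := by
  refine Finset.sum_congr rfl fun t _ => ?_
  rw [Set.indicator_of_notMem (a := W.opt ρ x t) (by simpa using hy t), sub_zero]

variable {W} in
lemma psum_indicator_pos {x y : X} (hy : ∀ t : ℕ, W.opt ρ x t ≠ y) {n : ℕ} (hn : 0 < n)
    (h : W.ept ρ x n = y) : 0 < psum ρ W x (Set.indicator {y} (1 : X → ℚ)) n := by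
  rw [psum_indicator ρ hy]
  refine Finset.sum_pos' (fun t _ => Set.indicator_nonneg (fun _ _ => zero_le_one) _)
    ⟨n - 1, by simpa using hn, ?_⟩
  have : (((n - 1 : ℕ) : ℤ) + 1) = n := by lia
  rw [this, h]
  simp

variable {W} in
lemma exists_ept_eq_of_psum_indicator_ne_zero {x y : X} (hy : ∀ t : ℕ, W.opt ρ x t ≠ y) {n : ℕ}
    (h : psum ρ W x (Set.indicator {y} (1 : X → ℚ)) n ≠ 0) :
    ∃ t : ℕ, W.ept ρ x (t + 1 : ℕ) = y := by
  rw [psum_indicator ρ hy] at h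
  obtain ⟨t, -, ht⟩ := Finset.exists_ne_zero_of_sum_ne_zero h
  exact ⟨t, by simpa using Set.mem_of_indicator_ne_zero ht⟩

/-- The sum of increments along a walk as a linear functional. -/
def psumHom (x : X) (n : ℕ) : (X → ℚ) →ₗ[ℚ] ℚ where
  toFun θ := psum ρ W x θ n
  map_add' θ θ' := by
    simp only [psum, ← Finset.sum_add_distrib]
    exact Finset.sum_congr rfl fun _ _ => by simp only [Pi.add_apply]; ring
  map_smul' c θ := by
    simp only [psum, RingHom.id_apply, smul_eq_mul, Finset.mul_sum, Pi.smul_apply, mul_sub]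

@[simp] lemma psumHom_apply (x : X) (n : ℕ) (θ : X → ℚ) :
    psumHom ρ W x n θ = psum ρ W x θ n := rfl

lemma psum_intCast (x : X) (n : ℕ) (θ : X → ℤ) :
    psum ρ W x (fun x => (θ x : ℚ)) n = psum ρ W x θ n := by
  simp [psum]

lemma exists_integral_of_forall_exists [Finite X] {J : Type*} [Finite J] (x₀ : X) (n₀ : ℕ)
    (V : J → AltWord A B) (y : J → X) (n : J → ℕ)
    (h : ∀ j, ∃ f : X → ℚ, psum ρ W x₀ f n₀ = 0 ∧ psum ρ (V j) (y j) f (n j) ≠ 0) :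
    ∃ θ : X → ℤ, psum ρ W x₀ θ n₀ = 0 ∧ ∀ j, psum ρ (V j) (y j) θ (n j) ≠ 0 := by
  obtain ⟨f, hf, hf'⟩ := Module.Dual.exists_forall_mem_ne_zero_of_forall_exists
    (LinearMap.ker (psumHom ρ W x₀ n₀)) (fun j => psumHom ρ (V j) (y j) (n j)) h
  obtain ⟨⟨b, hb⟩, hθ⟩ := IsLocalization.exist_integer_multiples_of_finite (nonZeroDivisors ℤ) f
  choose θ hθ using hθ
  have hθ' : (fun x => (θ x : ℚ)) = (b : ℚ) • f := funext fun x => by simpa using hθ x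
  have hb' : (b : ℚ) ≠ 0 := by simpa using hb
  refine ⟨θ, ?_, fun j hj => hf' j ?_⟩
  · have h1 := psum_intCast ρ W x₀ n₀ θ
    rw [hθ', ← psumHom_apply, map_smul, LinearMap.mem_ker.1 hf, smul_zero] at h1
    exact_mod_cast h1.symm
  · have h1 := psum_intCast ρ (V j) (y j) (n j) θ
    rw [hθ', ← psumHom_apply, map_smul, hj, Int.cast_zero, smul_eq_mul] at h1
    exact (mul_eq_zero.1 h1).resolve_left hb'

lemma exists_psum_eq_mul {W' : AltWord A B} {x y : X} {n m : ℕ}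
    (h : ¬ ∃ f : X → ℚ, psum ρ W x f n = 0 ∧ psum ρ W' y f m ≠ 0) :
    ∃ c : ℚ, ∀ f : X → ℚ, psum ρ W' y f m = c * psum ρ W x f n := by
  push Not at h
  have h1 := mem_span_of_iInf_ker_le_ker (ι := Unit) (L := fun _ => psumHom ρ W x n)
    (K := psumHom ρ W' y m) fun f hf => by simpa using h f (by simpa using hf)
  rw [Set.range_const, Submodule.mem_span_singleton] at h1
  obtain ⟨c, hc⟩ := h1
  exact ⟨c, fun f => (LinearMap.congr_fun hc f).symm⟩

/-- In the cover by the regular representation, a word whose holonomies are not conjugate to powers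
of the holonomy of another word does not have proportional sums. -/
lemma not_proportional {W' : AltWord A B} {x y : X} (g : Γ) (hx : ρ W.elem x = x)
    (ho : ∀ t : ℕ, W.opt ρ x t ≠ x) (he : ∀ t : ℕ, W.ept ρ x t = x → W.len ∣ t)
    {N₁ N : ℕ} (hN : 0 < N) (h₁ : ρ (W'.elem ^ N₁) y = y)
    (hW : volt ρ γ Γ (W.elem ^ N) = 1) (hW' : volt ρ γ Γ (W'.elem ^ N) = 1)
    (hne : ∀ (s : Γ) (m : ℤ), s * hol ρ γ W' y (N₁ * W'.len) * s⁻¹ ≠ hol ρ γ W x W.len ^ m)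
    {c : ℚ} (hc : c ≠ 0) : ¬ ∀ f : X × Γ → ℚ, psum (volt ρ γ Γ) W' (y, g) f (N * W'.len) =
      c * psum (volt ρ γ Γ) W (x, 1) f (N * W.len) := by
  intro H
  set r : Γ := g⁻¹ * hol ρ γ W' y (N₁ * W'.len) * g with hr
  let R : X × Γ → X × Γ := fun z => (z.1, z.2 * r)
  have hR : ∀ k z, R (volt ρ γ Γ k z) = volt ρ γ Γ k (R z) :=
    equivariant_of_factors R
      (fun a z => by simp only [R]; rw [volt_inl, volt_inl]; simp [mul_assoc])
      (fun b z => by simp only [R]; rw [volt_inr, volt_inr])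
  have hRy : volt ρ γ Γ (W'.elem ^ N₁) (y, g) = R (y, g) := by
    rw [volt_elem_pow, h₁]
    simp [R, hr, mul_assoc]
  have hinv : ∀ f : X × Γ → ℚ, psum (volt ρ γ Γ) W' (y, g) (fun z => f (R z)) (N * W'.len) =
      psum (volt ρ γ Γ) W' (y, g) f (N * W'.len) := fun f => by
    rw [psum_comp W' R hR, ← hRy, psum_cycle_shift _ _ _ _ _ _ (by rw [hW']; rfl)]
  have hinv' : psum (volt ρ γ Γ) W (x, 1) (Set.indicator {(x, 1)} (1 : X × Γ → ℚ)) (N * W.len) =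
      psum (volt ρ γ Γ) W (x, 1) (Set.indicator {(x, r)} (1 : X × Γ → ℚ)) (N * W.len) := by
    have h := hinv (Set.indicator {(x, r)} (1 : X × Γ → ℚ))
    rw [H, H] at h
    rw [← mul_left_cancel₀ hc h]
    congr 1
    ext z
    classical
    rw [Set.indicator_apply, Set.indicator_apply]
    refine if_congr ?_ rfl rfl
    simp [R, Prod.ext_iff]
  have ho' : ∀ (s : Γ) (t : ℕ), W.opt (volt ρ γ Γ) (x, 1) t ≠ (x, s) := fun s t h => by
    rw [opt_volt] at h
    exact ho t (Prod.ext_iff.1 h).1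
  have hpos := psum_indicator_pos (volt ρ γ Γ) (ho' 1) (Nat.mul_pos hN W.len_pos) (by
    have := W.ept_mul_len (volt ρ γ Γ) (x, 1) N
    rw [zpow_natCast, hW] at this
    exact_mod_cast this)
  rw [hinv'] at hpos
  obtain ⟨t, ht⟩ := exists_ept_eq_of_psum_indicator_ne_zero _ (ho' r) hpos.ne'
  rw [ept_volt, Prod.ext_iff] at ht
  obtain ⟨m, hm⟩ := he _ ht.1
  have h2 : hol ρ γ W x (t + 1) • (1 : Γ) = r := ht.2
  rw [hm, mul_comm, hol_mul_len ρ γ W hx, smul_eq_mul, mul_one] at h2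
  refine hne g⁻¹ m ?_
  rw [zpow_natCast, h2, hr, inv_inv]

end Cocycle

section Cocycle

variable {A B : Type*} [Group A] [Group B] {ι : Type} [Finite ι] {W : ι → AltWord A B}

/-- The product of two actions. -/
def prodAct {G X Y : Type*} [Group G] (ρ : G →* Equiv.Perm X) (ρ' : G →* Equiv.Perm Y) :
    G →* Equiv.Perm (X × Y) where
  toFun g := (ρ g).prodCongr (ρ' g)
  map_one' := by ext x <;> simp
  map_mul' a b := by ext x <;> simp

@[simp] lemma prodAct_apply {G X Y : Type*} [Group G] (ρ : G →* Equiv.Perm X)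
    (ρ' : G →* Equiv.Perm Y) (g : G) (z : X × Y) :
    prodAct ρ ρ' g z = (ρ g z.1, ρ' g z.2) := rfl

/-- There is a finite action with an integral edge labelling whose sum along one of the words
vanishes at a suitable point, while the sums along the other words vanish nowhere. -/
lemma exists_cocycle
    (hA : ∀ a : A, a ≠ 1 → ∃ (F : Type) (_ : Group F) (_ : Finite F) (ψ : A →* F), ψ a ≠ 1)
    (hB : ∀ b : B, b ≠ 1 → ∃ (F : Type) (_ : Group F) (_ : Finite F) (ψ : B →* F), ψ b ≠ 1)
    (hcyc : ∀ i j, i ≠ j → ¬ ∃ (g c : A ∗ B) (k l : ℤ),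
      (W i).elem = c ^ k ∧ g * (W j).elem * g⁻¹ = c ^ l) (i : ι) :
    ∃ (X : Type) (_ : Finite X) (ρ : A ∗ B →* Equiv.Perm X) (x₀ : X) (θ : X → ℤ) (N : ℕ), 0 < N ∧
      (∀ j, ρ ((W j).elem ^ N) = 1) ∧ (∀ t : ℕ, (W i).opt ρ x₀ t ≠ x₀) ∧
      (∀ t : ℕ, (W i).ept ρ x₀ t = x₀ → (W i).len ∣ t) ∧
      psum ρ (W i) x₀ θ (N * (W i).len) = 0 ∧
      ∀ j, i ≠ j → ∀ x, psum ρ (W j) x θ (N * (W j).len) ≠ 0 := by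
  obtain ⟨F₁, F₂, _, _, _, _, ψA, ψB, ha, hb, hleave⟩ := exists_quotients hA hB hcyc
  have hex : ∀ j, Nonempty (CycleAction (W j) ψA ψB) := fun j =>
    exists_cycleAction (W j) ψA ψB (ha j) (hb j)
  let 𝒞 : ∀ j, CycleAction (W j) ψA ψB := fun j => (hex j).some
  have hN₁ : ∀ j, (𝒞 i).ρ ((W j).elem ^ Nat.card (Equiv.Perm (𝒞 i).X)) = 1 := fun j => by
    rw [map_pow, pow_card_eq_one']
  obtain ⟨S, _, _, γ, hγ⟩ := exists_voltage ha hb (𝒞 i) (fun j hj => hleave i j hj (𝒞 i))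
    Nat.card_pos hN₁
  let P := ∀ j, Equiv.Perm (𝒞 j).X
  let ρP : A ∗ B →* Equiv.Perm P :=
    (MulAction.toPermHom P P).comp (MonoidHom.pi fun j => (𝒞 j).ρ)
  let X₁ := (𝒞 i).X × S
  let ρ₁ : A ∗ B →* Equiv.Perm X₁ := volt (𝒞 i).ρ γ S
  let X := X₁ × P
  let ρ : A ∗ B →* Equiv.Perm X := prodAct ρ₁ ρP
  let N := Nat.card (Equiv.Perm X)
  have hN : 0 < N := Nat.card_pos
  have hρN : ∀ j, ρ ((W j).elem ^ N) = 1 := fun j => by rw [map_pow, pow_card_eq_one']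
  let x₀ : X := (((𝒞 i).e 0, 1), 1)
  have hfst : ∀ g (z : X), (ρ g z).1 = ρ₁ g z.1 := fun g z => rfl
  have hfst' : ∀ g (z : X), (ρ g z).1.1 = (𝒞 i).ρ g z.1.1 := fun g z => by
    rw [hfst, volt_fst]
  have ho : ∀ t : ℕ, (W i).opt (𝒞 i).ρ ((𝒞 i).e 0) t ≠ (𝒞 i).e 0 := fun t => by
    rw [(𝒞 i).opt_e]
    exact (𝒞 i).o_ne_e (hb i) _ _
  have he : ∀ t : ℕ, (W i).ept (𝒞 i).ρ ((𝒞 i).e 0) t = (𝒞 i).e 0 → (W i).len ∣ t := fun t h => by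
    rw [(𝒞 i).ept_e] at h
    exact (ZMod.natCast_eq_zero_iff _ _).1 ((𝒞 i).e_injective h)
  have hρ₁N : ∀ j, ρ₁ ((W j).elem ^ N) = 1 := fun j => by
    ext1 z
    rw [← hfst _ (z, 1), hρN]
    rfl
  suffices h : ∀ q : {j // i ≠ j} × X, ∃ f : X → ℚ, psum ρ (W i) x₀ f (N * (W i).len) = 0 ∧
      psum ρ (W q.1) q.2 f (N * (W q.1).len) ≠ 0 by
    obtain ⟨θ, h1, h2⟩ := exists_integral_of_forall_exists ρ (W i) x₀ (N * (W i).len)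
      (fun q : {j // i ≠ j} × X => W q.1) (fun q => q.2) (fun q => N * (W q.1).len) h
    refine ⟨X, inferInstance, ρ, x₀, θ, N, hN, hρN, fun t h => ho t ?_, fun t h => he t ?_, h1,
      fun j hj x => h2 (⟨j, hj⟩, x)⟩
    · rw [← map_opt (W i) (fun z : X => z.1.1) hfst' x₀, h]
    · rw [← map_ept (W i) (fun z : X => z.1.1) hfst' x₀, h]
  rintro ⟨⟨j, hj⟩, ⟨⟨y, g⟩, σ⟩⟩
  by_contra hcon
  obtain ⟨c, hc⟩ := exists_psum_eq_mul ρ (W i) hcon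
  refine not_proportional (𝒞 i).ρ γ (W i) (W' := W j) (x := (𝒞 i).e 0) (y := y) g (𝒞 i).elem_e
    ho he hN (by rw [hN₁]; rfl) (hρ₁N i) (hρ₁N j) (fun s m => hγ j hj y s m) (c := c) ?_ fun f => ?_
  · rintro rfl
    let f : X → (𝒞 j).X := fun z => z.2 j ((σ j)⁻¹ ((𝒞 j).e 0))
    have hf : ∀ g z, f (ρ g z) = (𝒞 j).ρ g (f z) := fun g z => rfl
    have ho' : ∀ t : ℕ, (W j).opt (𝒞 j).ρ ((𝒞 j).e 0) t ≠ (𝒞 j).e 0 := fun t => by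
      rw [(𝒞 j).opt_e]
      exact (𝒞 j).o_ne_e (hb j) _ _
    have h3 := psum_indicator_pos (𝒞 j).ρ ho' (Nat.mul_pos hN (W j).len_pos)
      (by rw [(𝒞 j).ept_e]; simp)
    have h4 := hc fun z => Set.indicator {(𝒞 j).e 0} (1 : (𝒞 j).X → ℚ) (f z)
    rw [zero_mul, psum_comp (W j) f hf] at h4
    have h5 : f ((y, g), σ) = (𝒞 j).e 0 := by simp [f]
    simp only [h5] at h4
    exact h3.ne' h4
  · have h3 := hc fun z => f z.1
    rwa [psum_comp _ Prod.fst hfst, psum_comp _ Prod.fst hfst] at h3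

end Cocycle

section Affine

variable {p : ℕ} {R : Type*} [CommRing R]

/-- The permutation of the functions on `ZMod p` translating the argument by `k` and the value by
`d`. -/
def affPerm (k : ZMod p) (d : ZMod p → R) : Equiv.Perm (ZMod p → R) where
  toFun f z := f (z + k) + d z
  invFun f z := f (z - k) - d (z - k)
  left_inv f := by ext; simp
  right_inv f := by ext; simp

@[simp] lemma affPerm_apply (k : ZMod p) (d f : ZMod p → R) (z : ZMod p) :
    affPerm k d f z = f (z + k) + d z := rfl

lemma affPerm_mul (k k' : ZMod p) (d d' : ZMod p → R) :
    affPerm k d * affPerm k' d' = affPerm (k + k') (fun z => d' (z + k) + d z) := by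
  ext f z
  simp [add_assoc]

lemma affPerm_inv (k : ZMod p) (d : ZMod p → R) :
    (affPerm k d)⁻¹ = affPerm (-k) (fun z => -d (z - k)) := by
  rw [inv_eq_iff_mul_eq_one, affPerm_mul]
  ext f z
  simp

lemma affPerm_pow_apply (k : ZMod p) (d f : ZMod p → R) (n : ℕ) (z : ZMod p) :
    (affPerm k d ^ n) f z = f (z + n * k) + ∑ s ∈ Finset.range n, d (z + s * k) := by
  induction n generalizing z with
  | zero => simp
  | succ n ih =>
    rw [pow_succ', Equiv.Perm.mul_apply, affPerm_apply, ih, Finset.sum_range_succ', ← add_assoc]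
    simp only [Nat.cast_zero, zero_mul, add_zero]
    congr 2
    · push_cast
      ring_nf
    · refine Finset.sum_congr rfl fun s _ => ?_
      push_cast
      ring_nf

/-- A permutation of the functions on `ZMod p` acting by translation of the argument by `k` and of
the value by a function of sum zero. -/
def IsAff [NeZero p] (k : ZMod p) (σ : Equiv.Perm (ZMod p → R)) : Prop :=
  ∃ d : ZMod p → R, ∑ z, d z = 0 ∧ σ = affPerm k d

variable [NeZero p]

lemma IsAff.one : IsAff 0 (1 : Equiv.Perm (ZMod p → R)) :=
  ⟨0, by simp, by ext; simp⟩

lemma IsAff.mul {k k' : ZMod p} {σ σ' : Equiv.Perm (ZMod p → R)} (h : IsAff k σ)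
    (h' : IsAff k' σ') : IsAff (k + k') (σ * σ') := by
  obtain ⟨d, hd, rfl⟩ := h
  obtain ⟨d', hd', rfl⟩ := h'
  refine ⟨_, ?_, affPerm_mul k k' d d'⟩
  rw [Finset.sum_add_distrib, hd, add_zero, ← hd']
  exact Equiv.sum_comp (Equiv.addRight k) d'

lemma IsAff.inv {k : ZMod p} {σ : Equiv.Perm (ZMod p → R)} (h : IsAff k σ) : IsAff (-k) σ⁻¹ := by
  obtain ⟨d, hd, rfl⟩ := h
  refine ⟨_, ?_, affPerm_inv k d⟩
  rw [Finset.sum_neg_distrib, neg_eq_zero, ← hd]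
  exact Equiv.sum_comp (Equiv.subRight k) d

lemma IsAff.pow_eq_one [Fact p.Prime] {k : ZMod p} {σ : Equiv.Perm (ZMod p → R)} (h : IsAff k σ)
    (hk : k ≠ 0) : σ ^ p = 1 := by
  obtain ⟨d, hd, rfl⟩ := h
  ext f z
  rw [affPerm_pow_apply, CharP.cast_eq_zero, zero_mul, add_zero, Equiv.Perm.one_apply,
    add_eq_left, ← hd]
  refine Finset.sum_bij (fun s _ => z + s * k) (fun _ _ => Finset.mem_univ _) ?_ ?_ fun _ _ => rfl
  · intro s hs t ht hst
    have h1 := mul_right_cancel₀ hk (add_left_cancel hst)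
    rwa [ZMod.natCast_eq_natCast_iff', Nat.mod_eq_of_lt (Finset.mem_range.1 hs),
      Nat.mod_eq_of_lt (Finset.mem_range.1 ht)] at h1
  · intro w _
    refine ⟨((w - z) / k).val, Finset.mem_range.2 (ZMod.val_lt _), ?_⟩
    rw [ZMod.natCast_zmod_val, div_mul_cancel₀ _ hk, add_sub_cancel]

lemma IsAff.pow_apply [Fact p.Prime] {k : ZMod p} {σ : Equiv.Perm (ZMod p → R)} (h : IsAff k σ) :
    ∃ d : ZMod p → R, ∀ f, (σ ^ p) f = f + d := by
  by_cases hk : k = 0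
  · obtain ⟨d, -, rfl⟩ := h
    refine ⟨p • d, fun f => ?_⟩
    ext z
    rw [affPerm_pow_apply, hk]
    simp
  · exact ⟨0, fun f => by rw [h.pow_eq_one hk, Equiv.Perm.one_apply, add_zero]⟩

end Affine

section AffineVoltage

open scoped Classical in
/-- The affine voltage with linear part `θ` and a nontrivial translation at `x₀`. -/
noncomputable def affVolt {X : Type*} (p : ℕ) (R : Type*) [CommRing R] (θ : X → ℤ) (x₀ x : X) :
    Equiv.Perm (ZMod p → R) :=
  affPerm (θ x : ZMod p) (if x = x₀ then Pi.single 0 1 - Pi.single 1 1 else 0)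

variable {A B : Type*} [Group A] [Group B] {X : Type*} (ρ : A ∗ B →* Equiv.Perm X)
  (W : AltWord A B) {p : ℕ} {R : Type*} [CommRing R] (θ : X → ℤ) (x₀ : X)

lemma affVolt_of_ne {x : X} (h : x ≠ x₀) : affVolt p R θ x₀ x = affPerm (θ x : ZMod p) 0 := by
  rw [affVolt, if_neg h]

lemma affVolt_self : affVolt p R θ x₀ x₀ =
    affPerm (θ x₀ : ZMod p) (Pi.single 0 1 - Pi.single 1 1) := by
  rw [affVolt, if_pos rfl]

lemma isAff_affVolt [NeZero p] (x : X) : IsAff (θ x : ZMod p) (affVolt p R θ x₀ x) := by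
  refine ⟨_, ?_, rfl⟩
  split_ifs <;> simp

lemma isAff_hol [NeZero p] (x : X) (n : ℕ) :
    IsAff ((psum ρ W x θ n : ℤ) : ZMod p) (hol ρ (affVolt p R θ x₀) W x n) := by
  induction n with
  | zero => simpa [psum] using IsAff.one
  | succ n ih =>
    rw [hol_succ, psum, Finset.sum_range_succ, ← psum, add_comm, sub_eq_add_neg, Int.cast_add,
      Int.cast_add, Int.cast_neg]
    exact ((isAff_affVolt θ x₀ _).mul (isAff_affVolt θ x₀ _).inv).mul ih

/-- The action of `A ∗ B` on `X × (ZMod p → R)` given by the affine voltages. -/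
noncomputable def affAct (p : ℕ) (R : Type*) [CommRing R] :
    A ∗ B →* Equiv.Perm (X × (ZMod p → R)) :=
  volt ρ (affVolt p R θ x₀) (ZMod p → R)

variable {θ x₀}

lemma affAct_elem_pow_mul {N : ℕ} (h : ρ (W.elem ^ N) = 1) (x : X) (f : ZMod p → R) (n : ℕ) :
    affAct ρ θ x₀ p R (W.elem ^ (N * n)) (x, f) =
      (x, (hol ρ (affVolt p R θ x₀) W x (N * W.len) ^ n) f) := by
  induction n with
  | zero => simp
  | succ n ih =>
    rw [mul_add, mul_one, add_comm, pow_add, map_mul, Equiv.Perm.mul_apply, ih, affAct,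
      volt_elem_pow, h, pow_succ', Equiv.Perm.one_apply, Equiv.Perm.mul_apply]
    rfl

lemma affAct_elem_pow_eq_one [Fact p.Prime] {N : ℕ} (h : ρ (W.elem ^ N) = 1)
    (hθ : ∀ x, ¬ (p : ℤ) ∣ psum ρ W x θ (N * W.len)) :
    affAct ρ θ x₀ p R (W.elem ^ (N * p)) = 1 := by
  ext1 ⟨x, f⟩
  rw [affAct_elem_pow_mul ρ W h, (isAff_hol ρ W θ x₀ x _).pow_eq_one]
  · rfl
  · rw [Ne, ZMod.intCast_zmod_eq_zero_iff_dvd]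
    exact hθ x

lemma exists_affAct_elem_pow [Fact p.Prime] {N : ℕ} (h : ρ (W.elem ^ N) = 1) :
    ∃ D : X → ZMod p → R, ∀ x f, affAct ρ θ x₀ p R (W.elem ^ (N * p)) (x, f) = (x, f + D x) := by
  choose D hD using fun x => (isAff_hol (R := R) ρ W θ x₀ x (N * W.len) (p := p)).pow_apply
  exact ⟨D, fun x f => by rw [affAct_elem_pow_mul ρ W h, hD]⟩

lemma affAct_castRingHom {R' : Type*} [CommRing R'] (q : R →+* R') (g : A ∗ B)
    (z : X × (ZMod p → R)) : ((affAct ρ θ x₀ p R g z).1, q ∘ (affAct ρ θ x₀ p R g z).2) =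
      affAct ρ θ x₀ p R' g (z.1, q ∘ z.2) := by
  have h1 : ∀ (x : X) (f : ZMod p → R),
      q ∘ affVolt p R θ x₀ x f = affVolt p R' θ x₀ x (q ∘ f) := fun x f => by
    ext z
    by_cases hx : x = x₀
    · subst hx
      simp [affVolt_self, Pi.single_apply, apply_ite q]
    · simp [affVolt_of_ne _ _ hx]
  refine equivariant_of_factors (ρ := affAct ρ θ x₀ p R) (ρ' := affAct ρ θ x₀ p R')
    (fun z : X × (ZMod p → R) => (z.1, q ∘ z.2)) (fun a z => ?_) (fun b z => ?_) g z
  · have h2 : q ∘ (affVolt p R θ x₀ z.1)⁻¹ z.2 = (affVolt p R' θ x₀ z.1)⁻¹ (q ∘ z.2) := by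
      rw [Equiv.Perm.eq_inv_iff_eq, ← h1, ← Equiv.Perm.mul_apply, mul_inv_cancel,
        Equiv.Perm.one_apply]
    simp only [affAct]
    rw [← Prod.mk.eta (p := z), volt_inl, volt_inl]
    simp only [mul_smul, Equiv.Perm.smul_def, h1, h2]
  · simp only [affAct]
    rw [← Prod.mk.eta (p := z), volt_inr, volt_inr]

lemma hol_affVolt (ho : ∀ t : ℕ, W.opt ρ x₀ t ≠ x₀) {n : ℕ}
    (he : ∀ t : ℕ, t < n → W.ept ρ x₀ (t + 1 : ℕ) ≠ x₀) :
    hol ρ (affVolt p R θ x₀) W x₀ n = affPerm ((psum ρ W x₀ θ n : ℤ) : ZMod p) 0 := by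
  induction n with
  | zero => ext; simp [psum]
  | succ n ih =>
    rw [hol_succ, ih fun t ht => he t (ht.trans n.lt_succ_self), ← Nat.cast_succ,
      affVolt_of_ne θ x₀ (he n n.lt_succ_self), affVolt_of_ne θ x₀ (ho n), affPerm_inv, affPerm_mul,
      affPerm_mul, psum, psum, Finset.sum_range_succ]
    ext f z
    simp only [affPerm_apply, Pi.zero_apply, neg_zero, add_zero]
    congr 1
    push_cast
    ring_nf

lemma hol_affVolt_return (ho : ∀ t : ℕ, W.opt ρ x₀ t ≠ x₀) {n : ℕ}
    (he : ∀ t : ℕ, t < n → W.ept ρ x₀ (t + 1 : ℕ) ≠ x₀) (he' : W.ept ρ x₀ (n + 1 : ℕ) = x₀)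
    (hθ : psum ρ W x₀ θ (n + 1) = 0) (f : ZMod p → R) :
    hol ρ (affVolt p R θ x₀) W x₀ (n + 1) f = f + (Pi.single 0 1 - Pi.single 1 1) := by
  rw [hol_succ, hol_affVolt ρ W ho he, ← Nat.cast_succ, he', affVolt_self, affVolt_of_ne θ x₀ (ho n),
    affPerm_inv, affPerm_mul, affPerm_mul]
  rw [psum, Finset.sum_range_succ, ← psum, ← Nat.cast_succ, he'] at hθ
  have h1 : (θ x₀ : ZMod p) + -(θ (W.opt ρ x₀ n) : ZMod p) + ((psum ρ W x₀ θ n : ℤ) : ZMod p) = 0 := by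
    have := congrArg (Int.cast : ℤ → ZMod p) hθ
    push_cast at this
    rw [← this]
    ring
  rw [h1]
  ext z
  simp

/-- Over the integers, a word along which `θ` sums to zero acts with infinite order. -/
lemma exists_affAct_elem_pow_ne_zero [Fact p.Prime] {N : ℕ} (hN : 0 < N)
    (h : ρ (W.elem ^ N) = 1) (ho : ∀ t : ℕ, W.opt ρ x₀ t ≠ x₀)
    (he : ∀ t : ℕ, W.ept ρ x₀ t = x₀ → W.len ∣ t) (hθ : psum ρ W x₀ θ (N * W.len) = 0) :
    ∃ D : X → ZMod p → ℤ, D x₀ 0 ≠ 0 ∧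
      ∀ x f, affAct ρ θ x₀ p ℤ (W.elem ^ (N * p)) (x, f) = (x, f + D x) := by
  obtain ⟨D, hD⟩ := exists_affAct_elem_pow (R := ℤ) (p := p) (θ := θ) (x₀ := x₀) ρ W h
  refine ⟨D, ?_, hD⟩
  set ℓ := Function.minimalPeriod (ρ W.elem) x₀ with hℓ
  have hiter : ∀ m : ℕ, ρ (W.elem ^ m) x₀ = x₀ ↔ ℓ ∣ m := fun m => by
    rw [map_pow, ← Equiv.Perm.iterate_eq_pow, hℓ, ← Function.isPeriodicPt_iff_minimalPeriod_dvd]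
    rfl
  obtain ⟨m, hm⟩ := (hiter N).1 (by rw [h]; rfl)
  have hℓ0 : 0 < ℓ := Nat.pos_of_ne_zero fun h0 => by simp [h0] at hm; lia
  have hm0 : 0 < m := Nat.pos_of_ne_zero fun h0 => by simp [h0] at hm; lia
  have hℓx : ρ (W.elem ^ ℓ) x₀ = x₀ := (hiter ℓ).2 dvd_rfl
  have hept : ∀ m : ℕ, W.ept ρ x₀ (m * W.len : ℕ) = ρ (W.elem ^ m) x₀ := fun m => by
    have := W.ept_mul_len ρ x₀ m
    rw [zpow_natCast] at this
    exact_mod_cast this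
  have hθ' : psum ρ W x₀ θ (ℓ * W.len) = 0 := by
    rw [hm, mul_comm ℓ, psum_mul_cycle ρ W x₀ θ m ℓ hℓx, smul_eq_zero] at hθ
    exact hθ.resolve_left hm0.ne'
  obtain ⟨n, hn⟩ := Nat.exists_eq_add_one.2 (Nat.mul_pos hℓ0 W.len_pos)
  have hret : ∀ f, affAct ρ θ x₀ p ℤ (W.elem ^ ℓ) (x₀, f) =
      (x₀, f + (Pi.single 0 1 - Pi.single 1 1)) := fun f => by
    rw [affAct, volt_elem_pow, hℓx, hn, Equiv.Perm.smul_def,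
      hol_affVolt_return ρ W ho (fun t ht h1 => ?_) (by rw [← hn, hept, hℓx]) (by rw [← hn, hθ'])]
    obtain ⟨k, hk⟩ := he _ h1
    rw [hk, mul_comm, hept, hiter] at h1
    have h2 := Nat.le_of_dvd (Nat.pos_of_ne_zero fun h0 => by simp [h0] at hk) h1
    have h3 := Nat.mul_le_mul_right W.len h2
    rw [mul_comm k, ← hk] at h3
    lia
  have hret' : ∀ k : ℕ, affAct ρ θ x₀ p ℤ (W.elem ^ (ℓ * k)) (x₀, 0) =
      (x₀, k • (Pi.single 0 1 - Pi.single 1 1)) := fun k => by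
    induction k with
    | zero => simp
    | succ k ih =>
      rw [mul_add, mul_one, add_comm, pow_add, map_mul, Equiv.Perm.mul_apply, ih, hret, succ_nsmul]
  have h3 := hret' (m * p)
  rw [← mul_assoc, ← hm, hD, zero_add] at h3
  have h4 : D x₀ = _ := (Prod.ext_iff.1 h3).2
  have hp : p ≠ 0 := (Fact.out : p.Prime).ne_zero
  rw [h4]
  simp [hm0.ne', hp]

end AffineVoltage

section Orders

lemma orderOf_eq_of_orderOf_pow {G : Type*} [Monoid G] {g : G} {K l : ℕ} (hK : 0 < K) (hl : 0 < l)
    (h : orderOf (g ^ K) = K * l) : orderOf g = K * K * l := by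
  have h0 : 0 < K * l := Nat.mul_pos hK hl
  have h1 : K ∣ orderOf g := (Dvd.intro _ h.symm).trans (orderOf_pow_dvd K)
  rw [orderOf_pow_of_dvd hK.ne' h1] at h
  rw [← Nat.div_mul_cancel h1, h]
  ring

lemma exists_prime_forall_not_dvd {J : Type*} [Finite J] (f : J → ℤ) (hf : ∀ j, f j ≠ 0) :
    ∃ p : ℕ, p.Prime ∧ ∀ j, ¬ (p : ℤ) ∣ f j := by
  obtain ⟨b, hb⟩ := (Set.finite_range fun j => (f j).natAbs).bddAbove
  obtain ⟨p, hp, hp'⟩ := Nat.exists_infinite_primes (b + 1)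
  refine ⟨p, hp', fun j h => ?_⟩
  have h1 := Nat.le_of_dvd (Int.natAbs_pos.2 (hf j)) (Int.natCast_dvd.1 h)
  have h2 : (f j).natAbs ≤ b := hb ⟨j, rfl⟩
  lia

variable {A B : Type*} [Group A] [Group B] {ι : Type} [Finite ι] {W : ι → AltWord A B}

/-- The order of one of the words can be prescribed in a finite quotient, up to a constant, while
keeping the orders of the other words bounded. -/
lemma exists_quotient_orderOf
    (hA : ∀ a : A, a ≠ 1 → ∃ (F : Type) (_ : Group F) (_ : Finite F) (ψ : A →* F), ψ a ≠ 1)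
    (hB : ∀ b : B, b ≠ 1 → ∃ (F : Type) (_ : Group F) (_ : Finite F) (ψ : B →* F), ψ b ≠ 1)
    (hcyc : ∀ i j, i ≠ j → ¬ ∃ (g c : A ∗ B) (k l : ℤ),
      (W i).elem = c ^ k ∧ g * (W j).elem * g⁻¹ = c ^ l) (i : ι) :
    ∃ K : ℕ, 0 < K ∧ ∀ l : ℕ, 0 < l → ∃ (H : Type) (_ : Group H) (_ : Finite H) (φ : A ∗ B →* H),
      orderOf (φ (W i).elem) = K * l ∧ ∀ j, i ≠ j → φ (W j).elem ^ K = 1 := by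
  obtain ⟨X, _, ρ, x₀, θ, N, hN, hρ, ho, he, hi, hj⟩ := exists_cocycle hA hB hcyc i
  obtain ⟨p, hp, hpj⟩ := exists_prime_forall_not_dvd
    (fun q : {j // i ≠ j} × X => psum ρ (W q.1) q.2 θ (N * (W q.1).len)) fun q => hj _ q.1.2 _
  have : Fact p.Prime := ⟨hp⟩
  obtain ⟨D, hD0, hD⟩ := exists_affAct_elem_pow_ne_zero (p := p) ρ (W i) hN (hρ i) ho he hi
  have := Fintype.ofFinite X
  set K₁ := N * p
  have hK₁ : 0 < K₁ := Nat.mul_pos hN hp.pos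
  set c := Finset.univ.gcd fun q : X × ZMod p => (D q.1 q.2).natAbs
  have hc : 0 < c := Nat.pos_of_ne_zero fun h =>
    hD0 (Int.natAbs_eq_zero.1 (Finset.gcd_eq_zero_iff.1 h (x₀, 0) (Finset.mem_univ _)))
  refine ⟨K₁ * K₁, Nat.mul_pos hK₁ hK₁, fun l hl => ?_⟩
  set L := c * (K₁ * l)
  have hL : 0 < L := Nat.mul_pos hc (Nat.mul_pos hK₁ hl)
  have : NeZero L := ⟨hL.ne'⟩
  let φ : A ∗ B →* Equiv.Perm (X × (ZMod p → ZMod L)) := affAct ρ θ x₀ p (ZMod L)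
  have hφ : ∀ x f, φ ((W i).elem ^ K₁) (x, f) = (x, f + fun z => (D x z : ZMod L)) := fun x f => by
    obtain ⟨f, rfl⟩ : ∃ f' : ZMod p → ℤ, Int.castRingHom (ZMod L) ∘ f' = f :=
      ⟨fun z => (f z).val, by ext z; simp⟩
    have h1 := affAct_castRingHom (θ := θ) (x₀ := x₀) (p := p) ρ (Int.castRingHom (ZMod L))
      ((W i).elem ^ K₁) (x, f)
    rw [hD] at h1
    rw [← h1]
    ext z <;> simp
  have hφ' : ∀ (n : ℕ) x f, (φ ((W i).elem ^ K₁) ^ n) (x, f) =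
      (x, f + fun z => (n * D x z : ZMod L)) := fun n x f => by
    induction n with
    | zero => simp; rfl
    | succ n ih =>
      rw [pow_succ', Equiv.Perm.mul_apply, ih, hφ]
      ext z
      · rfl
      · simp only [Pi.add_apply]
        push_cast
        ring
  refine ⟨_, _, inferInstance, φ, orderOf_eq_of_orderOf_pow hK₁ hl ?_, fun j hij => ?_⟩
  · rw [← map_pow]
    refine Nat.dvd_right_iff_eq.1 fun n => ?_
    rw [orderOf_dvd_iff_pow_eq_one]
    have h1 : K₁ * l ∣ n ↔ L ∣ n * c := by
      rw [mul_comm n, Nat.mul_dvd_mul_iff_left hc]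
    have h2 : n * c = Finset.univ.gcd fun q : X × ZMod p => n * (D q.1 q.2).natAbs := by
      rw [Finset.gcd_mul_left, normalize_eq]
    rw [h1, h2, Finset.dvd_gcd_iff]
    have h3 : ∀ x z, L ∣ n * (D x z).natAbs ↔ (n * D x z : ZMod L) = 0 := fun x z => by
      have h4 : ((n * D x z : ℤ) : ZMod L) = n * D x z := by push_cast; rfl
      rw [← h4, ZMod.intCast_zmod_eq_zero_iff_dvd, Int.natCast_dvd, Int.natAbs_mul,
        Int.natAbs_natCast]
    constructor
    · intro h q _
      rw [h3]
      have h4 := hφ' n q.1 0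
      rw [h] at h4
      simpa using (congrFun (Prod.ext_iff.1 h4).2 q.2).symm
    · intro h
      ext1 ⟨x, f⟩
      rw [hφ']
      refine Prod.ext rfl (funext fun z => ?_)
      simp [(h3 x z).1 (h (x, z) (Finset.mem_univ _))]
  · rw [pow_mul, ← map_pow, affAct_elem_pow_eq_one ρ (W j) (hρ j) fun x => hpj (⟨j, hij⟩, x),
      one_pow]

end Orders

section Combination

lemma exists_altWords {A B : Type*} [Group A] [Group B] {ι : Type*} (u : ι → A ∗ B)
    (hu : ∀ i, ¬ ∃ g : A ∗ B,
        g * u i * g⁻¹ ∈ (Monoid.Coprod.inl : A →* A ∗ B).range ∨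
        g * u i * g⁻¹ ∈ (Monoid.Coprod.inr : B →* A ∗ B).range)
    (hcyc : ∀ i j, i ≠ j →
        ¬ ∃ (g c : A ∗ B) (k l : ℤ), u i = c ^ k ∧ g * u j * g⁻¹ = c ^ l) :
    ∃ (W : ι → AltWord A B) (h : ι → A ∗ B), (∀ i, h i * u i * (h i)⁻¹ = (W i).elem) ∧
      ∀ i j, i ≠ j → ¬ ∃ (g c : A ∗ B) (k l : ℤ),
        (W i).elem = c ^ k ∧ g * (W j).elem * g⁻¹ = c ^ l := by
  choose W h hW using fun i => exists_altWord (u i) (hu i)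
  refine ⟨W, h, hW, fun i j hij ⟨g, c, k, l, h1, h2⟩ => hcyc i j hij
    ⟨(h i)⁻¹ * g * h j, (h i)⁻¹ * c * h i, k, l, ?_, ?_⟩⟩
  · have := conj_zpow (a := (h i)⁻¹) (b := c) (i := k)
    rw [inv_inv] at this
    rw [this, ← h1, ← hW]
    group
  · have := conj_zpow (a := (h i)⁻¹) (b := c) (i := l)
    rw [inv_inv] at this
    rw [this, ← h2, ← hW]
    group

/-- Quotients prescribing the orders of the single elements combine to a quotient prescribing all
of the orders. -/
lemma exists_surjective_orderOf {G : Type*} [Group G] {ι : Type} [Finite ι] (u : ι → G)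
    (h : ∀ i, ∃ K : ℕ, 0 < K ∧ ∀ l : ℕ, 0 < l →
      ∃ (H : Type) (_ : Group H) (_ : Finite H) (φ : G →* H),
        orderOf (φ (u i)) = K * l ∧ ∀ j, i ≠ j → φ (u j) ^ K = 1) :
    ∃ K : ℕ, 0 < K ∧ ∀ l : ι → ℕ, (∀ i, 0 < l i) →
      ∃ (H : Type) (_ : Group H) (_ : Finite H) (φ : G →* H),
        Function.Surjective φ ∧ ∀ i, orderOf (φ (u i)) = K * l i := by
  have := Fintype.ofFinite ι
  choose K hK h using h
  have hdvd : ∀ i, K i ∣ ∏ i, K i := fun i => Finset.dvd_prod_of_mem K (Finset.mem_univ i)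
  have hpos : 0 < ∏ i, K i := Finset.prod_pos fun i _ => hK i
  refine ⟨∏ i, K i, hpos, fun l hl => ?_⟩
  choose H instH hfin φ hφ hφ' using fun i => h i ((∏ i, K i) / K i * l i)
    (Nat.mul_pos (Nat.div_pos (Nat.le_of_dvd hpos (hdvd i)) (hK i)) (hl i))
  let Φ : G →* ∀ i, H i := MonoidHom.pi φ
  refine ⟨Φ.range, inferInstance, inferInstance, Φ.rangeRestrict, Φ.rangeRestrict_surjective,
    fun i => ?_⟩
  have hi : orderOf (φ i (u i)) = (∏ i, K i) * l i := by
    rw [hφ, ← mul_assoc, Nat.mul_div_cancel' (hdvd i)]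
  rw [← Subgroup.orderOf_coe, ← hi]
  refine Nat.dvd_antisymm (orderOf_dvd_of_pow_eq_one (funext fun j => ?_)) ?_
  · change φ j (u i) ^ orderOf (φ i (u i)) = 1
    by_cases hij : j = i
    · subst hij
      exact pow_orderOf_eq_one _
    · obtain ⟨m, hm⟩ := (hdvd j).trans (Dvd.intro _ hi.symm)
      rw [hm, pow_mul, hφ' j i hij, one_pow]
  · exact orderOf_map_dvd (Pi.evalMonoidHom H i) (Φ (u i))

lemma orderOf_map_conj {G H : Type*} [Group G] [Group H] (φ : G →* H) (g x : G) :
    orderOf (φ (g * x * g⁻¹)) = orderOf (φ x) := by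
  rw [map_mul, map_mul, map_inv, ← MulAut.conj_apply]
  exact MulEquiv.orderOf_eq (MulAut.conj (φ g)) (φ x)

end Combination

end FreeProductOmnipotence

/-- Let `G = A ∗ B` be the free product of two residually finite groups.
If `u₁, …, uₙ ∈ G` are such that no `uᵢ` lies in a conjugate of `A` or `B`, and no two
distinct `uᵢ, uⱼ` lie in conjugate cyclic subgroups, then there is `K > 0` such that for
every sequence of positive integers `l₁, …, lₙ` there is a surjection `φ` of `G` onto a
finite group with `orderOf (φ uᵢ) = K * lᵢ` for all `i`. -/
theorem freeProduct_omnipotence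
    {A B : Type*} [Group A] [Group B]
    (hA : ∀ a : A, a ≠ 1 → ∃ (F : Type) (_ : Group F) (_ : Finite F) (ψ : A →* F), ψ a ≠ 1)
    (hB : ∀ b : B, b ≠ 1 → ∃ (F : Type) (_ : Group F) (_ : Finite F) (ψ : B →* F), ψ b ≠ 1)
    (n : ℕ) (u : Fin n → A ∗ B)
    (hu : ∀ i, ¬ ∃ g : A ∗ B,
        g * u i * g⁻¹ ∈ (Monoid.Coprod.inl : A →* A ∗ B).range ∨
        g * u i * g⁻¹ ∈ (Monoid.Coprod.inr : B →* A ∗ B).range)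
    (hcyc : ∀ i j, i ≠ j →
        ¬ ∃ (g c : A ∗ B) (k l : ℤ), u i = c ^ k ∧ g * u j * g⁻¹ = c ^ l) :
    ∃ K : ℕ, 0 < K ∧ ∀ l : Fin n → ℕ, (∀ i, 0 < l i) →
      ∃ (H : Type) (_ : Group H) (_ : Finite H) (φ : A ∗ B →* H),
        Function.Surjective φ ∧ ∀ i, orderOf (φ (u i)) = K * l i := by
  obtain ⟨W, h, hW, hcyc'⟩ := FreeProductOmnipotence.exists_altWords u hu hcyc
  obtain ⟨K, hK, hK'⟩ := FreeProductOmnipotence.exists_surjective_orderOf (fun i => (W i).elem)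
    (FreeProductOmnipotence.exists_quotient_orderOf hA hB hcyc')
  refine ⟨K, hK, fun l hl => ?_⟩
  obtain ⟨H, instH, hH, φ, hφ, hord⟩ := hK' l hl
  refine ⟨H, instH, hH, φ, hφ, fun i => ?_⟩
  rw [← hord, ← hW, FreeProductOmnipotence.orderOf_map_conj]
end

section
/- Let G = A ∗ B be the free product of two finite groups A and B. Let u₁, …, uₙ be elements of G such that no uᵢ lies in any conjugate of A or of B, and such that for all i ≠ j the elements uᵢ and uⱼ do not lie in conjugate cyclic subgroups (i.e., there exist no g, c ∈ G and integers k, l with uᵢ = c^k and g·uⱼ·g⁻¹ = c^l). Then there exists a positive integer K such that for every sequence of positive integers l₁, …, lₙ there exists a finite group H and a surjective group homomorphism φ : G → H such that the order of φ(uᵢ) equals K·lᵢ for every i. -/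
open scoped Monoid.Coprod

universe uA uB

/-- `len` and `head` behave like the syllable length and the type of the leftmost syllable of the
normal form with respect to the two families of letters `X true` and `X false`. -/
structure IsSyllableLength {G : Type*} [Group G] (X : Bool → Subgroup G)
    (len : G → ℕ) (head : G → Option Bool) : Prop where
  len_one : len 1 = 0
  head_one : head 1 = none
  len_mul : ∀ {t x g}, x ∈ X t → x ≠ 1 → head g ≠ some t → len (x * g) = len g + 1
  head_mul : ∀ {t x g}, x ∈ X t → x ≠ 1 → head g ≠ some t → head (x * g) = some t

namespace Monoid.Coprod

variable (A : Type uA) (B : Type uB) [Group A] [Group B]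

/-- The canonical copies of the two factors of `A ∗ B`. -/
def factor : Bool → Subgroup (A ∗ B)
  | true => (inl : A →* A ∗ B).range
  | false => (inr : B →* A ∗ B).range

/-- The two factors lifted to a common universe. -/
abbrev LiftedFactor : Bool → Type (max uA uB)
  | true => ULift.{max uA uB} A
  | false => ULift.{max uA uB} B

instance : ∀ t, Group (LiftedFactor A B t)
  | true => inferInstanceAs (Group (ULift A))
  | false => inferInstanceAs (Group (ULift B))

/-- The comparison map from the binary free product to the indexed one. -/
def toCoprodI : A ∗ B →* Monoid.CoprodI (LiftedFactor A B) :=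
  lift ((CoprodI.of (M := LiftedFactor A B) (i := true)).comp
      (MulEquiv.ulift.symm : A ≃* ULift.{max uA uB} A).toMonoidHom)
    ((CoprodI.of (M := LiftedFactor A B) (i := false)).comp
      (MulEquiv.ulift.symm : B ≃* ULift.{max uA uB} B).toMonoidHom)

variable {A B}

theorem exists_toCoprodI_eq_of {t : Bool} {x : A ∗ B} (hx : x ∈ factor A B t) (hx1 : x ≠ 1) :
    ∃ m : LiftedFactor A B t, m ≠ 1 ∧ toCoprodI A B x = CoprodI.of m := by
  cases t
  · obtain ⟨b, rfl⟩ := hx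
    refine ⟨ULift.up b, fun h => hx1 ?_, by simp [toCoprodI]; rfl⟩
    rw [show b = 1 from congrArg ULift.down h, map_one]
  · obtain ⟨a, rfl⟩ := hx
    refine ⟨ULift.up a, fun h => hx1 ?_, by simp [toCoprodI]; rfl⟩
    rw [show a = 1 from congrArg ULift.down h, map_one]

theorem exists_isSyllableLength (A : Type uA) (B : Type uB) [Group A] [Group B] :
    ∃ len head, IsSyllableLength (factor A B) len head := by
  classical
  let w : A ∗ B → CoprodI.Word (LiftedFactor A B) := fun g => CoprodI.Word.equiv (toCoprodI A B g)
  have hw : ∀ {t x g}, x ∈ factor A B t → x ≠ 1 → (w g).fstIdx ≠ some t →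
      ∃ (m : LiftedFactor A B t) (h1 : m ≠ 1) (h2 : (w g).fstIdx ≠ some t),
        w (x * g) = CoprodI.Word.cons m (w g) h2 h1 := by
    intro t x g hx hx1 hg
    obtain ⟨m, hm, hxm⟩ := exists_toCoprodI_eq_of hx hx1
    refine ⟨m, hm, hg, ?_⟩
    apply CoprodI.Word.equiv.symm.injective
    change CoprodI.Word.prod _ = CoprodI.Word.prod _
    rw [CoprodI.Word.prod_cons]
    have h : ∀ g, CoprodI.Word.prod (w g) = toCoprodI A B g :=
      fun g => CoprodI.Word.equiv.symm_apply_apply _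
    rw [h, h, map_mul, hxm]
  have w1 : w 1 = CoprodI.Word.empty := by
    apply CoprodI.Word.equiv.symm.injective
    simp only [w, Equiv.symm_apply_apply, map_one]
    rfl
  refine ⟨fun g => (w g).toList.length, fun g => (w g).fstIdx, ?_, ?_, ?_, ?_⟩
  · simp [w1, CoprodI.Word.empty]
  · simp [w1, CoprodI.Word.empty, CoprodI.Word.fstIdx]
  · intro t x g hx hx1 hg
    obtain ⟨m, h1, h2, h⟩ := hw hx hx1 hg
    simp [h]
  · intro t x g hx hx1 hg
    obtain ⟨m, h1, h2, h⟩ := hw hx hx1 hg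
    simp [h]

end Monoid.Coprod

section ReducedPaths

variable {G : Type*} [Group G]

/-- `V` is an infinite path in `G` all of whose steps are left multiplications by nontrivial
letters, the `n`-th one of type `τ n`, with alternating types. -/
structure IsReducedRay (X : Bool → Subgroup G) (τ : ℕ → Bool) (V : ℕ → G) : Prop where
  alt : ∀ n, τ (n + 1) = !τ n
  step : ∀ n, V (n + 1) * (V n)⁻¹ ∈ X (τ n)
  ne : ∀ n, V (n + 1) ≠ V n

/-- The two-sided version of `IsReducedRay`. -/
structure IsReducedLine (X : Bool → Subgroup G) (τ : ℤ → Bool) (W : ℤ → G) : Prop where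
  alt : ∀ n, τ (n + 1) = !τ n
  step : ∀ n, W (n + 1) * (W n)⁻¹ ∈ X (τ n)
  ne : ∀ n, W (n + 1) ≠ W n

variable {X : Bool → Subgroup G} {len : G → ℕ} {head : G → Option Bool}

theorem IsReducedLine.ray {τ : ℤ → Bool} {W : ℤ → G} (h : IsReducedLine X τ W) (k : ℤ) :
    IsReducedRay X (fun n => τ (k + n)) (fun n => W (k + n)) where
  alt n := by simpa [add_assoc] using h.alt (k + n)
  step n := by simpa [add_assoc] using h.step (k + n)
  ne n := by simpa [add_assoc] using h.ne (k + n)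

theorem IsReducedLine.mul_right {τ : ℤ → Bool} {W : ℤ → G} (h : IsReducedLine X τ W) (g : G) :
    IsReducedLine X τ (fun n => W n * g) where
  alt := h.alt
  step n := by simpa [mul_assoc] using h.step n
  ne n := by simpa using h.ne n

theorem IsReducedLine.neg {τ : ℤ → Bool} {W : ℤ → G} (h : IsReducedLine X τ W) :
    IsReducedLine X (fun n => τ (-n - 1)) (fun n => W (-n)) where
  alt n := by
    have := h.alt (-(n + 1) - 1)
    rw [show -(n + 1) - 1 + 1 = -n - 1 by ring] at this
    simp [this]
  step n := by
    have := (X _).inv_mem (h.step (-n - 1))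
    rw [show -n - 1 + 1 = -n by ring] at this
    rw [show -(n + 1) = -n - 1 by ring]
    simpa using this
  ne n := by
    have := h.ne (-n - 1)
    rw [show -n - 1 + 1 = -n by ring] at this
    rw [show -(n + 1) = -n - 1 by ring]
    exact this.symm

theorem IsReducedRay.shift {τ : ℕ → Bool} {V : ℕ → G} (h : IsReducedRay X τ V) (k : ℕ) :
    IsReducedRay X (fun n => τ (n + k)) (fun n => V (n + k)) where
  alt n := by simpa [add_right_comm] using h.alt (n + k)
  step n := by simpa [add_right_comm] using h.step (n + k)
  ne n := by simpa [add_right_comm] using h.ne (n + k)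

theorem IsReducedRay.cons {τ : ℕ → Bool} {V : ℕ → G} (h : IsReducedRay X τ V) {g : G}
    (hmem : V 0 * g⁻¹ ∈ X (!τ 0)) (hne : V 0 ≠ g) :
    IsReducedRay X (fun n => Nat.casesOn n (!τ 0) τ) (fun n => Nat.casesOn n g V) where
  alt n := by cases n <;> simp [h.alt]
  step n := by
    cases n
    · exact hmem
    · exact h.step _
  ne n := by
    cases n
    · exact hne
    · exact h.ne _

namespace IsSyllableLength

variable (hX : IsSyllableLength X len head)
include hX

theorem path {τ : ℕ → Bool} {V : ℕ → G} {N : ℕ} (alt : ∀ n < N, τ (n + 1) = !τ n)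
    (step : ∀ n < N, V (n + 1) * (V n)⁻¹ ∈ X (τ n)) (ne : ∀ n < N, V (n + 1) ≠ V n)
    (h0 : head (V 0) ≠ some (τ 0)) {n : ℕ} (hn : n ≤ N) :
    len (V n) = n + len (V 0) ∧ head (V n) ≠ some (τ n) := by
  induction n with
  | zero => exact ⟨by simp, h0⟩
  | succ n ih =>
    obtain ⟨h1, h2⟩ := ih (by omega)
    have hx : V (n + 1) * (V n)⁻¹ ≠ 1 := fun h => ne n hn (mul_inv_eq_one.1 h)
    have e : V (n + 1) = V (n + 1) * (V n)⁻¹ * V n := by group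
    rw [e, hX.len_mul (step n hn) hx h2, hX.head_mul (step n hn) hx h2, alt n hn, h1]
    exact ⟨by omega, by cases τ n <;> simp⟩

theorem ray {τ : ℕ → Bool} {V : ℕ → G} (h : IsReducedRay X τ V) {g : G}
    (h0 : head (V 0 * g) ≠ some (τ 0)) (n : ℕ) : len (V n * g) = n + len (V 0 * g) :=
  (hX.path (V := fun n => V n * g) (fun n _ => h.alt n)
    (fun n _ => by simpa [mul_assoc] using h.step n) (fun n _ => by simpa using h.ne n) h0
    le_rfl).1

theorem ray_len {τ : ℕ → Bool} {V : ℕ → G} (h : IsReducedRay X τ V) (n : ℕ) :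
    len (V n * (V 0)⁻¹) = n := by
  rw [hX.ray h (by simp [hX.head_one])]
  simp [hX.len_one]

theorem line_injective {τ : ℤ → Bool} {W : ℤ → G} (h : IsReducedLine X τ W) :
    Function.Injective W := by
  have key : ∀ (n : ℤ) (k : ℕ), W (n + k) = W n → k = 0 := by
    intro n k hk
    have := hX.ray_len (h.ray n) k
    simpa [hk, hX.len_one] using this.symm
  intro m n hmn
  rcases le_total m n with hle | hle
  · have := key m (n - m).toNat (by rw [hmn]; congr 1; omega)
    omega
  · have := key n (m - n).toNat (by rw [← hmn]; congr 1; omega)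
    omega

theorem type_unique {s t : Bool} {x : G} (hs : x ∈ X s) (ht : x ∈ X t) (hx : x ≠ 1) : s = t := by
  have h := fun {t} (ht : x ∈ X t) => hX.head_mul (g := 1) ht hx (by simp [hX.head_one])
  simpa using (h hs).symm.trans (h ht)

/-- Two rays which branch at their common origin form a reduced line, after omitting the origin
if the first steps have the same type. -/
theorem branch {τ τ' : ℕ → Bool} {V V' : ℕ → G} (h : IsReducedRay X τ V)
    (h' : IsReducedRay X τ' V') (h0 : V 0 = V' 0) (h1 : V 1 ≠ V' 1) :
    ∃ ε, ∀ m m', len (V (m + 1) * (V' (m' + 1))⁻¹) + ε = m + m' + 2 := by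
  have back : ∀ m', len (V' 1 * (V' (m' + 1))⁻¹) = m' ∧
      head (V' 1 * (V' (m' + 1))⁻¹) ≠ some (τ' 0) := by
    intro m'
    have := hX.path (N := m') (τ := fun j => τ' (m' - j))
      (V := fun j => V' (m' + 1 - j) * (V' (m' + 1))⁻¹) ?_ ?_ ?_ ?_ le_rfl
    · simpa [hX.len_one] using this
    · intro n hn
      have := h'.alt (m' - (n + 1))
      rw [show m' - (n + 1) + 1 = m' - n by omega] at this
      simp [this]
    · intro n hn
      have := (X _).inv_mem (h'.step (m' - n))
      rw [show m' + 1 - (n + 1) = m' - n by omega, show m' + 1 - n = m' - n + 1 by omega]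
      simpa [mul_assoc] using this
    · intro n hn
      have := h'.ne (m' - n)
      rw [show m' + 1 - (n + 1) = m' - n by omega, show m' + 1 - n = m' - n + 1 by omega]
      simpa [mul_assoc] using this.symm
    · simp [hX.head_one]
  by_cases hτ : τ 0 = τ' 0
  · refine ⟨1, fun m m' => ?_⟩
    obtain ⟨hl, hh⟩ := back m'
    have hmem : V 1 * (V' 1)⁻¹ ∈ X (τ' 0) := by
      have e : V 1 * (V' 1)⁻¹ = V 1 * (V 0)⁻¹ * (V' 1 * (V' 0)⁻¹)⁻¹ := by rw [h0]; group
      rw [e]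
      exact (X _).mul_mem (hτ ▸ h.step 0) ((X _).inv_mem (h'.step 0))
    have hne : V 1 * (V' 1)⁻¹ ≠ 1 := fun h => h1 (mul_inv_eq_one.1 h)
    have e : V 1 * (V' (m' + 1))⁻¹ = V 1 * (V' 1)⁻¹ * (V' 1 * (V' (m' + 1))⁻¹) := by group
    have a1 := hX.len_mul hmem hne hh
    have a2 := hX.head_mul hmem hne hh
    rw [← e] at a1 a2
    have := hX.ray (h.shift 1) (g := (V' (m' + 1))⁻¹) (by simp [a2, ← hτ, h.alt]) m
    rw [this]
    simp only [zero_add, a1, hl]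
    omega
  · refine ⟨0, fun m m' => ?_⟩
    obtain ⟨hl, hh⟩ := back m'
    have hmem := (X _).inv_mem (h'.step 0)
    have hne : (V' (0 + 1) * (V' 0)⁻¹)⁻¹ ≠ 1 :=
      fun he => h'.ne 0 (mul_inv_eq_one.1 (inv_eq_one.1 he))
    have e : V 0 * (V' (m' + 1))⁻¹ =
        (V' (0 + 1) * (V' 0)⁻¹)⁻¹ * (V' 1 * (V' (m' + 1))⁻¹) := by rw [h0]; group
    have a1 := hX.len_mul hmem hne hh
    have a2 := hX.head_mul hmem hne hh
    rw [← e] at a1 a2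
    have := hX.ray h (g := (V' (m' + 1))⁻¹) (by simp [a2, Ne.symm hτ]) (m + 1)
    rw [this, a1, hl]
    omega

end IsSyllableLength

/-- Every point is the origin of a reduced ray which eventually runs along a given line. -/
theorem IsReducedLine.exists_ray
    (hgen : ∀ P : G → Prop, P 1 → (∀ t x g, x ∈ X t → P g → P (x * g)) → ∀ g, P g)
    {τ : ℤ → Bool} {W : ℤ → G} (h : IsReducedLine X τ W) (g : G) :
    ∃ σ V, IsReducedRay X σ V ∧ V 0 = g ∧ ∃ (N : ℕ) (s : ℤ), ∀ n : ℕ, N ≤ n → V n = W (n + s) := by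
  suffices H : ∀ g, ∃ σ V, IsReducedRay X σ V ∧ V 0 = g * W 0 ∧
      ∃ (N : ℕ) (s : ℤ), ∀ n : ℕ, N ≤ n → V n = W (n + s) by simpa using H (g * (W 0)⁻¹)
  refine hgen _ ⟨_, _, h.ray 0, by simp, 0, 0, by simp⟩ ?_
  rintro t y g hy ⟨σ, V, hV, hV0, N, s, hN⟩
  by_cases hy1 : y = 1
  · exact ⟨σ, V, hV, by simpa [hy1] using hV0, N, s, hN⟩
  by_cases hσ : σ 0 = t
  · by_cases hyV : y * g * W 0 = V 1
    · exact ⟨_, _, hV.shift 1, by simp [hyV], N, s + 1, fun n hn => by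
        rw [hN _ (by omega)]; congr 1; push_cast; ring⟩
    · refine ⟨_, _, (hV.shift 1).cons (g := y * g * W 0) ?_ (Ne.symm hyV), rfl, N + 1, s, ?_⟩
      · have e : V (0 + 1) * (y * g * W 0)⁻¹ = V (0 + 1) * (V 0)⁻¹ * y⁻¹ := by rw [hV0]; group
        rw [e]
        simp only [hV.alt, Bool.not_not]
        exact (X _).mul_mem (hV.step 0) ((X _).inv_mem (hσ ▸ hy))
      · rintro (_ | n) hn
        · omega
        · exact hN _ (by omega)
  · refine ⟨_, _, hV.cons (g := y * g * W 0) ?_ ?_, rfl, N + 1, s - 1, ?_⟩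
    · have e : V 0 * (y * g * W 0)⁻¹ = y⁻¹ := by rw [hV0]; group
      rw [e, show (!σ 0) = t by cases t <;> simp_all]
      exact (X _).inv_mem hy
    · simpa [hV0, mul_assoc] using hy1
    · rintro (_ | n) hn
      · omega
      · change V n = _
        rw [hN _ (by omega)]; congr 1; push_cast; ring

theorem zpow_shift {W : ℤ → G} {c : G} {p : ℤ} (h : ∀ n, W n * c = W (n + p)) (m n : ℤ) :
    W n * c ^ m = W (n + m * p) := by
  induction m using Int.induction_on generalizing n with
  | zero => simp
  | succ m ih => rw [zpow_add_one, ← mul_assoc, ih, h]; congr 1; ring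
  | pred m ih =>
    rw [zpow_sub_one, ← mul_assoc, ih, mul_inv_eq_iff_eq_mul, h]; congr 1; ring

/-- A translation has at most one axis. -/
theorem IsSyllableLength.axis_unique (hX : IsSyllableLength X len head)
    (hgen : ∀ P : G → Prop, P 1 → (∀ t x g, x ∈ X t → P g → P (x * g)) → ∀ g, P g)
    {τ τ' : ℤ → Bool} {W W' : ℤ → G} (h : IsReducedLine X τ W) (h' : IsReducedLine X τ' W')
    {w : G} {p p' : ℕ} (hp : 0 < p) (hw : ∀ n, W n * w = W (n + p))
    (hw' : ∀ n, W' n * w = W' (n + p')) : ∃ δ : ℤ, ∀ n, W' n = W (n + δ) := by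
  obtain ⟨σ, V, hV, hV0, N, s, hN⟩ := h.exists_ray hgen (W' 0)
  have key : ∀ n : ℕ, V n = W' n := by
    by_contra! hne
    classical
    let k := Nat.find hne
    have hk : V k ≠ W' k := Nat.find_spec hne
    obtain ⟨j, hj⟩ : ∃ j, k = j + 1 := Nat.exists_eq_succ_of_ne_zero fun h0 => hk (by simp [h0, hV0])
    have hjj : V j = W' j := not_not.1 (Nat.find_min hne (m := j) (by omega))
    obtain ⟨ε, hε⟩ := hX.branch (hV.shift j) (h'.ray j) (by simpa using hjj)
      (by rw [hj] at hk; simpa [add_comm] using hk)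
    have h1 := hε N 0
    have h2 := hε (N + p) p'
    have e : V (N + p + 1 + j) * (W' (j + (p' + 1 : ℕ)))⁻¹ = V (N + 1 + j) * (W' (j + (0 + 1 : ℕ)))⁻¹ := by
      rw [hN _ (by omega), hN _ (by omega),
        show ((N + p + 1 + j : ℕ) + s : ℤ) = (N + 1 + j : ℕ) + s + p by push_cast; ring, ← hw,
        show (j + (p' + 1 : ℕ) : ℤ) = j + (0 + 1 : ℕ) + p' by push_cast; ring, ← hw']
      group
    rw [e] at h2
    omega
  have hWW' : ∀ n : ℕ, N ≤ n → W' n = W (n + s) := fun n hn => by rw [← key, hN n hn]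
  have hpp : p' = p := by
    have h1 : W (N + p' + s) = W (N + s + p) := by
      have := hWW' (N + p') (by omega)
      push_cast at this
      rw [← this, ← hw, ← hw', hWW' N le_rfl]
    have := hX.line_injective h h1
    omega
  subst hpp
  refine ⟨s, fun n => ?_⟩
  obtain ⟨q, m, hm, hq⟩ : ∃ (q : ℤ) (m : ℕ), N ≤ m ∧ n + q * p' = m := by
    refine ⟨N + n.natAbs, (n + (N + n.natAbs) * p').toNat, ?_, ?_⟩ <;>
    · have : (N + n.natAbs : ℤ) * 1 ≤ (N + n.natAbs) * p' := by gcongr; omega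
      omega
  apply mul_right_cancel (b := w ^ q)
  rw [zpow_shift hw', zpow_shift hw, hq, hWW' m hm]
  congr 1
  linarith

end ReducedPaths

section Axis

variable {G : Type*} [Group G] {X : Bool → Subgroup G}

theorem List.isConj_prod_rotate (l : List G) (k : ℕ) : IsConj l.prod (l.rotate k).prod := by
  induction k generalizing l with
  | zero => rw [List.rotate_zero]
  | succ k ih =>
    cases l with
    | nil => simp
    | cons a l =>
      rw [List.rotate_cons_succ]
      refine IsConj.trans ?_ (ih (l ++ [a]))
      rw [isConj_iff]
      exact ⟨a⁻¹, by simp⟩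

/-- The path spelled by the periodic bi-infinite word with period `l`. -/
def periodicPath (l : List G) (n : ℤ) : G :=
  l.prod ^ (n / l.length) * (l.take (n % l.length).toNat).prod

theorem periodicPath_eq {l : List G} (hl : 0 < l.length) (q : ℤ) {r : ℕ} (hr : r ≤ l.length) :
    periodicPath l (q * l.length + r) = l.prod ^ q * (l.take r).prod := by
  have hl' : (l.length : ℤ) ≠ 0 := by omega
  rcases hr.lt_or_eq with h | rfl
  · have h1 : (q * l.length + r : ℤ) / l.length = q := by
      rw [Int.add_comm, Int.add_mul_ediv_right _ _ hl', Int.ediv_eq_zero_of_lt] <;> omega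
    have h2 : (q * l.length + r : ℤ) % l.length = r := by
      rw [Int.add_comm, Int.add_mul_emod_self_right, Int.emod_eq_of_lt] <;> omega
    simp [periodicPath, h1, h2]
  · rw [show (q * l.length + l.length : ℤ) = (q + 1) * l.length by ring]
    simp [periodicPath, Int.mul_ediv_cancel _ hl', zpow_add_one]

theorem periodicPath_add_length {l : List G} (hl : 0 < l.length) (n : ℤ) :
    periodicPath l (n + l.length) = l.prod * periodicPath l n := by
  have hl' : (l.length : ℤ) ≠ 0 := by omega
  simp [periodicPath, Int.add_ediv_of_dvd_right (dvd_refl (l.length : ℤ)), Int.ediv_self hl',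
    add_comm _ (1 : ℤ), zpow_add, mul_assoc]

/-- An element which is not conjugate into a factor is conjugate to a translation of a reduced
line. -/
theorem exists_isReducedLine
    (hgen : ∀ P : G → Prop, P 1 → (∀ t x g, x ∈ X t → P g → P (x * g)) → ∀ g, P g)
    {u : G} (hu : ∀ g t, g * u * g⁻¹ ∉ X t) :
    ∃ τ W v, IsReducedLine X τ W ∧ W 0 = 1 ∧ IsConj v u ∧
      ∃ p : ℕ, 0 < p ∧ ∀ n, W n * v = W (n + p) := by
  classical
  let P : List G → Prop := fun l => (∀ x ∈ l, ∃ t, x ∈ X t) ∧ IsConj u l.prod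
  have hP : ∃ n l, P l ∧ l.length = n := by
    obtain ⟨l, h1, h2⟩ := hgen (fun g => ∃ l : List G, (∀ x ∈ l, ∃ t, x ∈ X t) ∧ l.prod = g)
      ⟨[], by simp⟩ (by
        rintro t x g hx ⟨l, h1, h2⟩
        exact ⟨x :: l, List.forall_mem_cons.2 ⟨⟨t, hx⟩, h1⟩, by simp [h2]⟩) u
    exact ⟨_, l, ⟨h1, h2 ▸ IsConj.refl _⟩, rfl⟩
  obtain ⟨l, hl, hlen⟩ := Nat.find_spec hP
  have hmin : ∀ l', P l' → l.length ≤ l'.length := fun l' h' =>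
    hlen ▸ Nat.find_min' hP ⟨l', h', rfl⟩
  have hrot : ∀ k, P (l.rotate k) := fun k =>
    ⟨by simpa using hl.1, hl.2.trans (l.isConj_prod_rotate k)⟩
  have two : 2 ≤ l.length := by
    by_contra! h
    obtain ⟨g, hg⟩ := isConj_iff.1 hl.2
    match l, h with
    | [], _ => exact hu g true (by rw [hg]; simp)
    | [x], _ =>
      obtain ⟨t, ht⟩ := hl.1 x (by simp)
      exact hu g t (by rw [hg]; simpa using ht)
  have adj : ∀ x y r t, P (x :: y :: r) → (x :: y :: r).length = l.length →
      x ∈ X t → y ∉ X t := by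
    intro x y r t h hlen' hx hy
    have hxy : P ((x * y) :: r) := by
      refine ⟨fun z hz => ?_, by simpa [mul_assoc] using h.2⟩
      rcases List.mem_cons.1 hz with rfl | hz
      · exact ⟨t, mul_mem hx hy⟩
      · exact h.1 z (by simp [hz])
    have := hmin _ hxy
    simp at this hlen'
    omega
  have hpos : 0 < l.length := by omega
  have hnext : ∀ (r : ℕ) (hr : r < l.length) t, l[r] ∈ X t →
      l[(r + 1) % l.length]'(Nat.mod_lt _ hpos) ∉ X t := by
    intro r hr t
    have h0 : (l.rotate r)[0]'(by simpa) = l[r] := by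
      rw [List.getElem_rotate]; simp [Nat.mod_eq_of_lt hr]
    have h1 : (l.rotate r)[1]'(by simpa) = l[(r + 1) % l.length]'(Nat.mod_lt _ hpos) := by
      rw [List.getElem_rotate]; simp [add_comm]
    rw [← h0, ← h1]
    have : ∀ l' (h : l'.length = l.length), P l' → l'[0] ∈ X t → l'[1] ∉ X t := by
      intro l' h hl'
      match l', h with
      | x :: y :: s, h => exact adj x y s t hl' h
      | [x], h => simp at h; omega
      | [], h => simp at h; omega
    exact this _ (List.length_rotate ..) (hrot r)
  have hmod : ∀ n : ℤ, (n % l.length).toNat < l.length := by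
    intro n
    have := Int.emod_lt_of_pos n (b := l.length) (by omega)
    omega
  have hτ : ∀ n : ℤ, ∃ t, l[(n % l.length).toNat]'(hmod n) ∈ X t := fun n =>
    hl.1 _ (List.getElem_mem _)
  choose τ hτ using hτ
  have hsucc : ∀ n : ℤ, ((n + 1) % l.length).toNat = ((n % l.length).toNat + 1) % l.length := by
    intro n
    zify
    rw [Int.toNat_of_nonneg (Int.emod_nonneg _ (by omega)),
      Int.toNat_of_nonneg (Int.emod_nonneg _ (by omega))]
    simp
  have hstep : ∀ n, (periodicPath l n)⁻¹ * periodicPath l (n + 1) =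
      l[(n % l.length).toNat]'(hmod n) := by
    intro n
    have e : n = n / l.length * l.length + (n % l.length).toNat := by
      rw [Int.toNat_of_nonneg (Int.emod_nonneg _ (by omega))]
      exact (Int.ediv_mul_add_emod ..).symm
    have e1 := periodicPath_eq hpos (n / l.length) (hmod n).le
    have e2 := periodicPath_eq hpos (n / l.length) (hmod n)
    push_cast at e2
    rw [← add_assoc, ← e] at e2
    rw [← e] at e1
    rw [e1, e2, List.prod_take_succ _ _ (hmod n)]
    group
  have hdiff : ∀ n, τ (n + 1) ≠ τ n := by
    intro n hn
    refine hnext _ (hmod n) _ (hτ n) ?_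
    have := hτ (n + 1)
    simp only [hsucc, hn] at this
    exact this
  have hW : IsReducedLine X τ fun n => (periodicPath l n)⁻¹ := by
    refine ⟨fun n => ?_, fun n => ?_, fun n hn => ?_⟩
    · have := hdiff n
      revert this
      cases τ (n + 1) <;> cases τ n <;> simp
    · have := inv_mem (hτ n)
      rw [← hstep] at this
      simpa using this
    · have h1 := hstep n
      rw [inv_inj.1 hn, inv_mul_cancel] at h1
      apply hnext _ (hmod n) (τ (n + 1)) (h1 ▸ one_mem _)
      have := hτ (n + 1)
      simp only [hsucc] at this
      exact this
  refine ⟨_, _, l.prod, hW.neg, by simp [periodicPath], hl.2.symm, l.length, hpos, fun n => ?_⟩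
  have := periodicPath_add_length hpos (-(n + l.length))
  rw [show -(n + l.length) + l.length = -n by ring] at this
  rw [this]
  group

/-- `c` generates the group of translations of the reduced line `W` through `1`, and translates
it by the positive amount `p`. -/
structure IsAxis (X : Bool → Subgroup G) (τ : ℤ → Bool) (W : ℤ → G) (c : G) (p : ℕ) : Prop where
  line : IsReducedLine X τ W
  zero : W 0 = 1
  pos : 0 < p
  shift : ∀ n, W n * c = W (n + p)
  mem_zpowers : ∀ g δ, (∀ n, W n * g = W (n + δ)) → g ∈ Subgroup.zpowers c

theorem exists_isAxis
    (hgen : ∀ P : G → Prop, P 1 → (∀ t x g, x ∈ X t → P g → P (x * g)) → ∀ g, P g)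
    {u : G} (hu : ∀ g t, g * u * g⁻¹ ∉ X t) :
    ∃ τ W c p, IsAxis X τ W c p ∧ ∃ k : ℕ, 0 < k ∧ ∃ h, u = h * c ^ k * h⁻¹ := by
  classical
  obtain ⟨τ, W, v, hW, h0, hv, q, hq, hvq⟩ := exists_isReducedLine hgen hu
  have hex : ∃ p : ℕ, 0 < p ∧ ∃ c, ∀ n, W n * c = W (n + p) := ⟨q, hq, v, hvq⟩
  obtain ⟨hp, c, hc⟩ := Nat.find_spec hex
  set p := Nat.find hex with hpdef
  have key : ∀ g δ, (∀ n, W n * g = W (n + δ)) → g = c ^ (δ / p) ∧ (p : ℤ) ∣ δ := by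
    intro g δ hg
    have hr : ∀ n, W n * (g * c ^ (-(δ / p))) = W (n + δ % p) := by
      intro n
      rw [← mul_assoc, hg, zpow_shift hc]
      congr 1
      linarith [Int.emod_add_mul_ediv δ p]
    have hr0 : δ % p = 0 := by
      by_contra hne
      have h1 := Int.emod_nonneg δ (b := p) (by omega)
      have h2 := Int.emod_lt_of_pos δ (b := p) (by omega)
      exact Nat.find_min hex (m := (δ % p).toNat) (by omega)
        ⟨by omega, _, fun n => by rw [hr, Int.toNat_of_nonneg h1]⟩
    refine ⟨?_, Int.dvd_of_emod_eq_zero hr0⟩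
    have := hr 0
    rw [hr0, add_zero, mul_eq_left, zpow_neg, mul_inv_eq_one] at this
    exact this
  obtain ⟨hvc, hpq⟩ := key v q hvq
  obtain ⟨k, rfl⟩ := Int.natCast_dvd_natCast.1 hpq
  obtain ⟨h, hh⟩ := isConj_iff.1 hv
  refine ⟨τ, W, c, p, ⟨hW, h0, hp, hc, fun g δ hg => ⟨_, (key g δ hg).1.symm⟩⟩, k,
    Nat.pos_of_mul_pos_left hq, h, ?_⟩
  rw [← hh, hvc]
  simp [hp.ne']

end Axis

section Axis

variable {G : Type*} [Group G] {X : Bool → Subgroup G} {len : G → ℕ} {head : G → Option Bool}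

namespace IsAxis

variable {τ τ' : ℤ → Bool} {W W' : ℤ → G} {c c' : G} {p p' : ℕ}

theorem zpow_eq (h : IsAxis X τ W c p) (m : ℤ) : c ^ m = W (m * p) := by
  simpa [h.zero] using zpow_shift h.shift m 0

theorem zpow_ne_one (hX : IsSyllableLength X len head) (h : IsAxis X τ W c p) {m : ℤ}
    (hm : m ≠ 0) : c ^ m ≠ 1 := by
  rw [h.zpow_eq, ← h.zero, (hX.line_injective h.line).ne_iff]
  have := h.pos
  positivity

theorem type_add (hX : IsSyllableLength X len head) (h : IsAxis X τ W c p) (n : ℤ) :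
    τ (n + p) = τ n := by
  refine hX.type_unique (h.line.step (n + p)) ?_ fun he => h.line.ne _ (mul_inv_eq_one.1 he)
  have := h.line.step n
  rw [show n + p + 1 = n + 1 + p by ring, ← h.shift, ← h.shift]
  simpa [mul_assoc] using this

theorem type_add_mul (hX : IsSyllableLength X len head) (h : IsAxis X τ W c p) (n : ℤ) (d : ℕ) :
    τ (n + d * p) = τ n := by
  induction d with
  | zero => simp
  | succ d ih => rw [← ih, ← h.type_add hX (n + d * p)]; congr 1; push_cast; ring

theorem mem_zpowers_of_commute (hX : IsSyllableLength X len head)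
    (hgen : ∀ P : G → Prop, P 1 → (∀ t x g, x ∈ X t → P g → P (x * g)) → ∀ g, P g)
    (h : IsAxis X τ W c p) {v : G} (hv : Commute v c) : v ∈ Subgroup.zpowers c := by
  obtain ⟨δ, hδ⟩ := hX.axis_unique hgen h.line (h.line.mul_right v) h.pos h.shift
    (p' := p) fun n => by rw [mul_assoc, hv.eq, ← mul_assoc, h.shift]
  exact h.mem_zpowers v δ hδ

theorem conj_mem_zpowers (hX : IsSyllableLength X len head)
    (hgen : ∀ P : G → Prop, P 1 → (∀ t x g, x ∈ X t → P g → P (x * g)) → ∀ g, P g)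
    (h : IsAxis X τ W c p) (h' : IsAxis X τ' W' c' p') {g : G} {m m' : ℤ} (hm : m ≠ 0)
    (heq : c ^ m = g * c' ^ m' * g⁻¹) : g * c' * g⁻¹ ∈ Subgroup.zpowers c := by
  wlog hpos : 0 < m generalizing m m'
  · refine this (m := -m) (m' := -m') (by omega) ?_ (by omega)
    rw [zpow_neg, heq, zpow_neg]
    group
  have hp := h.pos
  have hm' : m' ≠ 0 := by
    rintro rfl
    exact h.zpow_ne_one hX hm (by simp [heq])
  have hw : ∀ n, W n * c ^ m = W (n + (m.toNat * p : ℕ)) := fun n => by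
    rw [zpow_shift h.shift]
    push_cast
    rw [Int.toNat_of_nonneg hpos.le]
  have hw' : ∀ n, W' n * g⁻¹ * c ^ m = W' (n + m' * p') * g⁻¹ := fun n => by
    rw [heq, ← zpow_shift h'.shift]
    group
  have hwc : ∀ n, W' n * g⁻¹ * (g * c' * g⁻¹) = W' (n + p') * g⁻¹ := fun n => by
    rw [← h'.shift]
    group
  have hmp : 0 < m.toNat * p := Nat.mul_pos (by omega) hp
  rcases hm'.lt_or_gt with hneg | hpos'
  · obtain ⟨δ, hδ⟩ := hX.axis_unique hgen h.line (h'.line.neg.mul_right g⁻¹) hmp hw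
      (p' := (-m').toNat * p') fun n => by
        rw [hw']
        push_cast
        rw [Int.toNat_of_nonneg (by omega)]
        congr 2
        ring
    refine h.mem_zpowers _ (-p') fun n => ?_
    have e : W n = W' (-(n - δ)) * g⁻¹ := by rw [hδ (n - δ)]; congr 1; ring
    rw [e, hwc]
    have := hδ (n - δ - p')
    rw [show -(n - δ - p') = -(n - δ) + p' by ring] at this
    rw [this]
    congr 1
    ring
  · obtain ⟨δ, hδ⟩ := hX.axis_unique hgen h.line (h'.line.mul_right g⁻¹) hmp hw
      (p' := m'.toNat * p') fun n => by
        rw [hw']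
        push_cast
        rw [Int.toNat_of_nonneg (by omega)]
    refine h.mem_zpowers _ p' fun n => ?_
    have e : W n = W' (n - δ) * g⁻¹ := by rw [hδ (n - δ)]; congr 1; ring
    rw [e, hwc, hδ]
    congr 1
    ring

end IsAxis

end Axis

section LocalAction

variable {K G : Type*} [Group K] [Group G]

/-- A group acting on `G` through left multiplication acts on any subset `S`: it acts as on `G` on
the orbits contained in `S`, and trivially elsewhere. -/
theorem exists_localAction (f : K →* G) (S : Set G) :
    ∃ ψ : K →* Equiv.Perm S, ∀ k (s : S), (∀ k', f k' * s ∈ S) → (ψ k s : G) = f k * s := by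
  classical
  let sm : K → S → S := fun k s => if h : ∀ k', f k' * s ∈ S then ⟨f k * s, h k⟩ else s
  have sm_pos : ∀ k (s : S), (∀ k', f k' * s ∈ S) → (sm k s : G) = f k * s := fun k s h => by
    simp only [sm]
    rw [dif_pos h]
  have sm_neg : ∀ k (s : S), (¬ ∀ k', f k' * s ∈ S) → sm k s = s := fun k s h => dif_neg h
  let act : MulAction K S :=
    { smul := sm
      one_smul := fun s => by
        change sm 1 s = s
        by_cases h : ∀ k', f k' * s ∈ S
        · ext; simp [sm_pos 1 s h]
        · exact sm_neg 1 s h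
      mul_smul := fun k l s => by
        change sm (k * l) s = sm k (sm l s)
        by_cases h : ∀ k', f k' * s ∈ S
        · ext
          rw [sm_pos _ s h, sm_pos k, sm_pos l s h, map_mul, mul_assoc]
          intro k'
          rw [sm_pos l s h, ← mul_assoc, ← map_mul]
          exact h _
        · rw [sm_neg _ s h, sm_neg l s h, sm_neg k s h] }
  exact ⟨MulAction.toPermHom K S, sm_pos⟩

end LocalAction

namespace Monoid.Coprod

variable {A : Type uA} {B : Type uB} [Group A] [Group B]

theorem factor_induction (P : A ∗ B → Prop) (one : P 1)
    (mul : ∀ t x g, x ∈ factor A B t → P g → P (x * g)) (g : A ∗ B) : P g :=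
  induction_on' g one (fun a x hx => mul true _ x ⟨a, rfl⟩ hx)
    fun b x hx => mul false _ x ⟨b, rfl⟩ hx

/-- Free products of finite groups are residually finite. -/
theorem exists_finite_quotient [Finite A] [Finite B] {T : Set (A ∗ B)} (hT : T.Finite)
    (h1 : 1 ∉ T) : ∃ (Γ : Type (max uA uB)) (_ : Group Γ) (_ : Finite Γ) (π : A ∗ B →* Γ),
      ∀ g ∈ T, π g ≠ 1 := by
  choose ψA hA using exists_localAction (inl : A →* A ∗ B)
  choose ψB hB using exists_localAction (inr : B →* A ∗ B)
  have key : ∀ g : A ∗ B, ∃ F : Set (A ∗ B), F.Finite ∧ 1 ∈ F ∧ ∀ S, F ⊆ S → ∀ h : 1 ∈ S,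
      (lift (ψA S) (ψB S) g ⟨1, h⟩ : A ∗ B) = g := by
    intro g
    induction g using induction_on' with
    | one => exact ⟨{1}, Set.finite_singleton _, rfl, fun S _ h => by simp⟩
    | inl_mul a g ih =>
      obtain ⟨F, hF, hF1, h⟩ := ih
      refine ⟨F ∪ Set.range fun a => inl a * g, hF.union (Set.finite_range _), .inl hF1,
        fun S hS hS1 => ?_⟩
      have e := h S (Set.subset_union_left.trans hS) hS1
      rw [map_mul, lift_apply_inl, Equiv.Perm.mul_apply, hA, e]
      intro a'
      rw [e]
      exact hS (.inr ⟨a', rfl⟩)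
    | inr_mul b g ih =>
      obtain ⟨F, hF, hF1, h⟩ := ih
      refine ⟨F ∪ Set.range fun b => inr b * g, hF.union (Set.finite_range _), .inl hF1,
        fun S hS hS1 => ?_⟩
      have e := h S (Set.subset_union_left.trans hS) hS1
      rw [map_mul, lift_apply_inr, Equiv.Perm.mul_apply, hB, e]
      intro b'
      rw [e]
      exact hS (.inr ⟨b', rfl⟩)
  choose F hF hF1 hFS using key
  let S : Set (A ∗ B) := F 1 ∪ ⋃ g ∈ T, F g
  have hS : S.Finite := (hF 1).union (hT.biUnion fun g _ => hF g)
  have : Finite S := hS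
  refine ⟨Equiv.Perm S, inferInstance, inferInstance, lift (ψA S) (ψB S), fun g hg h => ?_⟩
  have := hFS g S (Set.subset_union_of_subset_right (Set.subset_biUnion_of_mem hg) _) (.inl (hF1 1))
  rw [h] at this
  exact h1 ((show g = 1 from this.symm) ▸ hg)

end Monoid.Coprod

section Separation

open scoped commutatorElement

variable {G : Type*} [Group G] {X : Bool → Subgroup G} {len : G → ℕ} {head : G → Option Bool}

namespace IsAxis

variable {τ : ℤ → Bool} {W : ℤ → G} {c : G} {p : ℕ}

theorem eq_mul_zpow (h : IsAxis X τ W c p) (n : ℤ) :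
    ∃ r < p, ∃ a : ℤ, n = r + a * p ∧ W n = W r * c ^ a := by
  have hp := h.pos
  have h1 := Int.emod_nonneg n (b := p) (by omega)
  have h2 := Int.emod_lt_of_pos n (b := p) (by omega)
  have h3 : n = (n % p).toNat + n / p * p := by
    rw [Int.toNat_of_nonneg h1]
    exact (Int.emod_add_ediv_mul n p).symm
  exact ⟨(n % p).toNat, by omega, n / p, h3, by rw [zpow_shift h.shift, ← h3]⟩

theorem natCast_mul_dvd_sub (hX : IsSyllableLength X len head)
    (hgen : ∀ P : G → Prop, P 1 → (∀ t x g, x ∈ X t → P g → P (x * g)) → ∀ g, P g)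
    (h : IsAxis X τ W c p) {Γ : Type*} [Group Γ] (π : G →* Γ)
    (hπ : ∀ r < p, ∀ s < p, π ⁅(W s)⁻¹ * W r, c⁆ = 1 → ⁅(W s)⁻¹ * W r, c⁆ = 1) {n n' : ℤ}
    (heq : π (W n) = π (W n')) : ((orderOf (π c) * p : ℕ) : ℤ) ∣ n - n' := by
  obtain ⟨r, hr, a, hn, hWn⟩ := h.eq_mul_zpow n
  obtain ⟨s, hs, b, hn', hWn'⟩ := h.eq_mul_zpow n'
  have e : π ((W s)⁻¹ * W r) = π c ^ (b - a) := by
    rw [hWn, hWn', map_mul, map_mul, map_zpow, map_zpow] at heq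
    rw [map_mul, map_inv, zpow_sub, inv_mul_eq_iff_eq_mul, ← mul_assoc, ← heq]
    group
  have hcomm : Commute ((W s)⁻¹ * W r) c := by
    refine commutatorElement_eq_one_iff_commute.1 (hπ r hr s hs ?_)
    rw [map_commutatorElement, e, commutatorElement_eq_one_iff_commute]
    exact (Commute.refl _).zpow_left _
  obtain ⟨q, hq⟩ := h.mem_zpowers_of_commute hX hgen hcomm
  have hrs : (r : ℤ) = s + q * p := by
    apply hX.line_injective h.line
    rw [← zpow_shift h.shift]
    simp only at hq
    rw [hq, mul_inv_cancel_left]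
  have hq0 : q = 0 := by
    by_contra hq0
    rcases lt_or_gt_of_ne hq0 with h0 | h0 <;> nlinarith
  obtain rfl : r = s := by simpa [hq0] using hrs
  rw [inv_mul_cancel, map_one] at e
  have hd := orderOf_dvd_iff_zpow_eq_one.2 e.symm
  rw [hn, hn', show (r + a * p - (r + b * p) : ℤ) = -((b - a) * p) by ring, dvd_neg]
  push_cast
  exact mul_dvd_mul_right hd _

theorem ne_mul_of_not_commute (h : IsAxis X τ W c p) {Γ : Type*} [Group Γ] (π : G →* Γ) {y : G}
    (hπ : ∀ r < p, ∀ s < p, π ⁅(W s)⁻¹ * y * W r, c⁆ ≠ 1) (n n' : ℤ) :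
    π (W n') ≠ π y * π (W n) := by
  intro heq
  obtain ⟨r, hr, a, -, hWn⟩ := h.eq_mul_zpow n
  obtain ⟨s, hs, b, -, hWn'⟩ := h.eq_mul_zpow n'
  refine hπ r hr s hs ?_
  have e : π ((W s)⁻¹ * y * W r) = π c ^ (b - a) := by
    rw [hWn, hWn', map_mul, map_mul, map_zpow, map_zpow] at heq
    rw [map_mul, map_mul, map_inv, zpow_sub, mul_assoc, inv_mul_eq_iff_eq_mul, ← mul_assoc, heq]
    group
  rw [map_commutatorElement, e, commutatorElement_eq_one_iff_commute]
  exact (Commute.refl _).zpow_left _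

end IsAxis

end Separation

namespace Monoid.Coprod

variable {A : Type uA} {B : Type uB} [Group A] [Group B]

open scoped commutatorElement in
/-- A finite quotient in which the axes of the `c j` stay embedded modulo their periods, and some
translation along the axis of `c i` maps no point of another axis to a point of that axis. -/
theorem exists_separating_quotient [Finite A] [Finite B] {ι : Type*} [Finite ι]
    {τ : ι → ℤ → Bool} {W : ι → ℤ → A ∗ B} {c : ι → A ∗ B} {p : ι → ℕ}
    (h : ∀ j, IsAxis (factor A B) (τ j) (W j) (c j) (p j)) (i : ι)
    (hind : ∀ j ≠ i, ∀ g (m m' : ℤ), m ≠ 0 → c i ^ m ≠ g * c j ^ m' * g⁻¹) :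
    ∃ (Γ : Type (max uA uB)) (_ : Group Γ) (_ : Finite Γ) (π : A ∗ B →* Γ) (N : ℕ),
      π (c i) ^ N ≠ 1 ∧
      (∀ j n n', π (W j n) = π (W j n') →
        ((orderOf (π (c j)) * p j : ℕ) : ℤ) ∣ n - n') ∧
      ∀ j ≠ i, ∀ n n', π (W j n') ≠ π (c i) ^ N * π (W j n) := by
  obtain ⟨len, head, hX⟩ := exists_isSyllableLength A B
  let I := Σ j, Fin (p j) × Fin (p j)
  have hbad : (⋃ x : I, {N : ℕ | x.1 ≠ i ∧
      Commute ((W x.1 x.2.1)⁻¹ * c i ^ N * W x.1 x.2.2) (c x.1)}).Finite := by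
    refine Set.finite_iUnion fun ⟨j, s, r⟩ => Set.Subsingleton.finite ?_
    rintro N ⟨hj, hN⟩ N' ⟨-, hN'⟩
    obtain ⟨a, ha⟩ := (h j).mem_zpowers_of_commute hX factor_induction hN
    obtain ⟨b, hb⟩ := (h j).mem_zpowers_of_commute hX factor_induction hN'
    simp only at ha hb
    by_contra hne
    refine hind j hj (W j s) (N - N') (a - b) (by omega) ?_
    rw [zpow_sub, zpow_sub, ha, hb]
    simp only [zpow_natCast]
    group
  obtain ⟨N, hN⟩ := (hbad.union (Set.finite_singleton 0)).exists_notMem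
  simp only [Set.mem_union, Set.mem_iUnion, Set.mem_ofPred_eq, Set.mem_singleton_iff, not_or,
    not_exists, not_and] at hN
  obtain ⟨hN, hN0⟩ := hN
  let T : Set (A ∗ B) := {c i ^ N} ∪
    ((Set.range fun x : I => ⁅(W x.1 x.2.1)⁻¹ * W x.1 x.2.2, c x.1⁆) ∪
      Set.range fun x : I => ⁅(W x.1 x.2.1)⁻¹ * c i ^ N * W x.1 x.2.2, c x.1⁆)
  have hT : T.Finite :=
    (Set.finite_singleton _).union ((Set.finite_range _).union (Set.finite_range _))
  obtain ⟨Γ, _, _, π, hπ⟩ := exists_finite_quotient (hT.subset (Set.sdiff_subset (t := {1})))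
    (by simp)
  have hπ' : ∀ g ∈ T, g ≠ 1 → π g ≠ 1 := fun g hg hg1 => hπ g ⟨hg, hg1⟩
  refine ⟨Γ, inferInstance, inferInstance, π, N, ?_, fun j n n' => ?_, fun j hj n n' => ?_⟩
  · rw [← map_pow]
    exact hπ' _ (.inl rfl) (by exact_mod_cast (h i).zpow_ne_one hX (m := N) (by exact_mod_cast hN0))
  · refine (h j).natCast_mul_dvd_sub hX factor_induction π fun r hr s hs => ?_
    exact not_imp_not.1 (hπ' _ (.inr (.inl ⟨⟨j, ⟨s, hs⟩, ⟨r, hr⟩⟩, rfl⟩)))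
  · rw [← map_pow]
    refine (h j).ne_mul_of_not_commute π (fun r hr s hs => ?_) n n'
    refine hπ' _ (.inr (.inr ⟨⟨j, ⟨s, hs⟩, ⟨r, hr⟩⟩, rfl⟩)) fun h1 => ?_
    exact hN ⟨j, ⟨s, hs⟩, ⟨r, hr⟩⟩ hj (commutatorElement_eq_one_iff_commute.1 h1)

end Monoid.Coprod

section Holonomy

variable {Γ D : Type*} [Group D]

/-- The product of the values of `t` at the points `γ 1, …, γ n`. -/
def holonomy (t : Γ → D) (γ : ℕ → Γ) : ℕ → D
  | 0 => 1
  | n + 1 => t (γ (n + 1)) * holonomy t γ n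

open Classical in
/-- The function with the value `ρ` at `e`, the value `ρ'` at `e'` and the value `1` elsewhere. -/
noncomputable def twoPoint (e e' : Γ) (ρ ρ' : D) (γ : Γ) : D :=
  if γ = e then ρ else if γ = e' then ρ' else 1

theorem holonomy_twoPoint {e e' : Γ} (he : e ≠ e') (ρ ρ' : D) {γ : ℕ → Γ} {n : ℕ}
    (hγ : Set.InjOn γ (Set.Icc 1 n)) :
    ((¬ ∃ k ∈ Set.Icc 1 n, γ k = e) ∧ (¬ ∃ k ∈ Set.Icc 1 n, γ k = e') ∧
      holonomy (twoPoint e e' ρ ρ') γ n = 1) ∨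
    ((∃ k ∈ Set.Icc 1 n, γ k = e) ∧ (¬ ∃ k ∈ Set.Icc 1 n, γ k = e') ∧
      holonomy (twoPoint e e' ρ ρ') γ n = ρ) ∨
    ((¬ ∃ k ∈ Set.Icc 1 n, γ k = e) ∧ (∃ k ∈ Set.Icc 1 n, γ k = e') ∧
      holonomy (twoPoint e e' ρ ρ') γ n = ρ') ∨
    ((∃ k ∈ Set.Icc 1 n, γ k = e) ∧ (∃ k ∈ Set.Icc 1 n, γ k = e') ∧
      (holonomy (twoPoint e e' ρ ρ') γ n = ρ * ρ' ∨
        holonomy (twoPoint e e' ρ ρ') γ n = ρ' * ρ)) := by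
  induction n with
  | zero => simp [holonomy]
  | succ n ih =>
    have hstep : ∀ f, (∃ k ∈ Set.Icc 1 (n + 1), γ k = f) ↔
        (∃ k ∈ Set.Icc 1 n, γ k = f) ∨ γ (n + 1) = f := by
      intro f
      constructor
      · rintro ⟨k, hk, hf⟩
        rcases hk.2.lt_or_eq with hlt | rfl
        · exact .inl ⟨k, ⟨hk.1, by omega⟩, hf⟩
        · exact .inr hf
      · rintro (⟨k, hk, hf⟩ | hf)
        · exact ⟨k, ⟨hk.1, hk.2.trans n.le_succ⟩, hf⟩
        · exact ⟨n + 1, by simp, hf⟩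
    have hnew : ¬ ∃ k ∈ Set.Icc 1 n, γ k = γ (n + 1) := by
      rintro ⟨k, hk, hf⟩
      have := hγ ⟨hk.1, hk.2.trans n.le_succ⟩ (by simp) hf
      have := hk.2
      omega
    have := ih (hγ.mono (Set.Icc_subset_Icc_right n.le_succ))
    simp only [hstep, holonomy, twoPoint]
    by_cases h1 : γ (n + 1) = e
    · have h2 : γ (n + 1) ≠ e' := h1 ▸ he
      rw [h1] at hnew
      simp only [h1, if_true, he, or_false, or_true]
      generalize (∃ k ∈ Set.Icc 1 n, γ k = e) = E at *
      generalize (∃ k ∈ Set.Icc 1 n, γ k = e') = E' at *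
      clear hstep
      rcases this with h | h | h | h <;> simp_all
    · by_cases h2 : γ (n + 1) = e'
      · rw [h2] at hnew
        simp only [h2, he.symm, if_true, if_false, or_false, or_true]
        generalize (∃ k ∈ Set.Icc 1 n, γ k = e) = E at *
        generalize (∃ k ∈ Set.Icc 1 n, γ k = e') = E' at *
        clear hstep
        rcases this with h | h | h | h <;> simp_all
      · simp only [h1, h2, if_false, or_false, one_mul]
        exact this

end Holonomy

namespace Monoid.Coprod

variable {A : Type uA} {B : Type uB} [Group A] [Group B]

/-- The group acts on `Γ × D`, where the action of the second factor is twisted by `t`. -/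
theorem exists_twistedAction {Γ D : Type*} [Group Γ] [Group D] (π : A ∗ B →* Γ) (t : Γ → D)
    (ht : ∀ γ, t γ * t γ = 1) : ∃ φ : A ∗ B →* Equiv.Perm (Γ × D),
      (∀ x ∈ factor A B true, ∀ γ d, φ x (γ, d) = (π x * γ, d)) ∧
      ∀ x ∈ factor A B false, ∀ γ d, φ x (γ, d) = (π x * γ, t (π x * γ) * (t γ * d)) := by
  let β : A ∗ B →* Equiv.Perm (Γ × D) :=
    { toFun := fun g => Equiv.prodCongr (Equiv.mulLeft (π g)) (Equiv.refl D)
      map_one' := by ext <;> simp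
      map_mul' := fun g h => by ext <;> simp [mul_assoc] }
  let σ : Equiv.Perm (Γ × D) := Function.Involutive.toPerm (fun x => (x.1, t x.1 * x.2))
    fun x => by simp [← mul_assoc, ht]
  refine ⟨lift (β.comp inl) ((MulAut.conj σ).toMonoidHom.comp (β.comp inr)), ?_, ?_⟩
  · rintro _ ⟨a, rfl⟩ γ d
    simp [β]
  · rintro _ ⟨b, rfl⟩ γ d
    simp [β, σ, MulAut.conj_apply, Function.Involutive.toPerm, Equiv.symm]

theorem twistedAction_apply {Γ D : Type*} [Group Γ] [Group D] {π : A ∗ B →* Γ} {t : Γ → D}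
    (ht : ∀ γ, t γ * t γ = 1) {φ : A ∗ B →* Equiv.Perm (Γ × D)}
    (hA : ∀ x ∈ factor A B true, ∀ γ d, φ x (γ, d) = (π x * γ, d))
    (hB : ∀ x ∈ factor A B false, ∀ γ d, φ x (γ, d) = (π x * γ, t (π x * γ) * (t γ * d)))
    {τ : ℤ → Bool} {W : ℤ → A ∗ B} (h : IsReducedLine (factor A B) τ W) (h0 : W 0 = 1)
    (γ : Γ) (d : D) (n : ℕ) :
    φ (W n) (γ, d) = (π (W n) * γ, (if τ n then 1 else t (π (W n) * γ)) *
      holonomy t (fun k => π (W k) * γ) n * (if τ 0 then 1 else t γ) * d) := by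
  induction n with
  | zero => by_cases h : τ 0 = true <;> simp [h0, holonomy, h, ht]
  | succ n ih =>
    have e : W (n + 1 : ℕ) = W (n + 1) * (W n)⁻¹ * W n := by simp
    have e' : π (W (n + 1) * (W n)⁻¹) * (π (W n) * γ) = π (W (n + 1)) * γ := by
      simp [mul_assoc]
    have ht' : ∀ γ d, t γ * (t γ * d) = d := fun γ d => by rw [← mul_assoc, ht, one_mul]
    have hs := h.step n
    have ha := h.alt n
    rw [e, map_mul, Equiv.Perm.mul_apply, ih]
    by_cases hτ : τ n = true
    · rw [hτ] at hs ha
      rw [hA _ hs, e']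
      simp [hτ, ha, holonomy, mul_assoc, ht']
    · rw [Bool.not_eq_true] at hτ
      rw [hτ] at hs ha
      rw [hB _ hs, e']
      simp [hτ, ha, holonomy, mul_assoc, ht']

/-- The return map of the twisted action to a fiber is a conjugate of the holonomy. -/
theorem twistedAction_pow_apply {Γ D : Type*} [Group Γ] [Group D] {π : A ∗ B →* Γ} {t : Γ → D}
    (ht : ∀ γ, t γ * t γ = 1) {φ : A ∗ B →* Equiv.Perm (Γ × D)}
    (hA : ∀ x ∈ factor A B true, ∀ γ d, φ x (γ, d) = (π x * γ, d))
    (hB : ∀ x ∈ factor A B false, ∀ γ d, φ x (γ, d) = (π x * γ, t (π x * γ) * (t γ * d)))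
    {τ : ℤ → Bool} {W : ℤ → A ∗ B} {c : A ∗ B} {p : ℕ} (h : IsAxis (factor A B) τ W c p) (γ : Γ) :
    ∃ s : D, ∀ k d, (φ c ^ (orderOf (π c) * k)) (γ, d) = (γ, s *
      holonomy t (fun k => π (W k) * γ) (orderOf (π c) * p) ^ k * s⁻¹ * d) := by
  obtain ⟨len, head, hX⟩ := exists_isSyllableLength A B
  let s : D := if τ 0 then 1 else t γ
  have hs : s⁻¹ = s := by
    rw [inv_eq_iff_mul_eq_one]
    by_cases h : τ 0 = true <;> simp [s, h, ht]
  have hW : c ^ orderOf (π c) = W (orderOf (π c) * p : ℕ) := by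
    simpa using h.zpow_eq (orderOf (π c))
  have hτ : τ (orderOf (π c) * p : ℕ) = τ 0 := by
    simpa using h.type_add_mul hX 0 (orderOf (π c))
  refine ⟨s, fun k => ?_⟩
  rw [hs, pow_mul, ← map_pow]
  induction k with
  | zero => intro d; rw [pow_zero, pow_zero, mul_one]; nth_rw 1 [← hs]; simp
  | succ k ih =>
    intro d
    have e := twistedAction_apply ht hA hB h.line h.zero γ d (orderOf (π c) * p)
    rw [← hW, map_pow π, pow_orderOf_eq_one, one_mul, hτ] at e
    change _ = (γ, s * _ * s * d) at e
    rw [pow_succ, Equiv.Perm.mul_apply, e, ih]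
    have hss : ∀ d, s * (s * d) = d := fun d => by
      nth_rw 1 [← hs]; simp
    simp [pow_succ, mul_assoc, hss]

/-- If the axes are separated by `π`, then `π` can be refined so that the order of `c i` gets
multiplied by a given even number, and the orders of the other elements get at most doubled. -/
theorem exists_orderOf_eq_mul {ι : Type*} {τ : ι → ℤ → Bool} {W : ι → ℤ → A ∗ B} {c : ι → A ∗ B}
    {p : ι → ℕ} (h : ∀ j, IsAxis (factor A B) (τ j) (W j) (c j) (p j)) (i : ι)
    {Γ : Type (max uA uB)} [Group Γ] [Finite Γ] (π : A ∗ B →* Γ) {N : ℕ}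
    (ne : π (c i) ^ N ≠ 1)
    (inj : ∀ j n n', π (W j n) = π (W j n') → ((orderOf (π (c j)) * p j : ℕ) : ℤ) ∣ n - n')
    (sep : ∀ j ≠ i, ∀ n n', π (W j n') ≠ π (c i) ^ N * π (W j n))
    {m : ℕ} (hm : 0 < m) (heven : Even m) :
    ∃ (H : Type (max uA uB)) (_ : Group H) (_ : Finite H) (φ : A ∗ B →* H),
      orderOf (φ (c i)) = orderOf (π (c i)) * m ∧
      ∀ j ≠ i, φ (c j) ^ (orderOf (π (c j)) * 2) = 1 := by
  have : NeZero m := ⟨hm.ne'⟩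
  let ρ : DihedralGroup m := .sr 0
  let ρ' : DihedralGroup m := .sr 1
  have hρ : ρ ^ 2 = 1 := by simp [ρ, sq]
  have hρ' : ρ' ^ 2 = 1 := by simp [ρ', sq]
  have h1 : orderOf (ρ * ρ') = m := by simp [ρ, ρ']
  have h2 : orderOf (ρ' * ρ) = m := by
    rw [← orderOf_inv]
    simp [ρ, ρ']
  set y := π (c i) ^ N with hy
  let t : Γ → DihedralGroup m := twoPoint 1 y ρ ρ'
  have ht : ∀ γ, t γ * t γ = 1 := fun γ => by
    rw [← sq]
    simp only [t, twoPoint]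
    split_ifs <;> simp [hρ, hρ']
  obtain ⟨φ, hA, hB⟩ := exists_twistedAction π t ht
  have hγ : ∀ j (γ : Γ), Set.InjOn (fun k : ℕ => π (W j k) * γ)
      (Set.Icc 1 (orderOf (π (c j)) * p j)) := by
    intro j γ n hn n' hn' heq
    have hd := inj j n n' (mul_right_cancel heq)
    have := Int.eq_zero_of_abs_lt_dvd hd (by
      have := hn.1; have := hn.2; have := hn'.1; have := hn'.2
      rw [abs_lt]; constructor <;> omega)
    omega
  have hol := fun j γ => holonomy_twoPoint ne.symm ρ ρ' (hγ j γ)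
  have pow_eq_one : ∀ j k, (∀ γ, holonomy t (fun k => π (W j k) * γ)
      (orderOf (π (c j)) * p j) ^ k = 1) → φ (c j) ^ (orderOf (π (c j)) * k) = 1 := by
    intro j k hk
    ext1 ⟨γ, d⟩
    obtain ⟨s, hs⟩ := twistedAction_pow_apply ht hA hB (h j) γ
    rw [hs, hk]
    simp
  have fst : ∀ g γ d, (φ g (γ, d)).1 = π g * γ := by
    intro g
    induction g using factor_induction with
    | one => simp
    | mul b x g hx ih =>
      intro γ d
      rw [map_mul, map_mul, Equiv.Perm.mul_apply, mul_assoc, ← ih γ d]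
      cases b
      · rw [← Prod.mk.eta (p := φ g (γ, d)), hB x hx]
      · rw [← Prod.mk.eta (p := φ g (γ, d)), hA x hx]
  refine ⟨Equiv.Perm (Γ × DihedralGroup m), inferInstance, inferInstance, φ, ?_, fun j hj => ?_⟩
  · have hord : orderOf (holonomy t (fun k => π (W i k) * 1) (orderOf (π (c i)) * p i)) = m := by
      have hp := (h i).pos
      have hd := orderOf_pos (π (c i))
      have hWp : ∀ k : ℕ, π (W i (k * p i : ℕ)) = π (c i) ^ k := fun k => by
        rw [← map_pow]
        simpa using congrArg π ((h i).zpow_eq k).symm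
      have E : ∃ k ∈ Set.Icc 1 (orderOf (π (c i)) * p i), π (W i k) * 1 = 1 :=
        ⟨_, ⟨Nat.mul_pos hd hp, le_rfl⟩, by rw [mul_one, hWp, pow_orderOf_eq_one]⟩
      have E' : ∃ k ∈ Set.Icc 1 (orderOf (π (c i)) * p i), π (W i k) * 1 = y := by
        refine ⟨N % orderOf (π (c i)) * p i, ⟨Nat.mul_pos (Nat.pos_of_ne_zero fun h0 => ne ?_) hp,
          Nat.mul_le_mul_right _ (Nat.mod_lt _ hd).le⟩, by rw [mul_one, hWp, pow_mod_orderOf]⟩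
        rw [hy, ← pow_mod_orderOf, h0, pow_zero]
      rcases hol i 1 with h | h | h | ⟨-, -, h | h⟩
      · exact absurd E h.1
      · exact absurd E' h.2.1
      · exact absurd E h.1
      · rw [h, h1]
      · rw [h, h2]
    refine Nat.dvd_antisymm (orderOf_dvd_of_pow_eq_one (pow_eq_one i m fun γ => ?_)) ?_
    · obtain ⟨k, rfl⟩ := heven.two_dvd
      rcases hol i γ with h | h | h | ⟨-, -, h | h⟩
      · rw [h.2.2, one_pow]
      · rw [h.2.2, pow_mul, hρ, one_pow]
      · rw [h.2.2, pow_mul, hρ', one_pow]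
      · rw [h, ← orderOf_dvd_iff_pow_eq_one, h1]
      · rw [h, ← orderOf_dvd_iff_pow_eq_one, h2]
    · obtain ⟨k, hk⟩ : orderOf (π (c i)) ∣ orderOf (φ (c i)) := by
        refine orderOf_dvd_of_pow_eq_one ?_
        have := fst (c i ^ orderOf (φ (c i))) 1 1
        rw [map_pow, pow_orderOf_eq_one, map_pow] at this
        simpa using this.symm
      rw [hk]
      refine mul_dvd_mul_left _ ?_
      obtain ⟨s, hs⟩ := twistedAction_pow_apply ht hA hB (h i) 1
      have := hs k 1
      rw [← hk, pow_orderOf_eq_one] at this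
      rw [← hord]
      refine orderOf_dvd_of_pow_eq_one ((conj_eq_one_iff (a := s)).1 ?_)
      simpa using (congrArg Prod.snd this).symm
  · refine pow_eq_one j 2 fun γ => ?_
    rcases hol j γ with h | h | h | ⟨⟨n, -, hn⟩, ⟨n', -, hn'⟩, -⟩
    · rw [h.2.2, one_pow]
    · rw [h.2.2, hρ]
    · rw [h.2.2, hρ']
    · refine absurd ?_ (sep j hj n n')
      rw [eq_inv_of_mul_eq_one_left hn, ← hn', mul_inv_cancel_right]

theorem exists_orderOf_eq [Finite A] [Finite B] {n : ℕ} {u : Fin n → A ∗ B}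
    (hu : ∀ i g t, g * u i * g⁻¹ ∉ factor A B t)
    (hcyc : ∀ i j, i ≠ j →
      ¬ ∃ (g c : A ∗ B) (k l : ℤ), u i = c ^ k ∧ g * u j * g⁻¹ = c ^ l) (i : Fin n) :
    ∃ M : ℕ, 0 < M ∧ ∀ l : ℕ, 0 < l →
      ∃ (H : Type (max uA uB)) (_ : Group H) (_ : Finite H) (φ : A ∗ B →* H),
        orderOf (φ (u i)) = M * l ∧ ∀ j ≠ i, orderOf (φ (u j)) ∣ M := by
  obtain ⟨len, head, hX⟩ := exists_isSyllableLength A B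
  choose τ W c p h k hk g hg using fun j => exists_isAxis factor_induction (hu j)
  have hind : ∀ j ≠ i, ∀ a (m m' : ℤ), m ≠ 0 → c i ^ m ≠ a * c j ^ m' * a⁻¹ := by
    intro j hj a m m' hm heq
    obtain ⟨e, he⟩ := (h i).conj_mem_zpowers hX factor_induction (h j) hm heq
    refine hcyc i j hj.symm ⟨g i * a * (g j)⁻¹, g i * c i * (g i)⁻¹, k i, e * k j, ?_, ?_⟩
    · rw [conj_zpow, zpow_natCast, hg]
    · simp only at he
      rw [conj_zpow, zpow_mul, he, hg j, zpow_natCast, conj_pow]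
      group
  obtain ⟨Γ, _, _, π, N, ne, inj, sep⟩ := exists_separating_quotient h i hind
  have hΓ : 0 < Nat.card Γ := Nat.card_pos
  refine ⟨Nat.card Γ * 2, by positivity, fun l hl => ?_⟩
  obtain ⟨q, hq⟩ := orderOf_dvd_natCard (π (c i))
  have hq0 : 0 < q := Nat.pos_of_ne_zero fun h0 => by simp [h0] at hq; omega
  obtain ⟨H, _, _, φ, h1, h2⟩ := exists_orderOf_eq_mul h i π ne inj sep
    (m := k i * (2 * (q * l))) (by have := hk i; positivity)
    ((even_two_mul _).mul_left _)
  have hconj : ∀ j, φ (u j) = φ (g j) * φ (c j) ^ k j * (φ (g j))⁻¹ := fun j => by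
    simp [← map_pow, ← map_mul, ← map_inv, ← hg]
  refine ⟨H, inferInstance, inferInstance, φ, ?_, fun j hj => ?_⟩
  · rw [hconj, ← (SemiconjBy.conj_mk (φ (g i)) (φ (c i) ^ k i)).orderOf_eq,
      orderOf_pow_of_dvd (hk i).ne', h1]
    · rw [hq, mul_left_comm, Nat.mul_div_cancel_left _ (hk i)]
      ring
    · rw [h1, mul_left_comm]
      exact dvd_mul_right _ _
  · refine orderOf_dvd_of_pow_eq_one ?_
    obtain ⟨r, hr⟩ := orderOf_dvd_natCard (π (c j))
    rw [hconj, conj_pow, ← pow_mul, hr,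
      show k j * (orderOf (π (c j)) * r * 2) = orderOf (π (c j)) * 2 * (k j * r) by ring,
      pow_mul, h2 j hj]
    simp

end Monoid.Coprod

/-- Let `G = A ∗ B` be the free product of two finite groups.
If `u₁, …, uₙ ∈ G` are such that no `uᵢ` lies in a conjugate of `A` or `B`, and no two
distinct `uᵢ, uⱼ` lie in conjugate cyclic subgroups, then there is `K > 0` such that for
every sequence of positive integers `l₁, …, lₙ` there is a surjection `φ` of `G` onto a
finite group with `orderOf (φ uᵢ) = K * lᵢ` for all `i`. -/
theorem freeProduct_of_finite_omnipotence
    {A B : Type*} [Group A] [Group B] [Finite A] [Finite B]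
    (n : ℕ) (u : Fin n → A ∗ B)
    (hu : ∀ i, ¬ ∃ g : A ∗ B,
        g * u i * g⁻¹ ∈ (Monoid.Coprod.inl : A →* A ∗ B).range ∨
        g * u i * g⁻¹ ∈ (Monoid.Coprod.inr : B →* A ∗ B).range)
    (hcyc : ∀ i j, i ≠ j →
        ¬ ∃ (g c : A ∗ B) (k l : ℤ), u i = c ^ k ∧ g * u j * g⁻¹ = c ^ l) :
    ∃ K : ℕ, 0 < K ∧ ∀ l : Fin n → ℕ, (∀ i, 0 < l i) →
      ∃ (H : Type) (_ : Group H) (_ : Finite H) (φ : A ∗ B →* H),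
        Function.Surjective φ ∧ ∀ i, orderOf (φ (u i)) = K * l i := by
  have hu' : ∀ i g t, g * u i * g⁻¹ ∉ Monoid.Coprod.factor A B t := by
    rintro i g (_ | _) h
    · exact hu i ⟨g, .inr h⟩
    · exact hu i ⟨g, .inl h⟩
  choose M hM hφ using Monoid.Coprod.exists_orderOf_eq hu' hcyc
  refine ⟨∏ i, M i, Finset.prod_pos fun i _ => hM i, fun l hl => ?_⟩
  have hdvd : ∀ i, M i ∣ ∏ i, M i := fun i => Finset.dvd_prod_of_mem _ (Finset.mem_univ i)
  choose q hq using hdvd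
  have hq0 : ∀ i, 0 < q i := fun i => Nat.pos_of_ne_zero fun h0 =>
    (Finset.prod_pos fun i _ => hM i).ne' (by rw [hq i, h0, mul_zero])
  choose H _ _ φ h1 h2 using fun i => hφ i (q i * l i) (Nat.mul_pos (hq0 i) (hl i))
  let Φ : A ∗ B →* ∀ i, H i := MonoidHom.pi φ
  let e : Φ.range ≃* Shrink.{0} Φ.range := Shrink.mulEquiv.symm
  refine ⟨Shrink.{0} Φ.range, inferInstance, inferInstance, e.toMonoidHom.comp Φ.rangeRestrict,
    e.surjective.comp Φ.rangeRestrict_surjective, fun j => ?_⟩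
  have ho : orderOf (e.toMonoidHom.comp Φ.rangeRestrict (u j)) = orderOf (Φ (u j)) := by
    change orderOf (e (Φ.rangeRestrict (u j))) = _
    rw [MulEquiv.orderOf_eq, ← Subgroup.orderOf_coe]
    rfl
  have hj : orderOf (φ j (u j)) = (∏ i, M i) * l j := by rw [h1, ← mul_assoc, ← hq]
  rw [ho, ← hj]
  refine Nat.dvd_antisymm (orderOf_dvd_of_pow_eq_one (funext fun i => ?_))
    (orderOf_map_dvd (Pi.evalMonoidHom H j) (Φ (u j)))
  change φ i (u j) ^ _ = 1
  rw [← orderOf_dvd_iff_pow_eq_one]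
  by_cases hij : j = i
  · rw [hij]
  · rw [hj]
    exact ((h2 i j hij).trans ⟨q i, hq i⟩).mul_right _
end
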